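/- Let δ > −1. There exists a constant c > 0, depending only on d, κ and δ, such that for all integers n ≥ 1 and all x, y ∈ S^d: |K_n^δ(h_κ²;x,y)| ≤ c [ (∏_{j=1}^{d+1}(|x_j y_j| + n^{−1}‖x̄ − ȳ‖ + n^{−2})^{−κ_j}) / (n^{δ−(d−1)/2} (‖x̄ − ȳ‖ + n^{−1})^{δ+(d+1)/2}) + (∏_{j=1}^{d+1}(|x_j y_j| + ‖x̄ − ȳ‖² + n^{−2})^{−κ_j}) / (n (‖x̄ − ȳ‖ + n^{−1})^{d+1}) ]. -/

import Mathlib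

open MeasureTheory Finset Real

/-- Generalized binomial coefficient `C(x, k) = x (x-1) ⋯ (x-k+1) / k!`. -/
noncomputable def genBinom (x : ℝ) (k : ℕ) : ℝ :=
  (∏ i ∈ Finset.range k, (x - i)) / (Nat.factorial k)

/-- Jacobi polynomial `P_n^{(a,b)}(t)`. -/
noncomputable def jacobiP (n : ℕ) (a b t : ℝ) : ℝ :=
  ∑ m ∈ Finset.range (n + 1),
    genBinom (n + a) (n - m) * genBinom (n + b) m * ((t - 1) / 2) ^ m * ((t + 1) / 2) ^ (n - m)

/-- Pochhammer symbol `(a)_n`. -/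
noncomputable def poch (a : ℝ) (n : ℕ) : ℝ := ∏ i ∈ Finset.range n, (a + i)

/-- Gegenbauer polynomial `C_n^λ(t)`. -/
noncomputable def gegenC (n : ℕ) (l t : ℝ) : ℝ :=
  (poch (2 * l) n / poch (l + 1 / 2) n) * jacobiP n (l - 1 / 2) (l - 1 / 2) t

/-- Cesàro coefficient `A_m^δ = C(m+δ, m)`. -/
noncomputable def cesA (δ : ℝ) (m : ℕ) : ℝ := genBinom (m + δ) m

/-- The cube `[-1,1]^m`. -/
def cube (m : ℕ) : Set (Fin m → ℝ) := Set.univ.pi fun _ => Set.Icc (-1) 1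

/-- The weight `∏ (1+t_i)(1-t_i²)^{κ_i-1}` on the cube. -/
noncomputable def wprod {m : ℕ} (κ : Fin m → ℝ) (t : Fin m → ℝ) : ℝ :=
  ∏ i, (1 + t i) * (1 - t i ^ 2) ^ (κ i - 1)

/-- `λ_κ = |κ| + (d-1)/2`. -/
noncomputable def lamK (d : ℕ) (κ : Fin (d + 1) → ℝ) : ℝ := (∑ i, κ i) + ((d : ℝ) - 1) / 2

/-- The reproducing kernel `P_n(h_κ²; x, y)` on the sphere. -/
noncomputable def hP (d : ℕ) (κ : Fin (d + 1) → ℝ) (n : ℕ)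
    (x y : EuclideanSpace ℝ (Fin (d + 1))) : ℝ :=
  (∫ t in cube (d + 1), wprod κ t)⁻¹ * ((n + lamK d κ) / lamK d κ) *
    ∫ t in cube (d + 1), gegenC n (lamK d κ) (∑ i, x i * y i * t i) * wprod κ t

/-- The Cesàro `(C,δ)` kernel `K_n^δ(h_κ²; x, y)` on the sphere. -/
noncomputable def hK (d : ℕ) (κ : Fin (d + 1) → ℝ) (δ : ℝ) (n : ℕ)
    (x y : EuclideanSpace ℝ (Fin (d + 1))) : ℝ :=
  (cesA δ n)⁻¹ * ∑ k ∈ Finset.range (n + 1), cesA δ (n - k) * hP d κ k x y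

/-- `z̄ = (|z_1|, …, |z_{d+1}|)`. -/
noncomputable def ebar {m : ℕ} (z : EuclideanSpace ℝ (Fin m)) : EuclideanSpace ℝ (Fin m) :=
  (EuclideanSpace.equiv (Fin m) ℝ).symm fun i => |z i|

/-- `h_κ²(y) = ∏ |y_i|^{2κ_i}`. -/
noncomputable def hsq {m : ℕ} (κ : Fin m → ℝ) (y : EuclideanSpace ℝ (Fin m)) : ℝ :=
  ∏ i, |y i| ^ (2 * κ i)

/-- `σ_κ = (d-1)/2 + |κ| - min_i κ_i`. -/
noncomputable def sigmaK (d : ℕ) (κ : Fin (d + 1) → ℝ) : ℝ :=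
  ((d : ℝ) - 1) / 2 + (∑ i, κ i) - Finset.univ.inf' (Finset.univ_nonempty) κ

/-- The surface measure `dω` on the unit sphere `S^d`. -/
noncomputable def sphereMeas (d : ℕ) :
    Measure (Metric.sphere (0 : EuclideanSpace ℝ (Fin (d + 1))) 1) :=
  (volume : Measure (EuclideanSpace ℝ (Fin (d + 1)))).toSphere

theorem poch_succ (a : ℝ) (n : ℕ) : poch a (n + 1) = poch a n * (a + n) := by
  simp [poch, Finset.prod_range_succ]

theorem poch_pos {a : ℝ} (ha : 0 < a) (n : ℕ) : 0 < poch a n :=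
  Finset.prod_pos fun i _ => by positivity

theorem prod_range_sub_mul_poch (a : ℝ) (n k : ℕ) (hk : k ≤ n) :
    (∏ i ∈ Finset.range k, ((n : ℝ) + a - i)) * poch (a + 1) (n - k) = poch (a + 1) n := by
  induction k with
  | zero => simp
  | succ k ih =>
    have h1 : n - k = (n - (k + 1)) + 1 := by omega
    have h2 : ((n - (k + 1) : ℕ) : ℝ) = (n : ℝ) - k - 1 := by
      rw [Nat.cast_sub hk]; push_cast; ring
    rw [← ih (by omega), h1, poch_succ, Finset.prod_range_succ, h2]
    ring

theorem genBinom_add_eq {a : ℝ} (ha : -1 < a) {n k : ℕ} (hk : k ≤ n) :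
    genBinom (n + a) k = poch (a + 1) n / (poch (a + 1) (n - k) * Nat.factorial k) := by
  have h := prod_range_sub_mul_poch a n k hk
  have h1 := poch_pos (show 0 < a + 1 by linarith) (n - k)
  rw [genBinom, ← h]
  field_simp

theorem cesA_eq {δ : ℝ} (hδ : -1 < δ) (m : ℕ) :
    cesA δ m = poch (δ + 1) m / Nat.factorial m := by
  rw [cesA, genBinom_add_eq hδ le_rfl]
  simp [poch]

theorem cesA_pos {δ : ℝ} (hδ : -1 < δ) (m : ℕ) : 0 < cesA δ m := by
  rw [cesA_eq hδ]
  have := poch_pos (show 0 < δ + 1 by linarith) m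
  positivity

theorem cesA_succ {δ : ℝ} (hδ : -1 < δ) (m : ℕ) :
    ((m : ℝ) + 1) * cesA δ (m + 1) = (m + (δ + 1)) * cesA δ m := by
  rw [cesA_eq hδ, cesA_eq hδ, poch_succ, Nat.factorial_succ]
  push_cast
  field_simp
  ring

/-- The coefficients of `₀F₁(; a + 1; t)`. -/
noncomputable def besselCoeff (a : ℝ) (i : ℕ) : ℝ := 1 / (poch (a + 1) i * Nat.factorial i)

theorem besselCoeff_succ {a : ℝ} (ha : -1 < a) (i : ℕ) :
    ((i : ℝ) + 1) * (i + 1 + a) * besselCoeff a (i + 1) = besselCoeff a i := by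
  have h1 := poch_pos (show 0 < a + 1 by linarith) i
  have h2 : (0 : ℝ) < i + 1 + a := by have : (0 : ℝ) ≤ i := by positivity
                                      linarith
  have h3 : a + 1 + (i : ℝ) ≠ 0 := by linarith
  rw [besselCoeff, besselCoeff, poch_succ, Nat.factorial_succ]
  push_cast
  field_simp
  ring

/-- Weighted homogeneous sums attached to the product of two Bessel-type series. -/
noncomputable def besselSum (a x y : ℝ) (φ : ℝ → ℝ → ℝ) (n : ℕ) : ℝ :=
  ∑ p ∈ Finset.HasAntidiagonal.antidiagonal n,
    φ p.1 p.2 * (besselCoeff a p.1 * besselCoeff a p.2 * x ^ p.1 * y ^ p.2)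

theorem fst_mul_besselSum {a : ℝ} (ha : -1 < a) (x y : ℝ) (φ : ℝ → ℝ → ℝ) (n : ℕ) :
    x * besselSum a x y φ n =
      besselSum a x y (fun i j => i * (i + a) * φ (i - 1) j) (n + 1) := by
  rw [besselSum, besselSum, Finset.Nat.sum_antidiagonal_succ, Finset.mul_sum]
  simp only [Nat.cast_zero, zero_mul, zero_add]
  refine Finset.sum_congr rfl fun p _ => ?_
  rw [← besselCoeff_succ ha p.1]
  push_cast
  rw [add_sub_cancel_right]
  ring

theorem snd_mul_besselSum {a : ℝ} (ha : -1 < a) (x y : ℝ) (φ : ℝ → ℝ → ℝ) (n : ℕ) :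
    y * besselSum a x y φ n =
      besselSum a x y (fun i j => j * (j + a) * φ i (j - 1)) (n + 1) := by
  rw [besselSum, besselSum, Finset.Nat.sum_antidiagonal_succ', Finset.mul_sum]
  simp only [Nat.cast_zero, zero_mul, zero_add]
  refine Finset.sum_congr rfl fun p _ => ?_
  rw [← besselCoeff_succ ha p.2]
  push_cast
  rw [add_sub_cancel_right]
  ring

theorem gegenC_eq {l : ℝ} (hl : 0 < l) (n : ℕ) (u : ℝ) :
    gegenC n l u = poch (2 * l) n * poch (l + 1 / 2) n *
      besselSum (l - 1 / 2) ((u - 1) / 2) ((u + 1) / 2) (fun _ _ => 1) n := by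
  have ha : -1 < l - 1 / 2 := by linarith
  have e : l - 1 / 2 + 1 = l + 1 / 2 := by ring
  have h0 := poch_pos (show 0 < l + 1 / 2 by linarith)
  rw [gegenC, jacobiP, besselSum,
    Finset.Nat.sum_antidiagonal_eq_sum_range_succ_mk, Finset.mul_sum, Finset.mul_sum]
  refine Finset.sum_congr rfl fun m hm => ?_
  have hm' : m ≤ n := by simpa [Nat.lt_succ_iff] using hm
  rw [genBinom_add_eq ha (Nat.sub_le n m), genBinom_add_eq ha hm', besselCoeff, besselCoeff, e,
    Nat.sub_sub_self hm']
  have := h0 n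
  have := h0 m
  have := h0 (n - m)
  simp only [one_mul]
  field_simp

theorem gegenC_zero {l : ℝ} (u : ℝ) : gegenC 0 l u = 1 := by
  simp [gegenC, jacobiP, poch, genBinom]

theorem gegenC_one {l : ℝ} (hl : 0 < l) (u : ℝ) : gegenC 1 l u = 2 * l * u := by
  have h1 : l + 1 / 2 ≠ 0 := by linarith
  simp [gegenC, jacobiP, poch, genBinom, Finset.sum_range_succ]
  field_simp
  ring

theorem gegenC_add_two {l : ℝ} (hl : 0 < l) (n : ℕ) (u : ℝ) :
    ((n : ℝ) + 2) * gegenC (n + 2) l u =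
      2 * u * (n + 1 + l) * gegenC (n + 1) l u - (n + 2 * l) * gegenC n l u := by
  set x := (u - 1) / 2 with hx
  set y := (u + 1) / 2 with hy
  set a := l - 1 / 2 with ha'
  have ha : -1 < a := by rw [ha']; linarith
  set P : ℕ → ℝ := besselSum a x y (fun _ _ => 1) with hP
  have key : ((n : ℝ) + 2) * (2 * l + n + 1) * (l + 1 / 2 + n) * (l + 3 / 2 + n) * P (n + 2) =
      2 * (n + 1 + l) * (l + 1 / 2 + n) * (x * P (n + 1) + y * P (n + 1)) -
        (x * (x * P n) - 2 * (x * (y * P n)) + y * (y * P n)) := by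
    simp only [hP, fst_mul_besselSum ha, snd_mul_besselSum ha]
    simp only [besselSum, Finset.mul_sum, ← Finset.sum_add_distrib, ← Finset.sum_sub_distrib]
    refine Finset.sum_congr rfl fun p hp => ?_
    have hn : (n : ℝ) = p.1 + p.2 - 2 := by
      have : p.1 + p.2 = n + 2 := by simpa using hp
      have h2 : (p.1 : ℝ) + p.2 = n + 2 := by exact_mod_cast this
      linarith
    rw [hn, show l = a + 1 / 2 by rw [ha']; ring]
    ring
  have h1 : x + y = u := by rw [hx, hy]; ring
  have h2 : y - x = 1 := by rw [hx, hy]; ring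
  have key2 : ((n : ℝ) + 2) * (2 * l + n + 1) * (l + 1 / 2 + n) * (l + 3 / 2 + n) * P (n + 2) =
      2 * (n + 1 + l) * (l + 1 / 2 + n) * u * P (n + 1) - P n := by
    rw [key, ← h1]
    linear_combination (-(P n) * (y - x + 1)) * h2
  rw [gegenC_eq hl, gegenC_eq hl, gegenC_eq hl, poch_succ, poch_succ, poch_succ, poch_succ]
  push_cast
  linear_combination (poch (2 * l) n * poch (l + 1 / 2) n * (2 * l + n)) * key2

/-- The formal Taylor series at the origin. -/
noncomputable def taylorPS (f : ℂ → ℂ) : PowerSeries ℂ :=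
  PowerSeries.mk fun n => iteratedDeriv n f 0 / (Nat.factorial n : ℂ)

theorem coeff_taylorPS (f : ℂ → ℂ) (n : ℕ) :
    PowerSeries.coeff n (taylorPS f) = iteratedDeriv n f 0 / (Nat.factorial n : ℂ) := by
  simp [taylorPS]

theorem taylorPS_congr {f g : ℂ → ℂ} (h : f =ᶠ[nhds 0] g) : taylorPS f = taylorPS g := by
  ext n
  rw [coeff_taylorPS, coeff_taylorPS, h.iteratedDeriv_eq]

theorem taylorPS_mul {f g : ℂ → ℂ} (hf : AnalyticAt ℂ f 0) (hg : AnalyticAt ℂ g 0) :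
    taylorPS (fun z => f z * g z) = taylorPS f * taylorPS g := by
  ext n
  rw [PowerSeries.coeff_mul, coeff_taylorPS, iteratedDeriv_fun_mul hf.contDiffAt hg.contDiffAt,
    Finset.Nat.sum_antidiagonal_eq_sum_range_succ_mk, Finset.sum_div]
  refine Finset.sum_congr rfl fun i hi => ?_
  have hi' : i ≤ n := by simpa [Nat.lt_succ_iff] using hi
  rw [coeff_taylorPS, coeff_taylorPS]
  have h := Nat.choose_mul_factorial_mul_factorial hi'
  have h' : (n.choose i : ℂ) * (Nat.factorial i) * (Nat.factorial (n - i)) = Nat.factorial n := by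
    exact_mod_cast h
  have h1 : (Nat.factorial n : ℂ) ≠ 0 := by exact_mod_cast Nat.factorial_ne_zero n
  have h2 : (Nat.factorial i : ℂ) ≠ 0 := by exact_mod_cast Nat.factorial_ne_zero i
  have h3 : (Nat.factorial (n - i) : ℂ) ≠ 0 := by exact_mod_cast Nat.factorial_ne_zero (n - i)
  rw [div_mul_div_comm, div_eq_div_iff h1 (mul_ne_zero h2 h3), ← h']
  ring

theorem taylorPS_add {f g : ℂ → ℂ} (hf : AnalyticAt ℂ f 0) (hg : AnalyticAt ℂ g 0) :
    taylorPS (fun z => f z + g z) = taylorPS f + taylorPS g := by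
  ext n
  rw [map_add, coeff_taylorPS, coeff_taylorPS, coeff_taylorPS,
    iteratedDeriv_fun_add hf.contDiffAt hg.contDiffAt, add_div]

theorem taylorPS_const (c : ℂ) : taylorPS (fun _ => c) = PowerSeries.C c := by
  ext n
  rw [coeff_taylorPS, iteratedDeriv_const, PowerSeries.coeff_C]
  rcases eq_or_ne n 0 with rfl | h <;> simp [*]

theorem taylorPS_id : taylorPS (fun z => z) = PowerSeries.X := by
  ext n
  rw [coeff_taylorPS, iteratedDeriv_fun_id_zero, PowerSeries.coeff_X]
  rcases eq_or_ne n 1 with rfl | h <;> simp [*]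

theorem coeff_taylorPS_deriv (f : ℂ → ℂ) (n : ℕ) :
    PowerSeries.coeff n (taylorPS (deriv f)) =
      (n + 1) * PowerSeries.coeff (n + 1) (taylorPS f) := by
  rw [coeff_taylorPS, coeff_taylorPS, ← iteratedDeriv_succ', Nat.factorial_succ]
  have h1 : (Nat.factorial n : ℂ) ≠ 0 := by exact_mod_cast Nat.factorial_ne_zero n
  have h2 : (n : ℂ) + 1 ≠ 0 := by exact_mod_cast Nat.succ_ne_zero n
  push_cast
  field_simp

theorem coeff_taylorPS_id_mul_deriv {f : ℂ → ℂ} (hf : AnalyticAt ℂ f 0) (n : ℕ) :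
    PowerSeries.coeff n (taylorPS (fun z => z * deriv f z)) =
      n * PowerSeries.coeff n (taylorPS f) := by
  rw [taylorPS_mul (f := fun z => z) analyticAt_id hf.deriv, taylorPS_id]
  cases n with
  | zero => simp
  | succ n => rw [PowerSeries.coeff_succ_X_mul, coeff_taylorPS_deriv]; push_cast; ring

/-- The quadratic `1 - 2uz + z²`. -/
noncomputable def quad (u z : ℂ) : ℂ := 1 - 2 * u * z + z ^ 2

theorem one_sub_mem_slitPlane {z : ℂ} (hz : ‖z‖ < 1) : 1 - z ∈ Complex.slitPlane := by
  left
  have := (abs_le.1 (Complex.abs_re_le_norm z)).2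
  simp
  linarith

theorem quad_mem_slitPlane {u : ℝ} (hu : |u| ≤ 1) {z : ℂ} (hz : ‖z‖ < 1) :
    quad u z ∈ Complex.slitPlane := by
  have h1 : z.re ^ 2 + z.im ^ 2 < 1 := by
    have : ‖z‖ ^ 2 < 1 := by nlinarith [norm_nonneg z]
    rw [← Complex.normSq_eq_norm_sq, Complex.normSq_apply] at this
    nlinarith
  obtain ⟨hu1, hu2⟩ := abs_le.1 hu
  have hre : (quad u z).re = 1 - 2 * u * z.re + (z.re ^ 2 - z.im ^ 2) := by
    simp [quad, pow_two]
  have him : (quad u z).im = 2 * z.im * (z.re - u) := by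
    simp [quad, pow_two]; ring
  rw [Complex.mem_slitPlane_iff, hre, him]
  by_cases h : z.im = 0
  · left
    rw [h] at h1 ⊢
    nlinarith [mul_nonneg (sub_nonneg.2 hu2) (sub_nonneg.2 hu2), sq_nonneg (z.re - u), sq_nonneg (z.re + u), sq_nonneg (z.re - 1), sq_nonneg (z.re + 1)]
  · by_cases h' : z.re = u
    · left
      nlinarith
    · right
      exact mul_ne_zero (mul_ne_zero two_ne_zero h) (sub_ne_zero.2 h')

theorem quad_ne_zero {u : ℝ} (hu : |u| ≤ 1) {z : ℂ} (hz : ‖z‖ < 1) : quad u z ≠ 0 :=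
  Complex.slitPlane_ne_zero (quad_mem_slitPlane hu hz)

theorem hasDerivAt_quad (u z : ℂ) : HasDerivAt (quad u) (-2 * u + 2 * z) z := by
  have h1 : HasDerivAt (fun z : ℂ => 1 - 2 * u * z + z ^ 2) (-(2 * u * 1) + 2 * z) z := by
    have := (((hasDerivAt_id z).const_mul (2 * u)).const_sub 1).fun_add (hasDerivAt_pow 2 z)
    simpa using this
  have e : -2 * u + 2 * z = -(2 * u * 1) + 2 * z := by ring
  rw [e]
  exact h1

theorem hasDerivAt_quad_cpow {u : ℝ} (hu : |u| ≤ 1) {z : ℂ} (hz : ‖z‖ < 1) (c : ℂ) :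
    HasDerivAt (fun z => quad u z ^ c) (c * quad u z ^ (c - 1) * (-2 * u + 2 * z)) z := by
  exact (hasDerivAt_quad u z).cpow_const (quad_mem_slitPlane hu hz)

theorem analyticAt_quad_cpow {u : ℝ} (hu : |u| ≤ 1) {z : ℂ} (hz : ‖z‖ < 1) (c : ℂ) :
    AnalyticAt ℂ (fun z => quad u z ^ c) z := by
  refine AnalyticAt.cpow ?_ analyticAt_const (quad_mem_slitPlane hu hz)
  unfold quad
  fun_prop

theorem analyticAt_one_sub_cpow {z : ℂ} (hz : ‖z‖ < 1) (c : ℂ) :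
    AnalyticAt ℂ (fun z : ℂ => (1 - z) ^ c) z := by
  refine AnalyticAt.cpow ?_ analyticAt_const (one_sub_mem_slitPlane hz)
  fun_prop

theorem hasDerivAt_one_sub_cpow {z : ℂ} (hz : ‖z‖ < 1) (c : ℂ) :
    HasDerivAt (fun z : ℂ => (1 - z) ^ c) (-c * (1 - z) ^ (c - 1)) z := by
  have := ((hasDerivAt_id' z).const_sub 1).cpow_const (c := c) (one_sub_mem_slitPlane hz)
  convert this using 1
  ring

theorem ball_eventually : ∀ᶠ z : ℂ in nhds 0, ‖z‖ < 1 := by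
  have := Metric.ball_mem_nhds (0 : ℂ) one_pos
  filter_upwards [this] with z hz
  simpa using hz

theorem coeff_taylorPS_quad_cpow {l : ℝ} (hl : 0 < l) {u : ℝ} (hu : |u| ≤ 1) (n : ℕ) :
    PowerSeries.coeff n (taylorPS fun z => quad u z ^ (-l : ℂ)) = (gegenC n l u : ℂ) := by
  set f : ℂ → ℂ := fun z => quad u z ^ (-l : ℂ) with hf
  have hfa : AnalyticAt ℂ f 0 := analyticAt_quad_cpow hu (by simp) _
  have hqa : AnalyticAt ℂ (quad u) 0 := by unfold quad; fun_prop
  set s : ℕ → ℂ := fun n => PowerSeries.coeff n (taylorPS f) with hs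
  have hode : (fun z => quad u z * deriv f z) =ᶠ[nhds 0]
      fun z => (2 * l * u + -(2 * l) * z) * f z := by
    filter_upwards [ball_eventually] with z hz
    rw [(hasDerivAt_quad_cpow hu hz _).deriv, Complex.cpow_sub _ _ (quad_ne_zero hu hz)]
    have := quad_ne_zero hu hz
    simp only [Complex.cpow_one, hf]
    field_simp
    ring
  have hquad : taylorPS (quad u) = 1 + PowerSeries.C (-(2 * u) : ℂ) * PowerSeries.X +
      PowerSeries.X * PowerSeries.X := by
    have e : quad (u : ℂ) = fun z => ((1 : ℂ) + (-(2 * u)) * z) + z * z := by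
      funext z; simp only [quad]; ring
    have a1 : AnalyticAt ℂ (fun z : ℂ => (-(2 * u) : ℂ)) 0 := analyticAt_const
    rw [e, taylorPS_add (f := fun z => (1 : ℂ) + (-(2 * u)) * z) (g := fun z => z * z)
      (by fun_prop) (by fun_prop),
      taylorPS_add (f := fun z => (1 : ℂ)) (by fun_prop) (by fun_prop),
      taylorPS_mul (f := fun z => (-(2 * u) : ℂ)) (by fun_prop) (by fun_prop),
      taylorPS_mul (f := fun z => z) (by fun_prop) (by fun_prop), taylorPS_const, taylorPS_const,
      taylorPS_id, map_one]
  have hps := taylorPS_congr hode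
  rw [taylorPS_mul hqa hfa.deriv, hquad,
    taylorPS_mul (f := fun z => (2 * l * u + -(2 * l) * z)) (by fun_prop) hfa,
    taylorPS_add (f := fun z => (2 * l * u : ℂ)) (by fun_prop) (by fun_prop),
    taylorPS_mul (f := fun z => (-(2 * l) : ℂ)) (by fun_prop) (by fun_prop),
    taylorPS_const, taylorPS_const, taylorPS_id, add_mul, add_mul, add_mul, one_mul,
    mul_assoc (PowerSeries.C _) PowerSeries.X, mul_assoc (PowerSeries.C _) PowerSeries.X,
    mul_assoc PowerSeries.X PowerSeries.X] at hps
  have h0 : s 0 = 1 := by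
    simp only [hs, coeff_taylorPS, hf]
    simp [quad]
  have h1 : s 1 = 2 * l * u := by
    have h := congrArg (PowerSeries.coeff 0) hps
    rw [map_add, map_add, map_add, PowerSeries.coeff_C_mul, PowerSeries.coeff_C_mul,
      PowerSeries.coeff_C_mul, PowerSeries.coeff_zero_X_mul, PowerSeries.coeff_zero_X_mul,
      PowerSeries.coeff_zero_X_mul, coeff_taylorPS_deriv] at h
    change ((0 : ℕ) + 1) * s 1 + _ + _ = _ * s 0 + _ at h
    rw [h0] at h
    simpa using h
  have h2 : ∀ n : ℕ, ((n : ℂ) + 2) * s (n + 2) =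
      2 * u * (n + 1 + l) * s (n + 1) - (n + 2 * l) * s n := by
    intro n
    have h := congrArg (PowerSeries.coeff (n + 1)) hps
    rw [map_add, map_add, map_add, PowerSeries.coeff_C_mul, PowerSeries.coeff_C_mul,
      PowerSeries.coeff_C_mul, PowerSeries.coeff_succ_X_mul, PowerSeries.coeff_succ_X_mul,
      PowerSeries.coeff_succ_X_mul, coeff_taylorPS_deriv, coeff_taylorPS_deriv] at h
    cases n with
    | zero =>
      rw [PowerSeries.coeff_zero_X_mul] at h
      change (((0 + 1 : ℕ) : ℂ) + 1) * s 2 + _ * (_ * s 1) + _ = _ * s 1 + _ * s 0 at h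
      push_cast at h ⊢
      linear_combination h
    | succ n =>
      rw [PowerSeries.coeff_succ_X_mul, coeff_taylorPS_deriv] at h
      change (((n + 1 + 1 : ℕ) : ℂ) + 1) * s (n + 3) + _ * (_ * s (n + 2)) + (_ * s (n + 1))
        = _ * s (n + 2) + _ * s (n + 1) at h
      push_cast at h ⊢
      linear_combination h
  change s n = _
  induction n using Nat.strong_induction_on with
  | _ n ih =>
    match n, ih with
    | 0, _ => rw [h0, gegenC_zero]; simp
    | 1, _ => rw [h1, gegenC_one hl]; push_cast; ring
    | n + 2, ih =>
      have hne : ((n : ℂ) + 2) ≠ 0 := by exact_mod_cast (Nat.succ_ne_zero (n + 1))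
      apply mul_left_cancel₀ hne
      rw [h2, ih (n + 1) (by omega), ih n (by omega)]
      have := congrArg (fun r : ℝ => (r : ℂ)) (gegenC_add_two hl n u)
      push_cast at this
      rw [this]

theorem coeff_taylorPS_one_sub_cpow {δ : ℝ} (hδ : -1 < δ) (n : ℕ) :
    PowerSeries.coeff n (taylorPS fun z => (1 - z) ^ (-δ - 1 : ℂ)) = (cesA δ n : ℂ) := by
  set f : ℂ → ℂ := fun z => (1 - z) ^ (-δ - 1 : ℂ) with hf
  have hfa : AnalyticAt ℂ f 0 := analyticAt_one_sub_cpow (by simp) _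
  have hode : (fun z => (1 + (-1) * z) * deriv f z) =ᶠ[nhds 0] fun z => (δ + 1) * f z := by
    filter_upwards [ball_eventually] with z hz
    have := Complex.slitPlane_ne_zero (one_sub_mem_slitPlane hz)
    rw [(hasDerivAt_one_sub_cpow hz _).deriv, Complex.cpow_sub _ _ this]
    simp only [Complex.cpow_one, hf]
    field_simp
    ring
  have hps := taylorPS_congr hode
  rw [taylorPS_mul (f := fun z => (1 : ℂ) + (-1) * z) (by fun_prop) hfa.deriv,
    taylorPS_mul (f := fun z => (δ + 1 : ℂ)) (by fun_prop) hfa,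
    taylorPS_add (f := fun z => (1 : ℂ)) (by fun_prop) (by fun_prop),
    taylorPS_mul (f := fun z => (-1 : ℂ)) (by fun_prop) (by fun_prop),
    taylorPS_const, taylorPS_const, taylorPS_const, taylorPS_id, map_one, add_mul, one_mul,
    mul_assoc] at hps
  induction n with
  | zero =>
    rw [coeff_taylorPS, cesA_eq hδ]
    simp [hf, poch]
  | succ n ih =>
    have hne : ((n : ℂ) + 1) ≠ 0 := by exact_mod_cast (Nat.succ_ne_zero n)
    apply mul_left_cancel₀ hne
    have h := congrArg (PowerSeries.coeff n) hps
    rw [map_add, PowerSeries.coeff_C_mul, PowerSeries.coeff_C_mul, coeff_taylorPS_deriv] at h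
    have := congrArg (fun r : ℝ => (r : ℂ)) (cesA_succ hδ n)
    push_cast at this
    rw [this, ← ih]
    cases n with
    | zero =>
      rw [PowerSeries.coeff_zero_X_mul] at h
      push_cast at h ⊢
      linear_combination h
    | succ n =>
      rw [PowerSeries.coeff_succ_X_mul, coeff_taylorPS_deriv] at h
      push_cast at h ⊢
      linear_combination h

/-- The generating function of the unnormalized Cesàro kernels of Gegenbauer expansions. -/
noncomputable def cesGen (δ l u : ℝ) (z : ℂ) : ℂ :=
  (1 - z) ^ (-δ : ℂ) * (1 + z) * quad u z ^ (-(l + 1 : ℝ) : ℂ)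

theorem coeff_taylorPS_cesGen {δ : ℝ} (hδ : -1 < δ) {l : ℝ} (hl : 0 < l) {u : ℝ} (hu : |u| ≤ 1)
    (n : ℕ) :
    PowerSeries.coeff n (taylorPS (cesGen δ l u)) =
      ((∑ k ∈ Finset.range (n + 1), cesA δ (n - k) * ((k + l) / l * gegenC k l u) : ℝ) : ℂ) := by
  set f : ℂ → ℂ := fun z => quad u z ^ (-l : ℂ) with hf
  have hfa : AnalyticAt ℂ f 0 := analyticAt_quad_cpow hu (by simp) _
  set g : ℂ → ℂ := fun z => f z + (1 / l : ℂ) * (z * deriv f z) with hg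
  have hl' : (l : ℂ) ≠ 0 := by exact_mod_cast hl.ne'
  have hda := hfa.deriv
  have hga : AnalyticAt ℂ g 0 := by fun_prop
  have hha := analyticAt_one_sub_cpow (z := 0) (by simp) (-δ - 1 : ℂ)
  have key : cesGen δ l u =ᶠ[nhds 0] fun z => g z * (1 - z) ^ (-δ - 1 : ℂ) := by
    filter_upwards [ball_eventually] with z hz
    have h1 := Complex.slitPlane_ne_zero (one_sub_mem_slitPlane hz)
    have h2 := quad_ne_zero hu hz
    have e : (-(l + 1 : ℝ) : ℂ) = (-l : ℂ) - 1 := by push_cast; ring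
    simp only [cesGen, hg, hf]
    rw [(hasDerivAt_quad_cpow hu hz _).deriv, e, Complex.cpow_sub _ _ h2, Complex.cpow_sub _ _ h1]
    simp only [Complex.cpow_one]
    field_simp
    simp only [quad]
    ring
  have hgc : ∀ k, PowerSeries.coeff k (taylorPS g) = (((k + l) / l * gegenC k l u : ℝ) : ℂ) := by
    intro k
    rw [hg, taylorPS_add hfa (by fun_prop),
      taylorPS_mul (f := fun _ => (1 / l : ℂ)) (by fun_prop) (by fun_prop), taylorPS_const,
      map_add, PowerSeries.coeff_C_mul, coeff_taylorPS_id_mul_deriv hfa,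
      coeff_taylorPS_quad_cpow hl hu]
    push_cast
    field_simp
    ring
  rw [taylorPS_congr key, taylorPS_mul hga hha, PowerSeries.coeff_mul,
    Finset.Nat.sum_antidiagonal_eq_sum_range_succ_mk]
  push_cast
  refine Finset.sum_congr rfl fun k _ => ?_
  rw [hgc, coeff_taylorPS_one_sub_cpow hδ]
  push_cast
  ring

theorem hasDerivAt_mul_quad_cpow {u : ℝ} (hu : |u| ≤ 1) {z : ℂ} (hz : ‖z‖ < 1) (ν : ℂ)
    {g : ℂ → ℂ} {g' : ℂ} (hg : HasDerivAt g g' z) :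
    HasDerivAt (fun z => g z * quad u z ^ (-ν))
      (g' * quad u z ^ (-ν) + g z * (-ν * quad u z ^ (-ν - 1) * (-2 * u + 2 * z))) z :=
  hg.fun_mul (hasDerivAt_quad_cpow hu hz _)

theorem euler_mul_quad_cpow {u : ℝ} (hu : |u| ≤ 1) {z : ℂ} (hz : ‖z‖ < 1) (ν : ℂ)
    {g : ℂ → ℂ} {g' : ℂ} (hg : HasDerivAt g g' z) :
    z * deriv (fun z => g z * quad u z ^ (-ν)) z =
      (z * g' - ν * g z) * quad u z ^ (-ν) + ν * (1 - z ^ 2) * g z * quad u z ^ (-(ν + 1)) := by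
  have h2 := quad_ne_zero hu hz
  rw [(hasDerivAt_mul_quad_cpow hu hz ν hg).deriv, show -(ν + 1) = -ν - 1 by ring,
    Complex.cpow_sub _ _ h2, Complex.cpow_one]
  field_simp
  simp only [quad]
  ring

/-- `z d/dz` applied to `(1-z)^(-δ) (1+z)`, divided by `(1-z)^(-δ)`. -/
noncomputable def eulerA1 (δ : ℝ) (z : ℂ) : ℂ := z * (δ * (1 + z) / (1 - z) + 1)

/-- `(z d/dz)²` applied to `(1-z)^(-δ) (1+z)`, divided by `(1-z)^(-δ)`. -/
noncomputable def eulerA2 (δ : ℝ) (z : ℂ) : ℂ :=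
  δ * z / (1 - z) * eulerA1 δ z + eulerA1 δ z + 2 * δ * z ^ 2 / (1 - z) ^ 2

/-- Coefficients of `(z d/dz)²` of the generating function along powers of the quadratic. -/
noncomputable def cesB (δ μ : ℝ) (z : ℂ) : Fin 3 → ℂ :=
  ![eulerA2 δ z - 2 * μ * eulerA1 δ z + μ ^ 2 * (1 + z),
    μ * (1 - z ^ 2) * (2 * eulerA1 δ z - (2 * μ + 1) * (1 + z)) - 2 * μ * z ^ 2 * (1 + z),
    (μ + 1) * μ * (1 - z ^ 2) ^ 2 * (1 + z)]

theorem cesB_zero (δ μ : ℝ) (z : ℂ) :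
    cesB δ μ z 0 = eulerA2 δ z - 2 * μ * eulerA1 δ z + μ ^ 2 * (1 + z) := rfl

theorem cesB_one (δ μ : ℝ) (z : ℂ) : cesB δ μ z 1 =
    μ * (1 - z ^ 2) * (2 * eulerA1 δ z - (2 * μ + 1) * (1 + z)) - 2 * μ * z ^ 2 * (1 + z) := rfl

theorem cesB_two (δ μ : ℝ) (z : ℂ) :
    cesB δ μ z 2 = (μ + 1) * μ * (1 - z ^ 2) ^ 2 * (1 + z) := rfl

/-- `(z d/dz)²` of the generating function. -/
noncomputable def cesD2 (δ μ u : ℝ) (z : ℂ) : ℂ :=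
  ∑ k : Fin 3, (1 - z) ^ (-δ : ℂ) * cesB δ μ z k * quad u z ^ (-((μ + (k : ℕ) : ℝ)) : ℂ)

theorem hasDerivAt_eulerA1 (δ : ℝ) {z : ℂ} (hz : ‖z‖ < 1) :
    HasDerivAt (eulerA1 δ) (δ * (1 + z) / (1 - z) + 1 + z * (2 * δ / (1 - z) ^ 2)) z := by
  have h1 := Complex.slitPlane_ne_zero (one_sub_mem_slitPlane hz)
  have ha : HasDerivAt (fun z : ℂ => (δ : ℂ) * (1 + z)) δ z := by
    simpa using ((hasDerivAt_id' z).const_add 1).const_mul (δ : ℂ)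
  have hb : HasDerivAt (fun z : ℂ => 1 - z) (-1) z := (hasDerivAt_id' z).const_sub 1
  refine ((hasDerivAt_id' z).fun_mul ((ha.fun_div hb h1).add_const 1)).congr_deriv ?_
  field_simp
  ring

theorem euler_one_sub_cpow_mul (δ : ℝ) {z : ℂ} (hz : ‖z‖ < 1) {a : ℂ → ℂ} {a' : ℂ}
    (ha : HasDerivAt a a' z) :
    HasDerivAt (fun z => (1 - z) ^ (-δ : ℂ) * a z)
      ((1 - z) ^ (-δ : ℂ) * (δ / (1 - z) * a z + a')) z := by
  have h1 := Complex.slitPlane_ne_zero (one_sub_mem_slitPlane hz)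
  refine ((hasDerivAt_one_sub_cpow hz (-δ : ℂ)).fun_mul ha).congr_deriv ?_
  rw [Complex.cpow_sub _ _ h1, Complex.cpow_one]
  field_simp

theorem analyticAt_cesGen {u : ℝ} (hu : |u| ≤ 1) (δ l : ℝ) {z : ℂ} (hz : ‖z‖ < 1) :
    AnalyticAt ℂ (cesGen δ l u) z := by
  unfold cesGen
  have h1 := analyticAt_one_sub_cpow hz (-δ : ℂ)
  have h2 := analyticAt_quad_cpow hu hz (-(l + 1 : ℝ) : ℂ)
  fun_prop

theorem euler_cesGen {u : ℝ} (hu : |u| ≤ 1) (δ l : ℝ) {z : ℂ} (hz : ‖z‖ < 1) :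
    z * deriv (cesGen δ l u) z =
      (1 - z) ^ (-δ : ℂ) * (eulerA1 δ z - (l + 1) * (1 + z)) * quad u z ^ (-(l + 1) : ℂ) +
      (1 - z) ^ (-δ : ℂ) * ((l + 1) * (1 - z ^ 2) * (1 + z)) * quad u z ^ (-(l + 1 + 1) : ℂ) := by
  have h1 := Complex.slitPlane_ne_zero (one_sub_mem_slitPlane hz)
  have hg := euler_one_sub_cpow_mul δ hz ((hasDerivAt_id' z).const_add 1)
  have := euler_mul_quad_cpow hu hz (l + 1 : ℂ) hg
  have e : cesGen δ l u = fun z => (1 - z) ^ (-δ : ℂ) * (1 + z) * quad u z ^ (-(l + 1) : ℂ) := by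
    funext z; simp only [cesGen]; push_cast; rfl
  rw [e, this]
  unfold eulerA1
  field_simp

theorem euler_euler_cesGen {u : ℝ} (hu : |u| ≤ 1) (δ l : ℝ) {z : ℂ} (hz : ‖z‖ < 1) :
    z * deriv (fun z => z * deriv (cesGen δ l u) z) z = cesD2 δ (l + 1) u z := by
  have h1 := Complex.slitPlane_ne_zero (one_sub_mem_slitPlane hz)
  have hev : ∀ᶠ w : ℂ in nhds z, ‖w‖ < 1 := by
    have := Metric.isOpen_ball.mem_nhds (show z ∈ Metric.ball (0 : ℂ) 1 by simpa using hz)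
    filter_upwards [this] with w hw
    simpa using hw
  have hd : (fun z => z * deriv (cesGen δ l u) z) =ᶠ[nhds z] fun z =>
      (1 - z) ^ (-δ : ℂ) * (eulerA1 δ z - (l + 1) * (1 + z)) * quad u z ^ (-(l + 1) : ℂ) +
      (1 - z) ^ (-δ : ℂ) * ((l + 1) * (1 - z ^ 2) * (1 + z)) * quad u z ^ (-(l + 1 + 1) : ℂ) := by
    filter_upwards [hev] with w hw
    exact euler_cesGen hu δ l hw
  have hA := euler_one_sub_cpow_mul δ hz ((hasDerivAt_eulerA1 δ hz).fun_sub
    (((hasDerivAt_id' z).const_add 1).const_mul (l + 1 : ℂ)))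
  have hB := euler_one_sub_cpow_mul δ hz ((((hasDerivAt_pow 2 z).const_sub 1).const_mul
    (l + 1 : ℂ)).fun_mul ((hasDerivAt_id' z).const_add 1))
  have eA := euler_mul_quad_cpow hu hz (l + 1 : ℂ) hA
  have eB := euler_mul_quad_cpow hu hz (l + 1 + 1 : ℂ) hB
  rw [hd.deriv_eq, deriv_fun_add (hasDerivAt_mul_quad_cpow hu hz _ hA).differentiableAt
    (hasDerivAt_mul_quad_cpow hu hz _ hB).differentiableAt, mul_add, eA, eB]
  rw [cesD2, Fin.sum_univ_three, cesB_zero, cesB_one, cesB_two]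
  simp only [Fin.coe_ofNat_eq_mod]
  have e0 : (-((l + 1 + ((0 % 3 : ℕ) : ℝ) : ℝ) : ℂ)) = -(l + 1 : ℂ) := by push_cast; simp
  have e1 : (-((l + 1 + ((1 % 3 : ℕ) : ℝ) : ℝ) : ℂ)) = -(l + 1 + 1 : ℂ) := by push_cast; simp
  have e2 : (-((l + 1 + ((2 % 3 : ℕ) : ℝ) : ℝ) : ℂ)) = -(l + 1 + 1 + 1 : ℂ) := by
    norm_num; ring
  rw [e0, e1, e2]
  generalize quad u z ^ (-(l + 1 : ℂ)) = q0
  generalize quad u z ^ (-(l + 1 + 1 : ℂ)) = q1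
  generalize quad u z ^ (-(l + 1 + 1 + 1 : ℂ)) = q2
  generalize (1 - z) ^ (-δ : ℂ) = P
  unfold eulerA2 eulerA1
  push_cast
  field_simp
  ring

theorem differentiableAt_cesD2 {u : ℝ} (hu : |u| ≤ 1) (δ l : ℝ) {z : ℂ} (hz : ‖z‖ < 1) :
    DifferentiableAt ℂ (cesD2 δ (l + 1) u) z := by
  have hev : ∀ᶠ w : ℂ in nhds z, ‖w‖ < 1 := by
    have := Metric.isOpen_ball.mem_nhds (show z ∈ Metric.ball (0 : ℂ) 1 by simpa using hz)
    filter_upwards [this] with w hw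
    simpa using hw
  have h1 := (analyticAt_cesGen hu δ l hz).deriv
  have h2 : AnalyticAt ℂ (fun z => z * deriv (cesGen δ l u) z) z := by fun_prop
  have h3 := h2.deriv
  have h4 : AnalyticAt ℂ (fun z => z * deriv (fun z => z * deriv (cesGen δ l u) z) z) z := by
    fun_prop
  refine h4.differentiableAt.congr_of_eventuallyEq ?_
  filter_upwards [hev] with w hw
  exact (euler_euler_cesGen hu δ l hw).symm

theorem coeff_taylorPS_eq_integral {f : ℂ → ℂ} (hf : ∀ z : ℂ, ‖z‖ < 1 → DifferentiableAt ℂ f z)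
    {r : ℝ} (hr : 0 < r) (hr1 : r < 1) (n : ℕ) :
    PowerSeries.coeff n (taylorPS f) =
      (2 * π : ℂ)⁻¹ * ∫ θ in (0 : ℝ)..2 * π, ((circleMap 0 r θ) ^ n)⁻¹ * f (circleMap 0 r θ) := by
  have hc : DiffContOnCl ℂ f (Metric.ball 0 r) := by
    refine DifferentiableOn.diffContOnCl fun z hz => (hf z ?_).differentiableWithinAt
    have := Metric.closure_ball_subset_closedBall hz
    rw [mem_closedBall_zero_iff] at this
    linarith
  have h := hc.circleIntegral_one_div_sub_center_pow_smul hr n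
  rw [circleIntegral] at h
  have e : ∀ θ : ℝ, deriv (circleMap 0 r) θ • (1 / (circleMap 0 r θ - 0) ^ (n + 1)) •
      f (circleMap 0 r θ) = Complex.I * (((circleMap 0 r θ) ^ n)⁻¹ * f (circleMap 0 r θ)) := by
    intro θ
    have : circleMap 0 r θ ≠ 0 := circleMap_ne_center hr.ne'
    simp only [deriv_circleMap, smul_eq_mul, sub_zero]
    field_simp
    ring
  simp only [e] at h
  rw [intervalIntegral.integral_const_mul] at h
  rw [coeff_taylorPS]
  have hpi : (π : ℂ) ≠ 0 := by exact_mod_cast Real.pi_ne_zero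
  have hfac : (Nat.factorial n : ℂ) ≠ 0 := by exact_mod_cast Nat.factorial_ne_zero n
  simp only [smul_eq_mul] at h
  have h' := mul_left_cancel₀ Complex.I_ne_zero (h.trans
    (show _ = Complex.I * (2 * π / Nat.factorial n * iteratedDeriv n f 0) by ring))
  rw [h']
  field_simp

theorem sum_cesA_gegenC_eq_integral {δ : ℝ} (hδ : -1 < δ) {l : ℝ} (hl : 0 < l) {u : ℝ}
    (hu : |u| ≤ 1) {r : ℝ} (hr : 0 < r) (hr1 : r < 1) (n : ℕ) :
    (n : ℂ) ^ 2 * ((∑ k ∈ Finset.range (n + 1),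
        cesA δ (n - k) * ((k + l) / l * gegenC k l u) : ℝ) : ℂ) =
      (2 * π : ℂ)⁻¹ * ∫ θ in (0 : ℝ)..2 * π,
        ((circleMap 0 r θ) ^ n)⁻¹ * cesD2 δ (l + 1) u (circleMap 0 r θ) := by
  have h1 := analyticAt_cesGen hu δ l (z := 0) (by simp)
  have h1' := h1.deriv
  have h2 : AnalyticAt ℂ (fun z => z * deriv (cesGen δ l u) z) 0 := by fun_prop
  rw [← coeff_taylorPS_cesGen hδ hl hu,
    ← coeff_taylorPS_eq_integral (fun z hz => differentiableAt_cesD2 hu δ l hz) hr hr1, pow_two,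
    mul_assoc, ← coeff_taylorPS_id_mul_deriv h1, ← coeff_taylorPS_id_mul_deriv h2]
  congr 1
  refine taylorPS_congr ?_
  filter_upwards [ball_eventually] with z hz
  exact euler_euler_cesGen hu δ l hz

theorem intervalIntegrable_ofReal_rpow {p : ℝ} (hp : -1 < p) (a b : ℝ) :
    IntervalIntegrable (fun s : ℝ => ((s ^ p : ℝ) : ℂ)) volume a b :=
  ⟨(intervalIntegral.intervalIntegrable_rpow' hp).1.ofReal,
    (intervalIntegral.intervalIntegrable_rpow' hp).2.ofReal⟩

theorem hasDerivAt_cpow_mul_integral {κ : ℝ} (hκ : 0 < κ) {V : Set ℂ} (hV : IsOpen V)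
    (hVc : Convex ℝ V) (h0 : (0 : ℂ) ∈ V) {G : ℂ → ℂ} (hG : DifferentiableOn ℂ G V) {ω : ℂ}
    (hω : ω ∈ V) (hre : 0 < ω.re) :
    HasDerivAt (fun ω : ℂ => ω ^ (κ : ℂ) * ∫ s in (0 : ℝ)..1, ((s ^ (κ - 1) : ℝ) : ℂ) * G (ω * s))
      (ω ^ (κ - 1 : ℂ) * G ω) ω := by
  have hdG : ContinuousOn (deriv G) V := (hG.deriv hV).continuousOn
  have hseg : ∀ x ∈ V, ∀ s ∈ Set.Icc (0 : ℝ) 1, x * s ∈ V := by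
    intro x hx s hs
    have := hVc h0 hx (a := 1 - s) (b := s) (by linarith [hs.2]) hs.1 (by ring)
    simpa [mul_comm] using this
  obtain ⟨ε, hε, hball⟩ := Metric.isOpen_iff.1 hV ω hω
  have hcb : Metric.closedBall ω (ε / 2) ⊆ V :=
    (Metric.closedBall_subset_ball (by linarith)).trans hball
  have hK : IsCompact (Metric.closedBall ω (ε / 2) ×ˢ Set.Icc (0 : ℝ) 1) :=
    (isCompact_closedBall _ _).prod isCompact_Icc
  have hcont : ContinuousOn (fun p : ℂ × ℝ => deriv G (p.1 * p.2))
      (Metric.closedBall ω (ε / 2) ×ˢ Set.Icc (0 : ℝ) 1) := by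
    refine hdG.comp (by fun_prop) ?_
    rintro ⟨x, s⟩ ⟨hx, hs⟩
    exact hseg x (hcb hx) s hs
  obtain ⟨M, hM⟩ := hK.exists_bound_of_continuousOn hcont
  have hii : IntervalIntegrable (fun s : ℝ => ((s ^ (κ - 1) : ℝ) : ℂ)) volume 0 1 :=
    intervalIntegrable_ofReal_rpow (by linarith) _ _
  have hcG : ∀ x ∈ V, ContinuousOn (fun s : ℝ => G (x * s)) (Set.uIcc 0 1) := by
    intro x hx
    rw [Set.uIcc_of_le zero_le_one]
    exact hG.continuousOn.comp (by fun_prop) fun s hs => hseg x hx s hs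
  have hcG' : ContinuousOn (fun s : ℝ => (s : ℂ) * deriv G (ω * s)) (Set.uIcc 0 1) := by
    rw [Set.uIcc_of_le zero_le_one]
    exact (by fun_prop : ContinuousOn (fun s : ℝ => (s : ℂ)) (Set.Icc 0 1)).mul
      (hdG.comp (by fun_prop) fun s hs => hseg ω hω s hs)
  have hint : ∀ x ∈ V, IntervalIntegrable (fun s : ℝ => ((s ^ (κ - 1) : ℝ) : ℂ) * G (x * s))
      volume 0 1 := fun x hx => hii.mul_continuousOn (hcG x hx)
  have hint' : IntervalIntegrable
      (fun s : ℝ => ((s ^ (κ - 1) : ℝ) : ℂ) * (s * deriv G (ω * s))) volume 0 1 :=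
    hii.mul_continuousOn hcG'
  have hIcc : ∀ s ∈ Set.uIoc (0 : ℝ) 1, s ∈ Set.Icc (0 : ℝ) 1 := by
    intro s hs
    rw [Set.uIoc_of_le zero_le_one] at hs
    exact Set.Ioc_subset_Icc_self hs
  have hder := (intervalIntegral.hasDerivAt_integral_of_dominated_loc_of_deriv_le
    (μ := volume) (a := 0) (b := 1)
    (F := fun x s => ((s ^ (κ - 1) : ℝ) : ℂ) * G (x * s))
    (F' := fun x s => ((s ^ (κ - 1) : ℝ) : ℂ) * (s * deriv G (x * s)))
    (x₀ := ω) (s := Metric.closedBall ω (ε / 2)) (bound := fun s => s ^ (κ - 1) * M)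
    (Metric.closedBall_mem_nhds _ (by linarith))
    (by
      filter_upwards [hV.mem_nhds hω] with x hx
      exact ((intervalIntegrable_iff.1 (hint x hx)).aestronglyMeasurable))
    (hint ω hω) (intervalIntegrable_iff.1 hint').aestronglyMeasurable
    (by
      refine Filter.Eventually.of_forall fun s hs x hx => ?_
      have hs' := hIcc s hs
      rw [norm_mul, norm_mul, Complex.norm_real, Complex.norm_real, Real.norm_eq_abs,
        Real.norm_eq_abs, abs_of_nonneg (Real.rpow_nonneg hs'.1 _), abs_of_nonneg hs'.1]
      refine mul_le_mul_of_nonneg_left ?_ (Real.rpow_nonneg hs'.1 _)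
      have h1 := hM (x, s) ⟨hx, hs'⟩
      have h2 := norm_nonneg (deriv G (x * s))
      have := mul_le_mul_of_nonneg_right hs'.2 h2
      simp only at h1
      linarith)
    ((intervalIntegral.intervalIntegrable_rpow' (by linarith)).mul_const M)
    (by
      refine Filter.Eventually.of_forall fun s hs x hx => ?_
      have hs' := hIcc s hs
      have hd := (hG.differentiableAt (hV.mem_nhds (hseg x (hcb hx) s hs'))).hasDerivAt
      have h2 : HasDerivAt (fun x : ℂ => x * (s : ℂ)) (s : ℂ) x := by
        simpa using (hasDerivAt_id' x).mul_const (s : ℂ)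
      have h3 := (HasDerivAt.comp x hd h2).const_mul ((s ^ (κ - 1) : ℝ) : ℂ)
      refine h3.congr_deriv ?_
      ring)).2
  have hω0 : ω ≠ 0 := by rintro rfl; simp at hre
  have hpow : HasDerivAt (fun ω : ℂ => ω ^ (κ : ℂ)) (κ * ω ^ (κ - 1 : ℂ)) ω := by
    simpa using (hasDerivAt_id' ω).cpow_const (c := (κ : ℂ)) (Or.inl hre)
  have hprod := hpow.fun_mul hder
  refine hprod.congr_deriv ?_
  have hparts : ∫ s in (0 : ℝ)..1, (κ * (((s ^ (κ - 1) : ℝ) : ℂ) * G (ω * s)) +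
      ω * (((s ^ (κ - 1) : ℝ) : ℂ) * (s * deriv G (ω * s)))) = G ω := by
    have := intervalIntegral.integral_eq_sub_of_hasDerivAt_of_le (a := 0) (b := 1) zero_le_one
      (f := fun s : ℝ => ((s ^ κ : ℝ) : ℂ) * G (ω * s))
      (f' := fun s : ℝ => (κ * (((s ^ (κ - 1) : ℝ) : ℂ) * G (ω * s)) +
      ω * (((s ^ (κ - 1) : ℝ) : ℂ) * (s * deriv G (ω * s)))))
      (by
        have := hcG ω hω
        rw [Set.uIcc_of_le zero_le_one] at this
        refine ContinuousOn.mul ?_ this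
        exact Complex.continuous_ofReal.comp_continuousOn
          (continuousOn_id.rpow_const fun _ _ => Or.inr hκ.le))
      (by
        intro s hs
        have hd := (hG.differentiableAt (hV.mem_nhds
          (hseg ω hω s (Set.Ioo_subset_Icc_self hs)))).hasDerivAt
        have h2 : HasDerivAt (fun s : ℝ => ω * (s : ℂ)) ω s := by
          simpa using (hasDerivAt_id' s).ofReal_comp.const_mul ω
        have h3 := HasDerivAt.comp s hd h2
        have h4 := (Real.hasDerivAt_rpow_const (x := s) (p := κ) (Or.inl hs.1.ne')).ofReal_comp
        refine (h4.fun_mul h3).congr_deriv ?_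
        have h5 : s ^ κ = s ^ (κ - 1) * s := by
          rw [Real.rpow_sub hs.1, Real.rpow_one]; field_simp [hs.1.ne']
        simp only [Function.comp]
        rw [h5]
        push_cast
        ring)
      (((hint ω hω).const_mul _).add (hint'.const_mul _))
    rw [this]
    simp [Real.zero_rpow hκ.ne']
  rw [intervalIntegral.integral_add ((hint ω hω).const_mul _) (hint'.const_mul _),
    intervalIntegral.integral_const_mul, intervalIntegral.integral_const_mul] at hparts
  rw [← hparts]
  have e : ω ^ (κ : ℂ) = ω ^ (κ - 1 : ℂ) * ω := by
    rw [Complex.cpow_sub _ _ hω0, Complex.cpow_one]; field_simp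
  rw [e]
  ring

theorem jacobiWeight_eq {κ : ℝ} (hκ : 0 < κ) {t : ℝ} (ht : t ∈ Set.Icc (-1 : ℝ) 1) :
    (1 + t) * (1 - t ^ 2) ^ (κ - 1) = (1 + t) ^ κ * (1 - t) ^ (κ - 1) := by
  rcases eq_or_lt_of_le ht.1 with h | h
  · subst h
    norm_num [Real.zero_rpow hκ.ne']
  · have h1 : 0 < 1 + t := by linarith
    have h2 : 0 ≤ 1 - t := by linarith [ht.2]
    rw [show 1 - t ^ 2 = (1 + t) * (1 - t) by ring, Real.mul_rpow h1.le h2,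
      Real.rpow_sub h1, Real.rpow_one]
    field_simp

theorem intervalIntegrable_jacobiWeight {κ : ℝ} (hκ : 0 < κ) :
    IntervalIntegrable (fun t : ℝ => (1 + t) * (1 - t ^ 2) ^ (κ - 1)) volume (-1) 1 := by
  have h1 : IntervalIntegrable (fun t : ℝ => (1 - t) ^ (κ - 1)) volume (-1) 1 := by
    have := (intervalIntegral.intervalIntegrable_rpow' (a := 0) (b := 2)
      (show -1 < κ - 1 by linarith)).comp_sub_left 1
    norm_num at this
    exact this.symm
  have h2 : ContinuousOn (fun t : ℝ => (1 + t) ^ κ) (Set.uIcc (-1) 1) :=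
    ContinuousOn.rpow_const (by fun_prop) fun _ _ => Or.inr hκ.le
  refine (h1.continuousOn_mul h2).congr fun t ht => ?_
  rw [Set.uIoc_of_le (by norm_num)] at ht
  exact (jacobiWeight_eq hκ (Set.Ioc_subset_Icc_self ht)).symm

theorem integral_jacobiWeight_eq_contour {κ : ℝ} (hκ : 0 < κ) (a : ℝ) {H : ℂ → ℂ}
    (hH : DifferentiableOn ℂ H {z | 0 < z.re}) {ξ : ℂ} (hξ : 0 < ξ.re) {ω : ℂ} (hω0 : 0 < ω.re)
    (hω2 : ω.re < 2) (hω : -ξ.re < -a * ω.im) :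
    ∫ t in (-1 : ℝ)..1, H (ξ - Complex.I * (a * t)) * (((1 + t) * (1 - t ^ 2) ^ (κ - 1) : ℝ) : ℂ) =
      (ω ^ (κ : ℂ) * ∫ s in (0 : ℝ)..1, ((s ^ (κ - 1) : ℝ) : ℂ) *
        ((2 - ω * s) ^ (κ : ℂ) * H (ξ - Complex.I * (a * (1 - ω * s))))) +
      (2 - ω) ^ ((κ + 1 : ℝ) : ℂ) * ∫ s in (0 : ℝ)..1, ((s ^ (κ + 1 - 1) : ℝ) : ℂ) *
        ((2 - (2 - ω) * s) ^ (κ - 1 : ℂ) * H (ξ - Complex.I * (a * (-1 + (2 - ω) * s)))) := by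
  set U : Set ℂ := {ω | 0 < ω.re ∧ ω.re < 2 ∧ -ξ.re < -a * ω.im} with hU
  set V : ℝ → Set ℂ := fun b => {ω | ω.re < 2 ∧ -ξ.re < b * ω.im} with hV
  have hVo : ∀ b, IsOpen (V b) := by
    intro b
    exact (isOpen_lt Complex.continuous_re continuous_const).inter
      (isOpen_lt continuous_const (continuous_const.mul Complex.continuous_im))
  have hVc : ∀ b, Convex ℝ (V b) := by
    intro b
    refine Convex.inter (convex_halfSpace_re_lt 2) ?_
    have : IsLinearMap ℝ fun z : ℂ => b * z.im :=
      ⟨fun x y => by simp; ring, fun c x => by simp; ring⟩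
    exact convex_halfSpace_gt this _
  have hUo : IsOpen U := (isOpen_lt continuous_const Complex.continuous_re).inter (hVo (-a))
  have hUc : Convex ℝ U := (convex_halfSpace_re_gt 0).inter (hVc (-a))
  set G₁ : ℂ → ℂ := fun x => (2 - x) ^ (κ : ℂ) * H (ξ - Complex.I * (a * (1 - x))) with hG₁
  set G₂ : ℂ → ℂ := fun x => (2 - x) ^ (κ - 1 : ℂ) * H (ξ - Complex.I * (a * (-1 + x))) with hG₂
  have hHo : IsOpen {z : ℂ | 0 < z.re} := isOpen_lt continuous_const Complex.continuous_re
  have hslit : ∀ b, ∀ x ∈ V b, 2 - x ∈ Complex.slitPlane := by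
    intro b x hx
    left
    have := hx.1
    simp
    linarith
  have hd₁ : DifferentiableOn ℂ G₁ (V (-a)) := by
    intro x hx
    have h1 : DifferentiableAt ℂ (fun x : ℂ => (2 - x) ^ (κ : ℂ)) x :=
      (DifferentiableAt.cpow_const (by fun_prop) (hslit _ x hx))
    have h2 : DifferentiableAt ℂ H (ξ - Complex.I * (a * (1 - x))) := by
      refine hH.differentiableAt (hHo.mem_nhds ?_)
      have := hx.2
      simp
      linarith
    exact (h1.mul (h2.comp (f := fun x => ξ - Complex.I * (a * (1 - x))) x
      (by fun_prop))).differentiableWithinAt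
  have hd₂ : DifferentiableOn ℂ G₂ (V a) := by
    intro x hx
    have h1 : DifferentiableAt ℂ (fun x : ℂ => (2 - x) ^ (κ - 1 : ℂ)) x :=
      (DifferentiableAt.cpow_const (by fun_prop) (hslit _ x hx))
    have h2 : DifferentiableAt ℂ H (ξ - Complex.I * (a * (-1 + x))) := by
      refine hH.differentiableAt (hHo.mem_nhds ?_)
      have := hx.2
      simp
      linarith
    exact (h1.mul (h2.comp (f := fun x => ξ - Complex.I * (a * (-1 + x))) x
      (by fun_prop))).differentiableWithinAt
  have h0 : ∀ b, (0 : ℂ) ∈ V b := fun b => by simp [hV, hξ]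
  set f : ℂ → ℂ := fun ω => (ω ^ (κ : ℂ) * ∫ s in (0 : ℝ)..1, ((s ^ (κ - 1) : ℝ) : ℂ) * G₁ (ω * s)) +
      (2 - ω) ^ ((κ + 1 : ℝ) : ℂ) * ∫ s in (0 : ℝ)..1, ((s ^ (κ + 1 - 1) : ℝ) : ℂ) *
        G₂ ((2 - ω) * s) with hf
  have hder : ∀ x ∈ U, HasDerivAt f 0 x := by
    intro x hx
    have d1 := hasDerivAt_cpow_mul_integral hκ (hVo (-a)) (hVc (-a)) (h0 _) hd₁ (ω := x) hx.2 hx.1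
    have hx2 : 2 - x ∈ V a := by
      refine ⟨?_, ?_⟩
      · simpa using hx.1
      · have := hx.2.2
        simpa using this
    have d2 := hasDerivAt_cpow_mul_integral (κ := κ + 1) (by linarith) (hVo a) (hVc a) (h0 _) hd₂
      (ω := 2 - x) hx2 (by have := hx.2.1; simp; linarith)
    have d3 := d1.fun_add (HasDerivAt.comp x d2 ((hasDerivAt_id' x).const_sub 2))
    refine d3.congr_deriv ?_
    have e1 : (2 : ℂ) - (2 - x) = x := by ring
    have e2 : ((κ + 1 : ℝ) : ℂ) - 1 = κ := by push_cast; ring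
    have e3 : -1 + (2 - x) = 1 - x := by ring
    simp only [hG₁, hG₂]
    rw [e1, e2, e3]
    ring
  have h1U : (1 : ℂ) ∈ U := by simp [hU, hξ]
  have hωU : ω ∈ U := ⟨hω0, hω2, hω⟩
  have hconst : f 1 = f ω := hUo.is_const_of_deriv_eq_zero hUc.isPreconnected
    (fun x hx => (hder x hx).differentiableAt.differentiableWithinAt)
    (fun x hx => (hder x hx).deriv) h1U hωU
  refine Eq.trans ?_ hconst
  set φ : ℝ → ℂ := fun t => H (ξ - Complex.I * (a * t)) *
    (((1 + t) * (1 - t ^ 2) ^ (κ - 1) : ℝ) : ℂ) with hφ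
  have hint : IntervalIntegrable φ volume (-1) 1 := by
    have hw := intervalIntegrable_jacobiWeight hκ
    have hw' : IntervalIntegrable (fun t : ℝ => (((1 + t) * (1 - t ^ 2) ^ (κ - 1) : ℝ) : ℂ))
        volume (-1) 1 := ⟨hw.1.ofReal, hw.2.ofReal⟩
    refine hw'.continuousOn_mul ?_
    refine hH.continuousOn.comp (by fun_prop) ?_
    intro t _
    simp [hξ]
  have hsub : ∀ {c d : ℝ}, c ∈ Set.Icc (-1 : ℝ) 1 → d ∈ Set.Icc (-1 : ℝ) 1 →
      IntervalIntegrable φ volume c d := by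
    intro c d hc hd
    refine hint.mono_set ?_
    rw [Set.uIcc_of_le (by norm_num : (-1 : ℝ) ≤ 1)]
    exact Set.uIcc_subset_Icc hc hd
  rw [← intervalIntegral.integral_add_adjacent_intervals (a := -1) (b := 0) (c := 1)
    (hsub (by norm_num) (by norm_num)) (hsub (by norm_num) (by norm_num)), add_comm]
  simp only [hf]
  congr 1
  · have := intervalIntegral.integral_comp_sub_left (a := 0) (b := 1) φ 1
    rw [sub_self, sub_zero] at this
    rw [← this, Complex.one_cpow, one_mul]
    refine intervalIntegral.integral_congr fun s hs => ?_
    rw [Set.uIcc_of_le zero_le_one] at hs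
    have h2 : (2 - (1 : ℂ) * s) ^ (κ : ℂ) = (((2 - s) ^ κ : ℝ) : ℂ) := by
      rw [Complex.ofReal_cpow (by linarith [hs.2])]; push_cast; ring_nf
    simp only [hφ, hG₁]
    rw [jacobiWeight_eq hκ ⟨by linarith [hs.2], by linarith [hs.1]⟩, h2,
      show 1 + (1 - s) = 2 - s by ring, show 1 - (1 - s) = s by ring]
    push_cast
    ring_nf
  · have := intervalIntegral.integral_comp_add_left (a := 0) (b := 1) φ (-1)
    rw [add_zero, show (-1 : ℝ) + 1 = 0 by norm_num] at this
    rw [← this]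
    have e1 : (2 - 1 : ℂ) = 1 := by norm_num
    rw [e1, Complex.one_cpow, one_mul]
    refine intervalIntegral.integral_congr fun s hs => ?_
    rw [Set.uIcc_of_le zero_le_one] at hs
    have h2 : (2 - (1 : ℂ) * s) ^ (κ - 1 : ℂ) = (((2 - s) ^ (κ - 1) : ℝ) : ℂ) := by
      rw [Complex.ofReal_cpow (by linarith [hs.2])]; push_cast; ring_nf
    simp only [hφ, hG₂]
    rw [jacobiWeight_eq hκ ⟨by linarith [hs.1], by linarith [hs.2]⟩, h2,
      show 1 + (-1 + s) = s by ring, show 1 - (-1 + s) = 2 - s by ring,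
      show κ + 1 - 1 = κ by ring]
    push_cast
    ring_nf

theorem integral_rpow_mul_rpow_le {κ ν D α : ℝ} (hκ : 0 < κ) (hν : κ + 1 ≤ ν) (hD : 0 < D)
    (hα : 0 ≤ α) :
    ∫ s in (0 : ℝ)..1, s ^ (κ - 1) * (D + α * s) ^ (-ν) ≤
      κ⁻¹ * (D ^ (κ - ν) * (D + α) ^ (-κ)) := by
  have hpos : ∀ s ∈ Set.Icc (0 : ℝ) 1, 0 < D + α * s := fun s hs => by
    have := mul_nonneg hα hs.1
    linarith
  have hcont : ∀ p : ℝ, ContinuousOn (fun s : ℝ => (D + α * s) ^ p) (Set.Icc 0 1) := fun p =>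
    ContinuousOn.rpow_const (by fun_prop) fun s hs => Or.inl (hpos s hs).ne'
  have hint : ∀ p : ℝ, IntervalIntegrable (fun s : ℝ => s ^ (κ - 1) * (D + α * s) ^ p)
      volume 0 1 := fun p => by
    refine (intervalIntegral.intervalIntegrable_rpow' (by linarith)).mul_continuousOn ?_
    rw [Set.uIcc_of_le zero_le_one]
    exact hcont p
  have hftc := intervalIntegral.integral_eq_sub_of_hasDerivAt_of_le (a := 0) (b := 1) zero_le_one
    (f := fun s : ℝ => s ^ κ * (D + α * s) ^ (-κ))
    (f' := fun s : ℝ => (κ * D) * (s ^ (κ - 1) * (D + α * s) ^ (-κ - 1)))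
    ((continuousOn_id.rpow_const fun _ _ => Or.inr hκ.le).mul (hcont _))
    (by
      intro s hs
      have hp := hpos s (Set.Ioo_subset_Icc_self hs)
      have h1 := Real.hasDerivAt_rpow_const (x := s) (p := κ) (Or.inl hs.1.ne')
      have h2 : HasDerivAt (fun s : ℝ => D + α * s) α s := by
        simpa using ((hasDerivAt_id' s).const_mul α).const_add D
      have h3 := h2.rpow_const (p := -κ) (Or.inl hp.ne')
      refine (h1.fun_mul h3).congr_deriv ?_
      have e1 : s ^ κ = s ^ (κ - 1) * s := by
        rw [Real.rpow_sub hs.1, Real.rpow_one]; field_simp [hs.1.ne']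
      have e2 : (D + α * s) ^ (-κ) = (D + α * s) ^ (-κ - 1) * (D + α * s) := by
        rw [Real.rpow_sub hp, Real.rpow_one]; field_simp
      rw [e1, e2]
      ring)
    ((hint _).const_mul _)
  rw [intervalIntegral.integral_const_mul] at hftc
  simp only [Real.zero_rpow hκ.ne', Real.one_rpow, zero_mul, sub_zero, one_mul, mul_one] at hftc
  have hle : ∫ s in (0 : ℝ)..1, s ^ (κ - 1) * (D + α * s) ^ (-ν) ≤
      ∫ s in (0 : ℝ)..1, D ^ (κ + 1 - ν) * (s ^ (κ - 1) * (D + α * s) ^ (-κ - 1)) := by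
    refine intervalIntegral.integral_mono_on zero_le_one (hint _) ((hint _).const_mul _) ?_
    intro s hs
    have hp := hpos s hs
    have e : (D + α * s) ^ (-ν) = (D + α * s) ^ (κ + 1 - ν) * (D + α * s) ^ (-κ - 1) := by
      rw [← Real.rpow_add hp]; ring_nf
    have hmono : (D + α * s) ^ (κ + 1 - ν) ≤ D ^ (κ + 1 - ν) :=
      Real.rpow_le_rpow_of_nonpos hD (by linarith [mul_nonneg hα hs.1]) (by linarith)
    have h1 := Real.rpow_nonneg hs.1 (κ - 1)
    have h2 := Real.rpow_nonneg hp.le (-κ - 1)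
    rw [e]
    calc _ = (D + α * s) ^ (κ + 1 - ν) * (s ^ (κ - 1) * (D + α * s) ^ (-κ - 1)) := by ring
      _ ≤ _ := mul_le_mul_of_nonneg_right hmono (mul_nonneg h1 h2)
  refine hle.trans (le_of_eq ?_)
  rw [intervalIntegral.integral_const_mul, ← hftc]
  have e : D ^ (κ + 1 - ν) = D ^ (κ - ν) * D := by
    rw [show κ + 1 - ν = κ - ν + 1 by ring, Real.rpow_add hD, Real.rpow_one]
  rw [e]
  field_simp

/-- The sign attached to a Boolean. -/
def boolSign (b : Bool) : ℝ := if b then 1 else -1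

theorem norm_integral_jacobiWeight_le {κ : ℝ} (hκ : 0 < κ) (a : ℝ) {H : ℂ → ℂ}
    (hH : DifferentiableOn ℂ H {z | 0 < z.re}) {ξ : ℂ} (hξ : 0 < ξ.re) :
    ‖∫ t in (-1 : ℝ)..1, H (ξ - Complex.I * (a * t)) *
        (((1 + t) * (1 - t ^ 2) ^ (κ - 1) : ℝ) : ℂ)‖ ≤
      2 ^ (κ + 1) * 4 ^ κ * ∑ b : Bool, ∫ s in (0 : ℝ)..1, s ^ (κ - 1) *
        ‖H (ξ - Complex.I * (a * boolSign b) + (|a| + Complex.I * (a * boolSign b)) * s)‖ := by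
  obtain ⟨η, hη, hηa⟩ : ∃ η : ℝ, |η| = 1 ∧ -a * η = |a| := by
    rcases le_total 0 a with h | h
    · exact ⟨-1, by norm_num, by rw [abs_of_nonneg h]; ring⟩
    · exact ⟨1, by norm_num, by rw [abs_of_nonpos h]; ring⟩
  have hηa' : (-a * η : ℂ) = (|a| : ℝ) := by rw [← hηa]; push_cast; ring
  set ω : ℂ := 1 + Complex.I * η with hω
  have hre : ω.re = 1 := by simp [hω]
  have him : ω.im = η := by simp [hω]
  rw [integral_jacobiWeight_eq_contour hκ a hH hξ (ω := ω) (by rw [hre]; norm_num)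
    (by rw [hre]; norm_num) (by rw [him, hηa]; linarith [abs_nonneg a]), Fintype.sum_bool, mul_add]
  have hI : ‖Complex.I * (η : ℂ)‖ = 1 := by simp [hη]
  have hn1 : ‖ω‖ ≤ 2 := by
    refine (norm_add_le _ _).trans ?_
    rw [hI]; norm_num
  have hn2 : ‖2 - ω‖ ≤ 2 := by
    have : 2 - ω = 1 - Complex.I * η := by rw [hω]; ring
    rw [this]
    refine (norm_sub_le _ _).trans ?_
    rw [hI]; norm_num
  have hbase : ∀ x : ℂ, ‖x‖ ≤ 2 → x.re = 1 → ∀ s ∈ Set.Ioc (0 : ℝ) 1,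
      1 ≤ ‖2 - x * s‖ ∧ ‖2 - x * s‖ ≤ 4 := by
    intro x hx hxr s hs
    constructor
    · have := (abs_le.1 (Complex.abs_re_le_norm (2 - x * s))).2
      simp [hxr] at this
      linarith [hs.2]
    · refine (norm_sub_le _ _).trans ?_
      rw [norm_mul, Complex.norm_real, Real.norm_eq_abs, abs_of_pos hs.1]
      have : ‖x‖ * s ≤ 2 * 1 := mul_le_mul hx hs.2 hs.1.le (by norm_num)
      norm_num at this ⊢
      linarith
  have hcont : ∀ b : Bool, ContinuousOn (fun s : ℝ => ‖H (ξ - Complex.I * (a * boolSign b) +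
      (|a| + Complex.I * (a * boolSign b)) * s)‖) (Set.uIcc 0 1) := by
    intro b
    rw [Set.uIcc_of_le zero_le_one]
    refine ContinuousOn.norm (hH.continuousOn.comp (by fun_prop) ?_)
    intro s hs
    have := mul_nonneg (abs_nonneg a) hs.1
    simp
    linarith
  have hint : ∀ b : Bool, IntervalIntegrable (fun s : ℝ => s ^ (κ - 1) *
      ‖H (ξ - Complex.I * (a * boolSign b) + (|a| + Complex.I * (a * boolSign b)) * s)‖)
      volume 0 1 := fun b =>
    (intervalIntegral.intervalIntegrable_rpow' (by linarith)).mul_continuousOn (hcont b)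
  have h2κ : (2 : ℝ) ^ κ ≤ 2 ^ (κ + 1) :=
    Real.rpow_le_rpow_of_exponent_le (by norm_num) (by linarith)
  have haux : ∀ {p q p' q' N : ℝ}, p ≤ p' → q ≤ q' → 0 ≤ q → 0 ≤ p' → 0 ≤ N →
      q * (p * N) ≤ p' * (q' * N) := fun h1 h2 h3 h4 h5 => by
    calc _ = _ := (mul_left_comm _ _ _)
      _ ≤ _ := mul_le_mul h1 (mul_le_mul_of_nonneg_right h2 h5) (mul_nonneg h3 h5) h4
  refine (norm_add_le _ _).trans (add_le_add ?_ ?_)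
  · rw [norm_mul, Complex.norm_cpow_real, mul_assoc]
    refine mul_le_mul ((Real.rpow_le_rpow (norm_nonneg _) hn1 hκ.le).trans h2κ) ?_
      (norm_nonneg _) (by positivity)
    rw [← intervalIntegral.integral_const_mul]
    refine intervalIntegral.norm_integral_le_of_norm_le zero_le_one ?_ ((hint true).const_mul _)
    refine Filter.Eventually.of_forall fun s hs => ?_
    have hp := Real.rpow_nonneg hs.1.le (κ - 1)
    have hb := (hbase ω hn1 hre s hs).2
    rw [norm_mul, norm_mul, Complex.norm_real, Complex.norm_cpow_real, Real.norm_eq_abs,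
      abs_of_nonneg hp]
    have earg : ξ - Complex.I * (a * (1 - ω * s)) =
        ξ - Complex.I * (a * boolSign true) + (|a| + Complex.I * (a * boolSign true)) * s := by
      rw [← hηa', hω]
      simp only [boolSign, if_true]
      push_cast
      linear_combination (a * η * s : ℂ) * Complex.I_sq
    rw [earg]
    exact haux (Real.rpow_le_rpow (norm_nonneg _) hb hκ.le) le_rfl hp (by positivity)
      (norm_nonneg _)
  · rw [norm_mul, Complex.norm_cpow_real, mul_assoc]
    refine mul_le_mul (Real.rpow_le_rpow (norm_nonneg _) hn2 (by linarith)) ?_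
      (norm_nonneg _) (by positivity)
    rw [← intervalIntegral.integral_const_mul]
    refine intervalIntegral.norm_integral_le_of_norm_le zero_le_one ?_ ((hint false).const_mul _)
    refine Filter.Eventually.of_forall fun s hs => ?_
    have hp := Real.rpow_nonneg hs.1.le (κ - 1)
    have hb := hbase (2 - ω) hn2 (by simp [hre]; norm_num) s hs
    rw [norm_mul, norm_mul, Complex.norm_real, show (κ - 1 : ℂ) = ((κ - 1 : ℝ) : ℂ) by push_cast; rfl,
      Complex.norm_cpow_real, Real.norm_eq_abs, abs_of_nonneg (Real.rpow_nonneg hs.1.le _)]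
    have earg : ξ - Complex.I * (a * (-1 + (2 - ω) * s)) =
        ξ - Complex.I * (a * boolSign false) + (|a| + Complex.I * (a * boolSign false)) * s := by
      rw [← hηa', hω]
      simp only [boolSign]
      push_cast
      simp
      linear_combination (a * η * s : ℂ) * Complex.I_sq
    have hs1 : s ^ (κ + 1 - 1) ≤ s ^ (κ - 1) :=
      Real.rpow_le_rpow_of_exponent_ge hs.1 hs.2 (by linarith)
    have hb1 : ‖2 - (2 - ω) * s‖ ^ (κ - 1) ≤ 4 ^ κ :=
      (Real.rpow_le_rpow_of_exponent_le hb.1 (by linarith)).trans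
        (Real.rpow_le_rpow (norm_nonneg _) hb.2 hκ.le)
    rw [earg]
    exact haux hb1 hs1 (Real.rpow_nonneg hs.1.le _) (by positivity) (norm_nonneg _)

/-- Lebesgue measure on the cube, as a product measure. -/
noncomputable abbrev cubeMeas (m : ℕ) : Measure (Fin m → ℝ) :=
  Measure.pi fun _ => volume.restrict (Set.Icc (-1) 1)

theorem restrict_cube (m : ℕ) :
    (volume : Measure (Fin m → ℝ)).restrict (cube m) = cubeMeas m := by
  rw [cube, volume_pi, Measure.restrict_pi_pi]

theorem integrable_wprod {m : ℕ} {κ : Fin m → ℝ} (hκ : ∀ i, 0 < κ i) :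
    Integrable (wprod κ) (cubeMeas m) := by
  unfold wprod
  refine Integrable.fintype_prod (f := fun i (t : ℝ) => (1 + t) * (1 - t ^ 2) ^ (κ i - 1))
    fun i => ?_
  have := (intervalIntegrable_jacobiWeight (hκ i)).1
  exact (integrableOn_Icc_iff_integrableOn_Ioc (by finiteness)).2 this

theorem ae_mem_cube (m : ℕ) : ∀ᵐ t ∂(cubeMeas m), t ∈ cube m := by
  rw [← restrict_cube]
  exact ae_restrict_mem (MeasurableSet.univ_pi fun _ => measurableSet_Icc)

theorem re_sub_I_mul (ξ : ℂ) (x : ℝ) : (ξ - Complex.I * x).re = ξ.re := by simp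

theorem sub_I_mul_mem_slitPlane {ξ : ℂ} (hξ : 0 < ξ.re) (x : ℝ) :
    ξ - Complex.I * x ∈ Complex.slitPlane := by
  left
  rwa [re_sub_I_mul]

theorem norm_cpow_neg_le {c ν : ℝ} (hc : 0 < c) (hν : 0 ≤ ν) {z : ℂ} (hz : c ≤ z.re) :
    ‖z ^ (-ν : ℂ)‖ ≤ c ^ (-ν) := by
  rw [show (-ν : ℂ) = ((-ν : ℝ) : ℂ) by push_cast; rfl, Complex.norm_cpow_real]
  exact Real.rpow_le_rpow_of_nonpos hc (hz.trans ((le_abs_self _).trans (Complex.abs_re_le_norm z)))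
    (by linarith)

/-- The Riesz type integral over the cube. -/
noncomputable def cubeJ {m : ℕ} (κ a : Fin m → ℝ) (ν : ℝ) (ξ : ℂ) : ℂ :=
  ∫ t, (ξ - Complex.I * ((∑ i, a i * t i : ℝ) : ℂ)) ^ (-ν : ℂ) * (wprod κ t : ℂ) ∂(cubeMeas m)

theorem continuous_cubeJ_kernel {m : ℕ} (a : Fin m → ℝ) (ν : ℂ) {ξ : ℂ} (hξ : 0 < ξ.re) :
    Continuous fun t : Fin m → ℝ => (ξ - Complex.I * ((∑ i, a i * t i : ℝ) : ℂ)) ^ ν := by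
  refine Continuous.cpow (by fun_prop) continuous_const fun t => sub_I_mul_mem_slitPlane hξ _

theorem integrable_cubeJ_integrand {m : ℕ} {κ : Fin m → ℝ} (hκ : ∀ i, 0 < κ i) (a : Fin m → ℝ)
    {ν : ℝ} (hν : 0 ≤ ν) {ξ : ℂ} (hξ : 0 < ξ.re) :
    Integrable (fun t => (ξ - Complex.I * ((∑ i, a i * t i : ℝ) : ℂ)) ^ (-ν : ℂ) * (wprod κ t : ℂ))
      (cubeMeas m) := by
  refine (integrable_wprod hκ).ofReal.bdd_mul (c := ξ.re ^ (-ν))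
    (continuous_cubeJ_kernel a _ hξ).aestronglyMeasurable (Filter.Eventually.of_forall fun t => ?_)
  exact norm_cpow_neg_le hξ hν (by rw [re_sub_I_mul])

theorem differentiableOn_cubeJ {m : ℕ} {κ : Fin m → ℝ} (hκ : ∀ i, 0 < κ i) (a : Fin m → ℝ)
    {ν : ℝ} (hν : 0 ≤ ν) : DifferentiableOn ℂ (cubeJ κ a ν) {z | 0 < z.re} := by
  intro ξ hξ
  have hξ : 0 < ξ.re := hξ
  have hball : ∀ x ∈ Metric.ball ξ (ξ.re / 2), ξ.re / 2 ≤ x.re := by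
    intro x hx
    rw [Metric.mem_ball, dist_eq_norm] at hx
    have := (abs_le.1 (Complex.abs_re_le_norm (x - ξ))).1
    rw [Complex.sub_re] at this
    linarith
  have h := hasDerivAt_integral_of_dominated_loc_of_deriv_le (μ := cubeMeas m)
    (F := fun x t => (x - Complex.I * ((∑ i, a i * t i : ℝ) : ℂ)) ^ (-ν : ℂ) * (wprod κ t : ℂ))
    (F' := fun x t => (-ν * (x - Complex.I * ((∑ i, a i * t i : ℝ) : ℂ)) ^ (-(ν + 1 : ℝ) : ℂ)) *
      (wprod κ t : ℂ)) (x₀ := ξ) (s := Metric.ball ξ (ξ.re / 2))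
    (bound := fun t => (ν * (ξ.re / 2) ^ (-(ν + 1))) * ‖wprod κ t‖)
    (Metric.ball_mem_nhds _ (by linarith))
    (by
      filter_upwards [Metric.ball_mem_nhds ξ (show 0 < ξ.re / 2 by linarith)] with x hx
      exact (integrable_cubeJ_integrand hκ a hν (by linarith [hball x hx])).aestronglyMeasurable)
    (integrable_cubeJ_integrand hκ a hν hξ)
    (((continuous_cubeJ_kernel a _ hξ).aestronglyMeasurable.const_mul _).mul
      (integrable_wprod hκ).ofReal.aestronglyMeasurable)
    (by
      refine Filter.Eventually.of_forall fun t x hx => ?_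
      rw [norm_mul, norm_mul, Complex.norm_real, norm_neg, Complex.norm_real,
        Real.norm_of_nonneg hν]
      refine mul_le_mul_of_nonneg_right (mul_le_mul_of_nonneg_left ?_ hν) (norm_nonneg _)
      exact norm_cpow_neg_le (by linarith) (by linarith)
        (by rw [re_sub_I_mul]; exact hball x hx))
    ((integrable_wprod hκ).norm.const_mul _)
    (by
      refine Filter.Eventually.of_forall fun t x hx => ?_
      have hx' : 0 < x.re := by linarith [hball x hx]
      have := ((hasDerivAt_id' x).sub_const (Complex.I * ((∑ i, a i * t i : ℝ) : ℂ))).cpow_const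
        (c := (-ν : ℂ)) (sub_I_mul_mem_slitPlane hx' _)
      refine (this.mul_const _).congr_deriv ?_
      rw [show (-ν - 1 : ℂ) = -(ν + 1 : ℝ) by push_cast; ring]
      ring)
  exact h.2.differentiableAt.differentiableWithinAt

theorem cubeJ_zero (κ a : Fin 0 → ℝ) (ν : ℝ) (ξ : ℂ) : cubeJ κ a ν ξ = ξ ^ (-ν : ℂ) := by
  rw [cubeJ, cubeMeas, Measure.pi_of_empty _ 0, integral_dirac]
  simp [wprod]

theorem cubeJ_succ {m : ℕ} {κ : Fin (m + 1) → ℝ} (hκ : ∀ i, 0 < κ i) (a : Fin (m + 1) → ℝ)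
    {ν : ℝ} (hν : 0 ≤ ν) {ξ : ℂ} (hξ : 0 < ξ.re) :
    cubeJ κ a ν ξ = ∫ t in (-1 : ℝ)..1,
      cubeJ (fun i => κ i.succ) (fun i => a i.succ) ν (ξ - Complex.I * (a 0 * t)) *
        (((1 + t) * (1 - t ^ 2) ^ (κ 0 - 1) : ℝ) : ℂ) := by
  have mp := (measurePreserving_piFinSuccAbove
    (fun _ : Fin (m + 1) => (volume : Measure ℝ).restrict (Set.Icc (-1) 1)) 0).symm
  have hint := integrable_cubeJ_integrand hκ a hν hξ
  rw [← mp.integrable_comp_emb (MeasurableEquiv.measurableEmbedding _)] at hint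
  simp only [Function.comp_def] at hint
  rw [cubeJ, ← mp.integral_comp (MeasurableEquiv.measurableEmbedding _), integral_prod _ hint,
    intervalIntegral.integral_of_le (by norm_num), ← integral_Icc_eq_integral_Ioc]
  refine integral_congr_ae (Filter.Eventually.of_forall fun t => ?_)
  simp only
  rw [cubeJ, ← integral_mul_const]
  refine integral_congr_ae (Filter.Eventually.of_forall fun t' => ?_)
  have e : (MeasurableEquiv.piFinSuccAbove (fun _ : Fin (m + 1) => ℝ) 0).symm (t, t') =
      (Fin.cons t t' : Fin (m + 1) → ℝ) := by
    simp [MeasurableEquiv.piFinSuccAbove]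
    rfl
  simp only
  rw [e, wprod, Fin.sum_univ_succ, Fin.prod_univ_succ]
  simp only [Fin.cons_zero, Fin.cons_succ, wprod]
  push_cast
  ring_nf

/-- The bound for `cubeJ` attached to one vertex of the cube. -/
noncomputable def jBound {m : ℕ} (κ a : Fin m → ℝ) (ν x : ℝ) : ℝ :=
  x ^ (∑ i, κ i - ν) * ∏ i, (x + |a i|) ^ (-κ i)

theorem jBound_nonneg {m : ℕ} (κ a : Fin m → ℝ) (ν : ℝ) {x : ℝ} (hx : 0 ≤ x) :
    0 ≤ jBound κ a ν x :=
  mul_nonneg (Real.rpow_nonneg hx _)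
    (Finset.prod_nonneg fun i _ => Real.rpow_nonneg (by positivity) _)

theorem jBound_le_of_le {m : ℕ} {κ : Fin m → ℝ} (hκ : ∀ i, 0 < κ i) (a : Fin m → ℝ)
    {ν D E y : ℝ} (hν : ∑ i, κ i ≤ ν) (hD : 0 < D) (hDE : D ≤ E) (hy : E ≤ 4 * y) :
    jBound κ a ν y ≤ 4 ^ ν * (E ^ (∑ i, κ i - ν) * ∏ i, (D + |a i|) ^ (-κ i)) := by
  have hE : 0 < E := hD.trans_le hDE
  have h1 : y ^ (∑ i, κ i - ν) ≤ 4 ^ (ν - ∑ i, κ i) * E ^ (∑ i, κ i - ν) := by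
    refine (Real.rpow_le_rpow_of_nonpos (x := E / 4) (by positivity) (by linarith)
      (by linarith)).trans (le_of_eq ?_)
    rw [Real.div_rpow hE.le (by norm_num), show ν - ∑ i, κ i = -(∑ i, κ i - ν) by ring,
      Real.rpow_neg (by norm_num)]
    field_simp
  have h2 : ∏ i, (y + |a i|) ^ (-κ i) ≤ ∏ i, (4 ^ κ i * (D + |a i|) ^ (-κ i)) := by
    refine Finset.prod_le_prod (fun i _ => Real.rpow_nonneg ?_ _) fun i _ => ?_
    · have := abs_nonneg (a i); linarith
    · have ha := abs_nonneg (a i)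
      have hp : 0 < (D + |a i|) := by linarith
      refine (Real.rpow_le_rpow_of_nonpos (x := (D + |a i|) / 4) (by positivity) (by linarith)
        (by linarith [hκ i])).trans (le_of_eq ?_)
      rw [Real.div_rpow hp.le (by norm_num), Real.rpow_neg (x := 4) (by norm_num)]
      field_simp
  have h3 : ∏ i, (4 ^ κ i * (D + |a i|) ^ (-κ i)) =
      4 ^ (∑ i, κ i) * ∏ i, (D + |a i|) ^ (-κ i) := by
    rw [Finset.prod_mul_distrib, Real.rpow_sum_of_pos (by norm_num)]
  rw [h3] at h2
  have hpn : 0 ≤ ∏ i, (y + |a i|) ^ (-κ i) := Finset.prod_nonneg fun i _ =>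
    Real.rpow_nonneg (by have := abs_nonneg (a i); linarith) _
  calc jBound κ a ν y ≤ (4 ^ (ν - ∑ i, κ i) * E ^ (∑ i, κ i - ν)) *
        (4 ^ (∑ i, κ i) * ∏ i, (D + |a i|) ^ (-κ i)) := mul_le_mul h1 h2 hpn (by positivity)
    _ = _ := by
      have : (4 : ℝ) ^ ν = 4 ^ (ν - ∑ i, κ i) * 4 ^ (∑ i, κ i) := by
        rw [← Real.rpow_add (by norm_num)]; ring_nf
      rw [this]; ring

theorem norm_add_mul_ge {x : ℂ} (hx : 0 < x.re) {a b s : ℝ} (hb : |b| = 1) (hs : 0 ≤ s) :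
    ‖x‖ + |a| * s ≤ 4 * ‖x + (|a| + Complex.I * (a * b)) * s‖ := by
  have h1 : |a| * s ≤ ‖x + (|a| + Complex.I * (a * b)) * s‖ := by
    refine le_trans ?_ (Complex.re_le_norm _)
    simp
    linarith
  have h2 : ‖(|a| + Complex.I * (a * b)) * s‖ ≤ 2 * (|a| * s) := by
    rw [norm_mul, Complex.norm_real, Real.norm_of_nonneg hs]
    have : ‖((|a| : ℝ) : ℂ) + Complex.I * (a * b)‖ ≤ 2 * |a| := by
      refine (norm_add_le _ _).trans ?_
      simp [hb]
      linarith
    nlinarith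
  have h3 := norm_sub_norm_le (x + (|a| + Complex.I * (a * b)) * s) (x + (|a| + Complex.I * (a * b)) * s - x)
  have h4 : ‖x‖ ≤ ‖x + (|a| + Complex.I * (a * b)) * s‖ + ‖(|a| + Complex.I * (a * b)) * s‖ := by
    simpa using norm_sub_le (x + (|a| + Complex.I * (a * b)) * s) ((|a| + Complex.I * (a * b)) * s)
  linarith

theorem abs_boolSign (b : Bool) : |boolSign b| = 1 := by cases b <;> simp [boolSign]

theorem norm_cubeJ_le {m : ℕ} {κ : Fin m → ℝ} (hκ : ∀ i, 0 < κ i) {ν : ℝ}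
    (hν : ∑ i, κ i + 1 ≤ ν) : ∃ C : ℝ, 0 < C ∧ ∀ (a : Fin m → ℝ) (ξ : ℂ), 0 < ξ.re →
      ‖cubeJ κ a ν ξ‖ ≤ C * ∑ ε : Fin m → Bool,
        jBound κ a ν ‖ξ - Complex.I * ((∑ i, a i * boolSign (ε i) : ℝ) : ℂ)‖ := by
  induction m with
  | zero =>
    refine ⟨1, one_pos, fun a ξ hξ => ?_⟩
    rw [cubeJ_zero, show (-ν : ℂ) = ((-ν : ℝ) : ℂ) by push_cast; rfl, Complex.norm_cpow_real]
    simp [jBound]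
  | succ m ih =>
    rw [Fin.sum_univ_succ] at hν
    have hκ' : ∀ i : Fin m, 0 < κ i.succ := fun i => hκ _
    have hsum : 0 ≤ ∑ i : Fin m, κ i.succ := Finset.sum_nonneg fun i _ => (hκ' i).le
    have h0 := hκ 0
    obtain ⟨C, hC, hb⟩ := ih hκ' (by linarith)
    refine ⟨2 ^ (κ 0 + 1) * 4 ^ κ 0 * (C * (4 ^ ν * (κ 0)⁻¹)), by positivity, fun a ξ hξ => ?_⟩
    rw [cubeJ_succ hκ a (by linarith) hξ]
    refine (norm_integral_jacobiWeight_le h0 (a 0) (differentiableOn_cubeJ hκ' _ (by linarith))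
      hξ).trans ?_
    rw [mul_assoc (2 ^ (κ 0 + 1) * 4 ^ κ 0)]
    refine mul_le_mul_of_nonneg_left ?_ (by positivity)
    rw [← (Fin.consEquiv fun _ : Fin (m + 1) => Bool).sum_comp, Fintype.sum_prod_type,
      Finset.mul_sum]
    refine Finset.sum_le_sum fun b _ => ?_
    set D : (Fin m → Bool) → ℝ := fun ε => ‖ξ - Complex.I *
      ((a 0 * boolSign b + ∑ i : Fin m, a i.succ * boolSign (ε i) : ℝ) : ℂ)‖ with hD
    have hDpos : ∀ ε, 0 < D ε := fun ε => by
      refine norm_pos_iff.2 (Complex.slitPlane_ne_zero (sub_I_mul_mem_slitPlane hξ _))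
    set P : (Fin m → Bool) → ℝ := fun ε => ∏ i : Fin m, (D ε + |a i.succ|) ^ (-κ i.succ) with hP
    have hPn : ∀ ε, 0 ≤ P ε := fun ε => Finset.prod_nonneg fun i _ =>
      Real.rpow_nonneg (by have := hDpos ε; positivity) _
    have key : ∀ s ∈ Set.Icc (0 : ℝ) 1,
        ‖cubeJ (fun i : Fin m => κ i.succ) (fun i => a i.succ) ν
          (ξ - Complex.I * (a 0 * boolSign b) +
            (|a 0| + Complex.I * (a 0 * boolSign b)) * s)‖ ≤
        C * ∑ ε : Fin m → Bool, 4 ^ ν *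
          ((D ε + |a 0| * s) ^ (∑ i : Fin m, κ i.succ - ν) * P ε) := by
      intro s hs
      refine (hb (fun i => a i.succ) _ ?_).trans ?_
      · have := mul_nonneg (abs_nonneg (a 0)) hs.1
        simp
        linarith
      · refine mul_le_mul_of_nonneg_left (Finset.sum_le_sum fun ε _ => ?_) hC.le
        refine jBound_le_of_le hκ' _ (by linarith) (hDpos ε)
          (by linarith [mul_nonneg (abs_nonneg (a 0)) hs.1]) ?_
        refine (norm_add_mul_ge ?_ (abs_boolSign b) hs.1).trans (le_of_eq ?_)
        · rw [re_sub_I_mul]; exact hξ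
        · congr 2
          push_cast
          ring
    have hint : ∀ ε, IntervalIntegrable (fun s : ℝ => s ^ (κ 0 - 1) *
        (D ε + |a 0| * s) ^ (∑ i : Fin m, κ i.succ - ν)) volume 0 1 := fun ε => by
      refine (intervalIntegral.intervalIntegrable_rpow' (by linarith)).mul_continuousOn ?_
      rw [Set.uIcc_of_le zero_le_one]
      refine ContinuousOn.rpow_const (by fun_prop) fun s hs => Or.inl ?_
      have := mul_nonneg (abs_nonneg (a 0)) hs.1
      have := hDpos ε
      linarith
    have hint2 : IntervalIntegrable (fun s : ℝ => ∑ ε : Fin m → Bool, (C * 4 ^ ν * P ε) *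
        (s ^ (κ 0 - 1) * (D ε + |a 0| * s) ^ (∑ i : Fin m, κ i.succ - ν))) volume 0 1 := by
      have := IntervalIntegrable.sum (μ := volume) (a := 0) (b := 1) Finset.univ
        (f := fun (ε : Fin m → Bool) (s : ℝ) => (C * 4 ^ ν * P ε) *
          (s ^ (κ 0 - 1) * (D ε + |a 0| * s) ^ (∑ i : Fin m, κ i.succ - ν)))
        (fun ε _ => (hint ε).const_mul _)
      exact this.congr (by intro s _; simp)
    refine (intervalIntegral.integral_mono_on zero_le_one ?_ hint2 (fun s hs => ?_)).trans ?_
    · refine (intervalIntegral.intervalIntegrable_rpow' (by linarith)).mul_continuousOn ?_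
      rw [Set.uIcc_of_le zero_le_one]
      refine ContinuousOn.norm ((differentiableOn_cubeJ hκ' _
        (by linarith)).continuousOn.comp (by fun_prop) ?_)
      intro s hs
      have := mul_nonneg (abs_nonneg (a 0)) hs.1
      simp
      linarith
    · refine (mul_le_mul_of_nonneg_left (key s hs) (Real.rpow_nonneg hs.1 _)).trans (le_of_eq ?_)
      rw [Finset.mul_sum, Finset.mul_sum]
      refine Finset.sum_congr rfl fun ε _ => ?_
      ring
    · rw [intervalIntegral.integral_finsetSum fun ε _ => (hint ε).const_mul _, Finset.mul_sum]
      refine Finset.sum_le_sum fun ε _ => ?_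
      rw [intervalIntegral.integral_const_mul]
      have h := integral_rpow_mul_rpow_le (κ := κ 0) (ν := ν - ∑ i : Fin m, κ i.succ) (D := D ε)
        (α := |a 0|) h0 (by linarith) (hDpos ε) (abs_nonneg _)
      rw [neg_sub] at h
      refine (mul_le_mul_of_nonneg_left h (by have := hPn ε; positivity)).trans (le_of_eq ?_)
      have e : ‖ξ - Complex.I * ((∑ i, a i * boolSign
          ((Fin.consEquiv fun _ : Fin (m + 1) => Bool) (b, ε) i) : ℝ) : ℂ)‖ = D ε := by
        rw [hD, Fin.sum_univ_succ]
        rfl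
      rw [e, jBound, Fin.sum_univ_succ, Fin.prod_univ_succ,
        show κ 0 - (ν - ∑ i : Fin m, κ i.succ) = κ 0 + ∑ i : Fin m, κ i.succ - ν by ring]
      simp only [hP]
      ring

theorem mul_cpow_of_re_pos {x y : ℂ} (hx : 0 < x.re) (hy : 0 < y.re) (c : ℂ) :
    (x * y) ^ c = x ^ c * y ^ c := by
  have hx0 : x ≠ 0 := fun h => by simp [h] at hx
  have hy0 : y ≠ 0 := fun h => by simp [h] at hy
  have h1 := abs_lt.1 (Complex.abs_arg_lt_pi_div_two_iff.2 (Or.inl hx))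
  have h2 := abs_lt.1 (Complex.abs_arg_lt_pi_div_two_iff.2 (Or.inl hy))
  rw [Complex.cpow_def_of_ne_zero hx0, Complex.cpow_def_of_ne_zero hy0,
    Complex.cpow_def_of_ne_zero (mul_ne_zero hx0 hy0),
    Complex.log_mul hx0 hy0 ⟨by linarith [h1.1, h2.1], by linarith [h1.2, h2.2]⟩,
    add_mul, Complex.exp_add]

theorem abs_sum_mul_le_one {m : ℕ} {a : Fin m → ℝ} (ha : ∑ i, |a i| ≤ 1) {t : Fin m → ℝ}
    (ht : ∀ i, |t i| ≤ 1) : |∑ i, a i * t i| ≤ 1 := by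
  refine (Finset.abs_sum_le_sum_abs _ _).trans (le_trans (Finset.sum_le_sum fun i _ => ?_) ha)
  rw [abs_mul]
  exact mul_le_of_le_one_right (abs_nonneg _) (ht i)

theorem abs_le_one_of_mem_cube {m : ℕ} {t : Fin m → ℝ} (ht : t ∈ cube m) (i : Fin m) :
    |t i| ≤ 1 := abs_le.2 (ht i (Set.mem_univ i))

/-- The average of a power of the Gegenbauer quadratic over the cube. -/
noncomputable def cubePhi {m : ℕ} (κ a : Fin m → ℝ) (ν : ℝ) (z : ℂ) : ℂ :=
  ∫ t, quad ((∑ i, a i * t i : ℝ) : ℂ) z ^ (-ν : ℂ) * (wprod κ t : ℂ) ∂(cubeMeas m)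

theorem quad_conj (u : ℝ) (z : ℂ) : quad u (starRingEnd ℂ z) = starRingEnd ℂ (quad u z) := by
  simp only [quad, map_add, map_sub, map_mul, map_pow, map_one, Complex.conj_ofReal, map_ofNat]

theorem cubePhi_conj {m : ℕ} (κ : Fin m → ℝ) {a : Fin m → ℝ} (ha : ∑ i, |a i| ≤ 1) (ν : ℝ) {z : ℂ}
    (hz : ‖z‖ < 1) : cubePhi κ a ν (starRingEnd ℂ z) = starRingEnd ℂ (cubePhi κ a ν z) := by
  rw [cubePhi, cubePhi, ← integral_conj]
  refine integral_congr_ae ?_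
  filter_upwards [ae_mem_cube m] with t ht
  have hs := quad_mem_slitPlane (abs_sum_mul_le_one ha (abs_le_one_of_mem_cube ht)) hz
  rw [map_mul, quad_conj, Complex.conj_cpow _ _ (Complex.mem_slitPlane_iff_arg.1 hs).1]
  simp

/-- The point of the right half plane whose Riesz integral represents `cubePhi`. -/
noncomputable def liftPt (z : ℂ) : ℂ := Complex.I * ((z + z⁻¹) / 2)

theorem liftPt_re_pos {z : ℂ} (hz : ‖z‖ < 1) (hi : 0 < z.im) : 0 < (liftPt z).re := by
  have hn : 0 < Complex.normSq z := Complex.normSq_pos.2 fun h => by simp [h] at hi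
  have hn1 : Complex.normSq z < 1 := by
    rw [Complex.normSq_eq_norm_sq]
    nlinarith [norm_nonneg z]
  have e : (liftPt z).re = z.im * ((Complex.normSq z)⁻¹ - 1) / 2 := by
    simp [liftPt, Complex.inv_im]
    ring
  rw [e]
  have := (one_lt_inv₀ hn).2 hn1
  have : 0 < (Complex.normSq z)⁻¹ - 1 := by linarith
  positivity

theorem quad_eq_mul_liftPt {z : ℂ} (hz : z ≠ 0) (u : ℂ) :
    quad u z = (-2 * Complex.I * z) * (liftPt z - Complex.I * u) := by
  rw [quad, liftPt]
  field_simp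
  linear_combination (1 - 2 * u * z + z ^ 2) * Complex.I_sq

theorem cubePhi_eq {m : ℕ} (κ a : Fin m → ℝ) (ν : ℝ) {z : ℂ} (hz : ‖z‖ < 1) (hi : 0 < z.im) :
    cubePhi κ a ν z = (-2 * Complex.I * z) ^ (-ν : ℂ) * cubeJ κ a ν (liftPt z) := by
  have hz0 : z ≠ 0 := fun h => by simp [h] at hi
  rw [cubePhi, cubeJ, ← integral_const_mul]
  refine integral_congr_ae (Filter.Eventually.of_forall fun t => ?_)
  simp only
  rw [quad_eq_mul_liftPt hz0, mul_cpow_of_re_pos (by simp [hi]) ?_, mul_assoc]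
  rw [re_sub_I_mul]
  exact liftPt_re_pos hz hi

theorem norm_cubePhi_le {m : ℕ} {κ : Fin m → ℝ} (hκ : ∀ i, 0 < κ i) {ν : ℝ}
    (hν : ∑ i, κ i + 1 ≤ ν) : ∃ C : ℝ, 0 < C ∧ ∀ (a : Fin m → ℝ) (z : ℂ), ∑ i, |a i| ≤ 1 →
      1 / 2 ≤ ‖z‖ → ‖z‖ < 1 → z.im ≠ 0 →
      ‖cubePhi κ a ν z‖ ≤ C * ∑ ε : Fin m → Bool,
        jBound κ a ν ‖quad ((∑ i, a i * boolSign (ε i) : ℝ) : ℂ) z‖ := by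
  obtain ⟨C, hC, hb⟩ := norm_cubeJ_le hκ hν
  have hsum : 0 ≤ ∑ i, κ i := Finset.sum_nonneg fun i _ => (hκ i).le
  refine ⟨C * 4 ^ ν, by positivity, ?_⟩
  have main : ∀ (a : Fin m → ℝ) (z : ℂ), ∑ i, |a i| ≤ 1 →
      1 / 2 ≤ ‖z‖ → ‖z‖ < 1 → 0 < z.im →
      ‖cubePhi κ a ν z‖ ≤ C * 4 ^ ν * ∑ ε : Fin m → Bool,
        jBound κ a ν ‖quad ((∑ i, a i * boolSign (ε i) : ℝ) : ℂ) z‖ := by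
    intro a z ha h1 h2 hi
    have hz0 : z ≠ 0 := fun h => by simp [h] at hi
    have hn : ‖-2 * Complex.I * z‖ = 2 * ‖z‖ := by simp
    rw [cubePhi_eq κ a ν h2 hi, norm_mul, show (-ν : ℂ) = ((-ν : ℝ) : ℂ) by push_cast; rfl,
      Complex.norm_cpow_real, hn, mul_assoc C, Finset.mul_sum (a := (4 : ℝ) ^ ν)]
    have hle1 : (2 * ‖z‖) ^ (-ν) ≤ 1 :=
      Real.rpow_le_one_of_one_le_of_nonpos (by linarith) (by linarith)
    refine (mul_le_of_le_one_left (norm_nonneg _) hle1).trans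
      ((hb a _ (liftPt_re_pos h2 hi)).trans ?_)
    refine mul_le_mul_of_nonneg_left (Finset.sum_le_sum fun ε _ => ?_) hC.le
    have hu : |∑ i, a i * boolSign (ε i)| ≤ 1 :=
      abs_sum_mul_le_one ha fun i => (abs_boolSign _).le
    have hq : 0 < ‖quad ((∑ i, a i * boolSign (ε i) : ℝ) : ℂ) z‖ :=
      norm_pos_iff.2 (quad_ne_zero hu h2)
    refine (jBound_le_of_le hκ a (by linarith) hq le_rfl ?_)
    rw [quad_eq_mul_liftPt hz0, norm_mul, hn]
    refine mul_le_mul_of_nonneg_right (by linarith) (norm_nonneg _)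
  intro a z ha h1 h2 hi
  rcases lt_or_gt_of_ne hi with hi | hi
  · have h := main a (starRingEnd ℂ z) ha (by rwa [RCLike.norm_conj]) (by rwa [RCLike.norm_conj])
      (by simpa using hi)
    rw [cubePhi_conj κ ha ν h2, RCLike.norm_conj] at h
    simpa only [quad_conj, RCLike.norm_conj] using h
  · exact main a z ha h1 h2 hi

theorem integral_wprod_pos {m : ℕ} {κ : Fin m → ℝ} (hκ : ∀ i, 0 < κ i) :
    0 < ∫ t in cube m, wprod κ t := by
  rw [restrict_cube]
  unfold wprod
  rw [cubeMeas, integral_fintype_prod_eq_prod (fun i (t : ℝ) => (1 + t) * (1 - t ^ 2) ^ (κ i - 1))]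
  refine Finset.prod_pos fun i _ => ?_
  rw [integral_Icc_eq_integral_Ioc, ← intervalIntegral.integral_of_le (by norm_num)]
  refine intervalIntegral.intervalIntegral_pos_of_pos_on (intervalIntegrable_jacobiWeight (hκ i))
    (fun t ht => ?_) (by norm_num)
  have : 0 < 1 - t ^ 2 := by nlinarith [ht.1, ht.2]
  have : 0 < 1 + t := by linarith [ht.1]
  positivity

theorem continuousOn_cesB (δ μ : ℝ) (k : Fin 3) :
    ContinuousOn (fun z => cesB δ μ z k) (Metric.ball 0 1) := by
  have h0 : ∀ z ∈ Metric.ball (0 : ℂ) 1, 1 - z ≠ 0 := fun z hz =>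
    Complex.slitPlane_ne_zero (one_sub_mem_slitPlane (by simpa using hz))
  have h1 : ContinuousOn (eulerA1 δ) (Metric.ball 0 1) := by
    unfold eulerA1
    fun_prop (disch := assumption)
  have h2 : ContinuousOn (eulerA2 δ) (Metric.ball 0 1) := by
    unfold eulerA2
    have : ∀ z ∈ Metric.ball (0 : ℂ) 1, (1 - z) ^ 2 ≠ 0 := fun z hz => pow_ne_zero _ (h0 z hz)
    fun_prop (disch := assumption)
  fin_cases k
  · simp only [Fin.zero_eta, cesB_zero]
    fun_prop
  · simp only [Fin.mk_one, cesB_one]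
    fun_prop
  · simp only [Fin.reduceFinMk, cesB_two]
    fun_prop

theorem continuousOn_quad_cpow (c : ℂ) : ContinuousOn (fun p : ℝ × ℂ => quad p.1 p.2 ^ c)
    (Set.Icc (-1) 1 ×ˢ Metric.ball 0 1) := by
  refine ContinuousOn.cpow (by unfold quad; fun_prop) continuousOn_const ?_
  rintro ⟨u, z⟩ ⟨hu, hz⟩
  exact quad_mem_slitPlane (abs_le.2 hu) (by simpa using hz)

theorem continuousOn_cesD2 (δ μ : ℝ) : ContinuousOn (fun p : ℝ × ℂ => cesD2 δ μ p.1 p.2)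
    (Set.Icc (-1) 1 ×ˢ Metric.ball 0 1) := by
  unfold cesD2
  refine continuousOn_finsetSum _ fun k _ => ContinuousOn.mul (ContinuousOn.mul ?_ ?_)
    (continuousOn_quad_cpow _)
  · refine ContinuousOn.cpow (by fun_prop) continuousOn_const ?_
    rintro ⟨u, z⟩ ⟨hu, hz⟩
    exact one_sub_mem_slitPlane (by simpa using hz)
  · exact (continuousOn_cesB δ μ k).comp continuousOn_snd fun p hp => hp.2

theorem measurable_cesD2 (δ μ : ℝ) : Measurable (fun p : ℝ × ℂ => cesD2 δ μ p.1 p.2) := by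
  unfold cesD2 quad
  refine Finset.measurable_fun_sum _ fun k _ => ?_
  have : Measurable fun p : ℝ × ℂ => cesB δ μ p.2 k := by
    fin_cases k
    · simp only [Fin.zero_eta, cesB_zero, eulerA2, eulerA1]
      fun_prop
    · simp only [Fin.mk_one, cesB_one, eulerA1]
      fun_prop
    · simp only [Fin.reduceFinMk, cesB_two]
      fun_prop
  refine Measurable.mul (Measurable.mul ?_ this) ?_
  · exact Measurable.pow_const (by fun_prop) _
  · exact Measurable.pow_const (by fun_prop) _

theorem continuous_gegenC (n : ℕ) (l : ℝ) : Continuous (gegenC n l) := by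
  unfold gegenC jacobiP
  fun_prop

theorem integrable_quad_cpow {m : ℕ} {κ a : Fin m → ℝ} (hκ : ∀ i, 0 < κ i) (ha : ∑ i, |a i| ≤ 1)
    (c : ℂ) {z : ℂ} (hz : ‖z‖ < 1) :
    Integrable (fun t => quad ((∑ i, a i * t i : ℝ) : ℂ) z ^ c * (wprod κ t : ℂ)) (cubeMeas m) := by
  obtain ⟨M, hM⟩ := (isCompact_Icc (a := (-1 : ℝ)) (b := 1)).exists_bound_of_continuousOn
    (f := fun u : ℝ => quad u z ^ c) ((continuousOn_quad_cpow c).comp (f := fun u : ℝ => (u, z))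
      (by fun_prop) fun u hu => ⟨hu, by simpa using hz⟩)
  refine (integrable_wprod hκ).ofReal.bdd_mul (c := M) ?_ ?_
  · refine Measurable.aestronglyMeasurable (Measurable.pow_const ?_ _)
    unfold quad
    fun_prop
  · filter_upwards [ae_mem_cube m] with t ht
    exact hM _ (abs_le.1 (abs_sum_mul_le_one ha (abs_le_one_of_mem_cube ht)))

theorem lamK_pos {d : ℕ} (hd : 1 ≤ d) {κ : Fin (d + 1) → ℝ} (hκ : ∀ i, 0 < κ i) :
    0 < lamK d κ := by
  have : (1 : ℝ) ≤ d := by exact_mod_cast hd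
  have : 0 < ∑ i, κ i := Finset.sum_pos (fun i _ => hκ i) ⟨0, Finset.mem_univ _⟩
  unfold lamK
  linarith

theorem hK_eq_integral {d : ℕ} {κ : Fin (d + 1) → ℝ} (hκ : ∀ i, 0 < κ i)
    {δ : ℝ} (hδ : -1 < δ) (n : ℕ) {x y : EuclideanSpace ℝ (Fin (d + 1))}
    (ha : ∑ i, |x i * y i| ≤ 1) :
    cesA δ n * hK d κ δ n x y * ∫ t in cube (d + 1), wprod κ t =
      ∫ t, (∑ k ∈ Finset.range (n + 1), cesA δ (n - k) * ((k + lamK d κ) / lamK d κ *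
        gegenC k (lamK d κ) (∑ i, x i * y i * t i))) * wprod κ t ∂(cubeMeas (d + 1)) := by
  have hW := integral_wprod_pos hκ
  have hA := cesA_pos hδ n
  have hint : ∀ k, Integrable (fun t => gegenC k (lamK d κ) (∑ i, x i * y i * t i) * wprod κ t)
      (cubeMeas (d + 1)) := fun k => by
    obtain ⟨M, hM⟩ := (isCompact_Icc (a := (-1 : ℝ)) (b := 1)).exists_bound_of_continuousOn
      (continuous_gegenC k (lamK d κ)).continuousOn
    refine (integrable_wprod hκ).bdd_mul (c := M) ?_ ?_
    · exact ((continuous_gegenC k _).comp (by fun_prop)).aestronglyMeasurable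
    · filter_upwards [ae_mem_cube (d + 1)] with t ht
      exact hM _ (abs_le.1 (abs_sum_mul_le_one ha (abs_le_one_of_mem_cube ht)))
  rw [hK, mul_inv_cancel_left₀ hA.ne']
  simp only [Finset.sum_mul, hP]
  rw [integral_finsetSum]
  · refine Finset.sum_congr rfl fun k _ => ?_
    simp only [restrict_cube] at hW ⊢
    have e : ∀ t : Fin (d + 1) → ℝ, cesA δ (n - k) * ((k + lamK d κ) / lamK d κ *
        gegenC k (lamK d κ) (∑ i, x i * y i * t i)) * wprod κ t =
        (cesA δ (n - k) * ((k + lamK d κ) / lamK d κ)) *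
        (gegenC k (lamK d κ) (∑ i, x i * y i * t i) * wprod κ t) := fun t => by ring
    simp only [e]
    rw [integral_const_mul]
    field_simp
  · intro k _
    refine ((hint k).const_mul (cesA δ (n - k) * ((k + lamK d κ) / lamK d κ))).congr
      (Filter.Eventually.of_forall fun t => ?_)
    simp only
    ring

theorem integral_cesD2_mul_wprod {m : ℕ} {κ a : Fin m → ℝ} (hκ : ∀ i, 0 < κ i)
    (ha : ∑ i, |a i| ≤ 1) (δ μ : ℝ) {z : ℂ} (hz : ‖z‖ < 1) :
    ∫ t, cesD2 δ μ (∑ i, a i * t i) z * (wprod κ t : ℂ) ∂(cubeMeas m) =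
      ∑ k : Fin 3, (1 - z) ^ (-δ : ℂ) * cesB δ μ z k * cubePhi κ a (μ + (k : ℕ)) z := by
  simp only [cesD2, Finset.sum_mul, mul_assoc, cubePhi]
  rw [integral_finsetSum]
  · refine Finset.sum_congr rfl fun k _ => ?_
    rw [integral_const_mul, integral_const_mul]
  · intro k _
    exact ((integrable_quad_cpow hκ ha _ hz).const_mul _).const_mul _

theorem hK_eq_contour {d : ℕ} (hd : 1 ≤ d) {κ : Fin (d + 1) → ℝ} (hκ : ∀ i, 0 < κ i)
    {δ : ℝ} (hδ : -1 < δ) (n : ℕ) {x y : EuclideanSpace ℝ (Fin (d + 1))}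
    (ha : ∑ i, |x i * y i| ≤ 1) {r : ℝ} (hr : 0 < r) (hr1 : r < 1) :
    (n : ℂ) ^ 2 * ((cesA δ n * hK d κ δ n x y * ∫ t in cube (d + 1), wprod κ t : ℝ) : ℂ) =
      (2 * π : ℂ)⁻¹ * ∫ θ in (0 : ℝ)..2 * π, ((circleMap 0 r θ) ^ n)⁻¹ *
        ∑ k : Fin 3, (1 - circleMap 0 r θ) ^ (-δ : ℂ) * cesB δ (lamK d κ + 1) (circleMap 0 r θ) k *
          cubePhi κ (fun i => x i * y i) (lamK d κ + 1 + (k : ℕ)) (circleMap 0 r θ) := by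
  have hl := lamK_pos hd hκ
  have hz : ∀ θ, ‖circleMap 0 r θ‖ = r := fun θ => by simp [abs_of_pos hr]
  rw [hK_eq_integral hκ hδ n ha, ← integral_complex_ofReal, ← integral_const_mul]
  set F : ℝ → ℝ → ℂ := fun u θ =>
    ((circleMap 0 r θ) ^ n)⁻¹ * cesD2 δ (lamK d κ + 1) u (circleMap 0 r θ) with hF
  have hcube : ∀ᵐ t ∂(cubeMeas (d + 1)), ∑ i, x i * y i * t i ∈ Set.Icc (-1 : ℝ) 1 := by
    filter_upwards [ae_mem_cube (d + 1)] with t ht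
    exact abs_le.1 (abs_sum_mul_le_one ha (abs_le_one_of_mem_cube ht))
  obtain ⟨M, hM⟩ : ∃ M, ∀ u ∈ Set.Icc (-1 : ℝ) 1, ∀ θ, ‖F u θ‖ ≤ M := by
    obtain ⟨M, hM⟩ := ((isCompact_Icc (a := (-1 : ℝ)) (b := 1)).prod
      (isCompact_sphere (0 : ℂ) r)).exists_bound_of_continuousOn
      ((continuousOn_cesD2 δ (lamK d κ + 1)).mono
        (Set.prod_mono le_rfl (Metric.sphere_subset_ball hr1)))
    refine ⟨(r ^ n)⁻¹ * M, fun u hu θ => ?_⟩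
    rw [hF, norm_mul, norm_inv, norm_pow, hz]
    refine mul_le_mul_of_nonneg_left (hM (u, circleMap 0 r θ) ⟨hu, ?_⟩) (by positivity)
    simpa using hz θ
  have hmeas : Measurable fun p : (Fin (d + 1) → ℝ) × ℝ => F (∑ i, x i * y i * p.1 i) p.2 := by
    have hc : Measurable fun p : (Fin (d + 1) → ℝ) × ℝ => circleMap 0 r p.2 :=
      (continuous_circleMap 0 r).measurable.comp measurable_snd
    have hs : Measurable fun p : (Fin (d + 1) → ℝ) × ℝ => ∑ i, x i * y i * p.1 i := by fun_prop
    have h2 := (measurable_cesD2 δ (lamK d κ + 1)).comp (hs.prodMk hc)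
    simp only [Function.comp_def] at h2
    exact (hc.pow_const n).inv.mul h2
  have hprod : Integrable (Function.uncurry fun (t : Fin (d + 1) → ℝ) (θ : ℝ) =>
      F (∑ i, x i * y i * t i) θ * (wprod κ t : ℂ))
      ((cubeMeas (d + 1)).prod (volume.restrict (Set.Ioc 0 (2 * π)))) := by
    have h1 : Integrable (fun p : (Fin (d + 1) → ℝ) × ℝ => (wprod κ p.1 : ℂ))
        ((cubeMeas (d + 1)).prod (volume.restrict (Set.Ioc 0 (2 * π)))) :=
      Integrable.comp_fst (f := fun t => (wprod κ t : ℂ)) (integrable_wprod hκ).ofReal _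
    refine h1.bdd_mul (c := M) hmeas.aestronglyMeasurable ?_
    have := (Measure.quasiMeasurePreserving_fst (μ := cubeMeas (d + 1))
      (ν := volume.restrict (Set.Ioc 0 (2 * π)))).ae hcube
    filter_upwards [this] with p hp
    exact hM _ hp _
  have e1 : ∫ t, (n : ℂ) ^ 2 * (((∑ k ∈ Finset.range (n + 1), cesA δ (n - k) *
      ((k + lamK d κ) / lamK d κ * gegenC k (lamK d κ) (∑ i, x i * y i * t i))) * wprod κ t : ℝ) : ℂ)
        ∂(cubeMeas (d + 1)) =
      ∫ t, (2 * π : ℂ)⁻¹ *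
        (∫ θ in Set.Ioc (0 : ℝ) (2 * π), F (∑ i, x i * y i * t i) θ * (wprod κ t : ℂ)) ∂(cubeMeas (d + 1)) := by
    refine integral_congr_ae ?_
    filter_upwards [hcube] with t ht
    rw [Complex.ofReal_mul, ← mul_assoc, sum_cesA_gegenC_eq_integral hδ hl (abs_le.2 ht) hr hr1,
      mul_assoc, ← intervalIntegral.integral_mul_const,
      intervalIntegral.integral_of_le (by positivity)]
  rw [e1, integral_const_mul, integral_integral_swap hprod,
    intervalIntegral.integral_of_le (by positivity)]
  congr 1
  refine integral_congr_ae (Filter.Eventually.of_forall fun θ => ?_)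
  have hz1 : ‖circleMap 0 r θ‖ < 1 := by rw [hz]; exact hr1
  simp only
  rw [← integral_cesD2_mul_wprod hκ ha δ (lamK d κ + 1) hz1, ← integral_const_mul]
  refine integral_congr_ae (Filter.Eventually.of_forall fun t => ?_)
  simp only [hF]
  rw [mul_assoc]

theorem rpow_neg_mul_le_of_near {δ e X Y q s : ℝ} (hδ : -1 < δ) (he : 1 ≤ e) (hX : 0 < X)
    (hY : 0 < Y) (hY2 : Y ≤ 2) (hs : 0 < s) (hXY : X * Y ≤ 4 * q) (hsX : s ≤ 4 * X)
    (hsq : s ≤ 8 * q) :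
    X ^ (-δ) * Y * q ^ (-e) ≤ 2 * 4 ^ |δ| * 8 ^ (|δ| + e) * s ^ (-δ - e) := by
  have hq : 0 < q := by linarith
  have hsc : ∀ {c f x : ℝ}, 0 < c → 0 ≤ f → s ≤ c * x → x ^ (-f) ≤ c ^ f * s ^ (-f) := by
    intro c f x hc hf hx
    have hx' : s / c ≤ x := by rw [div_le_iff₀ hc]; linarith
    refine (Real.rpow_le_rpow_of_nonpos (by positivity) hx' (by linarith)).trans (le_of_eq ?_)
    rw [Real.div_rpow hs.le hc.le, Real.rpow_neg hc.le]
    field_simp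
  have h8 : ∀ {f : ℝ}, f ≤ |δ| + e → (8 : ℝ) ^ f ≤ 8 ^ (|δ| + e) := fun hf =>
    Real.rpow_le_rpow_of_exponent_le (by norm_num) hf
  have hd := abs_nonneg δ
  rcases le_total 0 δ with h | h
  · have h1 := hsc (f := δ) (by norm_num) h hsX
    have h2 := hsc (f := e) (by norm_num) (by linarith) hsq
    have h3 : s ^ (-δ - e) = s ^ (-δ) * s ^ (-e) := by
      rw [← Real.rpow_add hs]; ring_nf
    rw [abs_of_nonneg h] at h8 ⊢
    rw [h3]
    calc X ^ (-δ) * Y * q ^ (-e) ≤ (4 ^ δ * s ^ (-δ)) * 2 * (8 ^ (δ + e) * s ^ (-e)) := by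
          gcongr
          exact h2.trans (mul_le_mul_of_nonneg_right (h8 (by linarith)) (by positivity))
      _ = _ := by ring
  · have h1 : X ^ (-δ) * Y = (X * Y) ^ (-δ) * Y ^ (1 + δ) := by
      rw [Real.mul_rpow hX.le hY.le, mul_assoc, ← Real.rpow_add hY]
      simp
    have h2 : Y ^ (1 + δ) ≤ 2 := by
      refine (Real.rpow_le_rpow hY.le hY2 (by linarith)).trans ?_
      refine (Real.rpow_le_rpow_of_exponent_le (y := 1 + δ) (z := 1) (by norm_num)
        (by linarith)).trans ?_
      simp
    have h3 : (X * Y) ^ (-δ) ≤ 4 ^ (-δ) * q ^ (-δ) := by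
      rw [← Real.mul_rpow (by norm_num) hq.le]
      exact Real.rpow_le_rpow (by positivity) hXY (by linarith)
    have h4 := hsc (f := δ + e) (by norm_num) (by linarith) hsq
    have h5 : q ^ (-δ) * q ^ (-e) = q ^ (-(δ + e)) := by
      rw [← Real.rpow_add hq]; ring_nf
    rw [show -δ - e = -(δ + e) by ring, h1, abs_of_nonpos h]
    rw [abs_of_nonpos h] at h8
    calc (X * Y) ^ (-δ) * Y ^ (1 + δ) * q ^ (-e)
        ≤ (4 ^ (-δ) * q ^ (-δ)) * 2 * q ^ (-e) := by gcongr
      _ = 2 * 4 ^ (-δ) * q ^ (-(δ + e)) := by rw [← h5]; ring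
      _ ≤ 2 * 4 ^ (-δ) * (8 ^ (-δ + e) * s ^ (-(δ + e))) := by
          refine mul_le_mul_of_nonneg_left (h4.trans ?_) (by positivity)
          exact mul_le_mul_of_nonneg_right (h8 (by linarith)) (by positivity)
      _ = _ := by ring

theorem rpow_neg_mul_le_of_far {δ X Y : ℝ} (hδ : -1 < δ) (hX : 0 < X)
    (hY : 0 < Y) (hX2 : X ≤ 2) (hY2 : Y ≤ 2) (hXY : 2 ≤ X + Y) :
    X ^ (-δ) * Y * ((X ^ 2)⁻¹ + (Y ^ 2)⁻¹) ≤
      (3 + 2 ^ |δ| * 2 ^ (δ + 1)) * (X ^ (-δ - 2) + Y ^ (-δ - 2)) := by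
  have e1 : ∀ {x : ℝ}, 0 < x → x ^ (-δ - 2) = x ^ (-δ) * (x ^ 2)⁻¹ := fun {x} hx => by
    rw [Real.rpow_sub hx, div_eq_mul_inv]; norm_num
  have hXn : 0 ≤ X ^ (-δ - 2) := Real.rpow_nonneg hX.le _
  have hYn : 0 ≤ Y ^ (-δ - 2) := Real.rpow_nonneg hY.le _
  have hc : (0 : ℝ) ≤ 2 ^ |δ| * 2 ^ (δ + 1) := by positivity
  have h1 : X ^ (-δ) * Y * (X ^ 2)⁻¹ ≤ 2 * X ^ (-δ - 2) := by
    rw [e1 hX]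
    have : 0 ≤ X ^ (-δ) * (X ^ 2)⁻¹ := by positivity
    nlinarith
  have h2 : X ^ (-δ) * Y * (Y ^ 2)⁻¹ ≤
      X ^ (-δ - 2) + 2 ^ |δ| * 2 ^ (δ + 1) * Y ^ (-δ - 2) := by
    have e2 : X ^ (-δ) * Y * (Y ^ 2)⁻¹ = X ^ (-δ) * Y⁻¹ := by field_simp
    rw [e2]
    rcases le_total 1 X with h | h
    · have h3 : X ^ (-δ) ≤ 2 ^ |δ| := by
        refine (Real.rpow_le_rpow_of_exponent_le h (neg_le_abs δ)).trans ?_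
        exact Real.rpow_le_rpow hX.le hX2 (abs_nonneg _)
      have h4 : Y⁻¹ ≤ 2 ^ (δ + 1) * Y ^ (-δ - 2) := by
        have : Y⁻¹ = Y ^ (δ + 1) * Y ^ (-δ - 2) := by
          rw [← Real.rpow_add hY, ← Real.rpow_neg_one]; ring_nf
        rw [this]
        exact mul_le_mul_of_nonneg_right (Real.rpow_le_rpow hY.le hY2 (by linarith)) hYn
      have := mul_le_mul h3 h4 (by positivity) (by positivity)
      rw [← mul_assoc] at this
      linarith
    · have h3 : X ^ (-δ) ≤ X ^ (-δ - 2) := by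
        rw [e1 hX]
        exact le_mul_of_one_le_right (by positivity) (one_le_inv₀ (by positivity) |>.2 (by nlinarith))
      have h4 : Y⁻¹ ≤ 1 := inv_le_one_of_one_le₀ (by linarith)
      have := mul_le_mul h3 h4 (by positivity) hXn
      have : 0 ≤ 2 ^ |δ| * 2 ^ (δ + 1) * Y ^ (-δ - 2) := by positivity
      linarith
  have h3 : 0 ≤ 2 ^ |δ| * 2 ^ (δ + 1) * X ^ (-δ - 2) := by positivity
  rw [mul_add]
  nlinarith

theorem contour_weight_le {δ e L : ℝ} (hδ : -1 < δ) (he : 1 ≤ e) (hL : 0 < L) :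
    ∃ C : ℝ, 0 < C ∧ ∀ (P : ℝ → ℝ) (N X Y p q s : ℝ), (∀ x, 0 < x → 0 ≤ P x) →
      (∀ x y, 0 < x → x ≤ 32 * y → P y ≤ L * P x) → 0 < N → 0 < X → 0 < Y → 0 < p → 0 < s →
      N⁻¹ ≤ 2 * p → X ≤ 2 → Y ≤ 2 → 2 ≤ X + Y → X * Y ≤ 4 * q → s ≤ 8 * q →
      (p ≤ X → s ≤ 4 * X) → (X < p ∨ Y < p → s ≤ 4 * p) →
      X ^ (-δ) * (Y * ((X ^ 2)⁻¹ + (Y ^ 2)⁻¹ + (p ^ 2)⁻¹)) * ((p * q) ^ (-e) * P (p * q)) ≤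
        C * (s ^ (-δ - e) * P (s * N⁻¹) * p ^ (-2 - e) +
          s ^ (-(2 * e)) * P (s ^ 2) * (X ^ (-δ - 2) + Y ^ (-δ - 2))) := by
  set C1 : ℝ := 3 * (2 * 4 ^ |δ| * 8 ^ (|δ| + e)) * L with hC1
  set C2 : ℝ := 2 * (3 + 2 ^ |δ| * 2 ^ (δ + 1)) * 32 ^ e * L with hC2
  have h1 : 0 < C1 := by positivity
  have h2 : 0 < C2 := by positivity
  refine ⟨C1 + C2, by positivity, ?_⟩
  intro P N X Y p q s hP hPL hN hX hY hp hs hNp hX2 hY2 hXY hXYq hsq hsX hsp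
  have hq : 0 < q := by linarith
  have hT1 : 0 ≤ s ^ (-δ - e) * P (s * N⁻¹) * p ^ (-2 - e) :=
    mul_nonneg (mul_nonneg (by positivity) (hP _ (by positivity))) (by positivity)
  have hT2 : 0 ≤ s ^ (-(2 * e)) * P (s ^ 2) * (X ^ (-δ - 2) + Y ^ (-δ - 2)) :=
    mul_nonneg (mul_nonneg (by positivity) (hP _ (by positivity))) (by positivity)
  by_cases hcase : p ≤ X ∧ p ≤ Y
  · have hS : (X ^ 2)⁻¹ + (Y ^ 2)⁻¹ + (p ^ 2)⁻¹ ≤ 3 * (p ^ 2)⁻¹ := by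
      have hx : (X ^ 2)⁻¹ ≤ (p ^ 2)⁻¹ := by have := hcase.1; gcongr
      have hy : (Y ^ 2)⁻¹ ≤ (p ^ 2)⁻¹ := by have := hcase.2; gcongr
      linarith
    have hPq : P (p * q) ≤ L * P (s * N⁻¹) := by
      refine hPL _ _ (by positivity) ?_
      have hn : 0 < N⁻¹ := by positivity
      nlinarith [mul_le_mul hsq hNp hn.le (by positivity)]
    have hmain := rpow_neg_mul_le_of_near hδ he hX hY hY2 hs hXYq (hsX hcase.1) hsq
    have ep : (p ^ 2)⁻¹ * p ^ (-e) = p ^ (-2 - e) := by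
      rw [show -2 - e = -e - 2 by ring, Real.rpow_sub hp]; norm_num; ring
    have hPn := hP (s * N⁻¹) (by positivity)
    calc X ^ (-δ) * (Y * ((X ^ 2)⁻¹ + (Y ^ 2)⁻¹ + (p ^ 2)⁻¹)) * ((p * q) ^ (-e) * P (p * q))
        ≤ X ^ (-δ) * (Y * (3 * (p ^ 2)⁻¹)) * ((p * q) ^ (-e) * (L * P (s * N⁻¹))) := by
          gcongr
          exact mul_nonneg (by positivity) (hP _ (by positivity))
      _ = (X ^ (-δ) * Y * q ^ (-e)) * (3 * L * P (s * N⁻¹) * p ^ (-2 - e)) := by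
          rw [Real.mul_rpow hp.le hq.le, ← ep]; ring
      _ ≤ (2 * 4 ^ |δ| * 8 ^ (|δ| + e) * s ^ (-δ - e)) *
            (3 * L * P (s * N⁻¹) * p ^ (-2 - e)) := by
          gcongr
      _ = C1 * (s ^ (-δ - e) * P (s * N⁻¹) * p ^ (-2 - e)) := by rw [hC1]; ring
      _ ≤ _ := by nlinarith
  · have hcase' : X < p ∨ Y < p := by
      by_contra hcon
      push Not at hcon
      exact hcase hcon
    have hsp := hsp hcase'
    have hS : (X ^ 2)⁻¹ + (Y ^ 2)⁻¹ + (p ^ 2)⁻¹ ≤ 2 * ((X ^ 2)⁻¹ + (Y ^ 2)⁻¹) := by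
      have hx : 0 < (X ^ 2)⁻¹ := by positivity
      have hy : 0 < (Y ^ 2)⁻¹ := by positivity
      rcases hcase' with h | h
      · have : (p ^ 2)⁻¹ ≤ (X ^ 2)⁻¹ := by gcongr
        linarith
      · have : (p ^ 2)⁻¹ ≤ (Y ^ 2)⁻¹ := by gcongr
        linarith
    have hpq : s ^ 2 ≤ 32 * (p * q) := by nlinarith [mul_le_mul hsp hsq hs.le (by positivity)]
    have hPq : P (p * q) ≤ L * P (s ^ 2) := hPL _ _ (by positivity) hpq
    have hpe : (p * q) ^ (-e) ≤ 32 ^ e * s ^ (-(2 * e)) := by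
      have hx' : s ^ 2 / 32 ≤ p * q := by linarith
      refine (Real.rpow_le_rpow_of_nonpos (by positivity) hx' (by linarith)).trans (le_of_eq ?_)
      rw [Real.div_rpow (by positivity) (by norm_num), Real.rpow_neg (x := 32) (by norm_num),
        show -(2 * e) = (2 : ℕ) * (-e) by push_cast; ring, Real.rpow_natCast_mul hs.le]
      field_simp
    have hmain := rpow_neg_mul_le_of_far hδ hX hY hX2 hY2 hXY
    have hPn := hP (s ^ 2) (by positivity)
    have hPn' := hP (p * q) (by positivity)
    calc X ^ (-δ) * (Y * ((X ^ 2)⁻¹ + (Y ^ 2)⁻¹ + (p ^ 2)⁻¹)) * ((p * q) ^ (-e) * P (p * q))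
        ≤ X ^ (-δ) * (Y * (2 * ((X ^ 2)⁻¹ + (Y ^ 2)⁻¹))) *
            ((32 ^ e * s ^ (-(2 * e))) * (L * P (s ^ 2))) := by
          gcongr
      _ = (X ^ (-δ) * Y * ((X ^ 2)⁻¹ + (Y ^ 2)⁻¹)) *
            (2 * (32 ^ e * s ^ (-(2 * e))) * (L * P (s ^ 2))) := by ring
      _ ≤ ((3 + 2 ^ |δ| * 2 ^ (δ + 1)) * (X ^ (-δ - 2) + Y ^ (-δ - 2))) *
            (2 * (32 ^ e * s ^ (-(2 * e))) * (L * P (s ^ 2))) := by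
          gcongr
      _ = C2 * (s ^ (-(2 * e)) * P (s ^ 2) * (X ^ (-δ - 2) + Y ^ (-δ - 2))) := by rw [hC2]; ring
      _ ≤ _ := by nlinarith

set_option maxHeartbeats 1000000 in
theorem cesB_majorant_le {D M X Y p q : ℝ} (hD : 0 ≤ D) (hM : 0 ≤ M) (hX : 0 < X) (hY : 0 < Y)
    (hX2 : X ≤ 2) (hY2 : Y ≤ 2) (hXY : 2 ≤ X + Y) (hp : 0 < p) (hpq : p ≤ q)
    (hXYq : X * Y ≤ 4 * q) :
    (D / X * (D * Y / X + 1) + (D * Y / X + 1) + 2 * D / X ^ 2 + 2 * M * (D * Y / X + 1) +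
        M ^ 2 * Y) +
      (M * (X * Y) * (2 * (D * Y / X + 1) + (2 * M + 1) * Y) + 2 * M * Y) * (p * q)⁻¹ +
      ((M + 1) * M * (X * Y) ^ 2 * Y) * ((p * q) ^ 2)⁻¹ ≤
    (D * (D + 1) + 2 * (D + 1) * (1 + 2 * M) + 4 * D + 4 * M ^ 2 +
      (M * (2 * (2 * D + 2) + 4 * (2 * M + 1)) + 2 * M) + 16 * (M * (M + 1))) *
      (Y * ((X ^ 2)⁻¹ + (Y ^ 2)⁻¹ + (p ^ 2)⁻¹)) := by
  have hq : 0 < q := hp.trans_le hpq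
  set V := X⁻¹ with hV
  set U := Y⁻¹ with hU
  have hV0 : 0 < V := inv_pos.2 hX
  have hU0 : 0 < U := inv_pos.2 hY
  have hXV : X * V = 1 := mul_inv_cancel₀ hX.ne'
  have hYU : Y * U = 1 := mul_inv_cancel₀ hY.ne'
  have hV2 : 1 ≤ 2 * V := by nlinarith
  have hU2 : 1 ≤ 2 * U := by nlinarith
  set W := (p ^ 2)⁻¹ with hW
  have hW0 : 0 < W := by positivity
  have hpqW : (p * q)⁻¹ ≤ W := by
    rw [hW]
    refine inv_anti₀ (by positivity) ?_
    nlinarith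
  have hq2W : q ^ 2 * ((p * q) ^ 2)⁻¹ = W := by rw [hW]; field_simp
  have em : D * Y / X + 1 = Y * (D * V + U) := by
    rw [mul_add, hYU, hV]; ring
  have e1 : D / X = D * V := by rw [hV]; ring
  have e2 : 2 * D / X ^ 2 = 2 * D * V ^ 2 := by rw [hV]; field_simp
  have e3 : (X ^ 2)⁻¹ = V ^ 2 := by rw [hV]; field_simp
  have e4 : (Y ^ 2)⁻¹ = U ^ 2 := by rw [hU]; field_simp
  rw [em, e1, e2, e3, e4]
  clear_value V U W
  set T := V ^ 2 + U ^ 2 with hT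
  have hT0 : 0 < T := by positivity
  clear_value T
  have a1 : D * V + U ≤ 2 * (D + 1) * T := by
    have h1 : V ≤ 2 * V ^ 2 := by nlinarith [mul_le_mul_of_nonneg_left hV2 hV0.le]
    have h2 : U ≤ 2 * U ^ 2 := by nlinarith [mul_le_mul_of_nonneg_left hU2 hU0.le]
    have h3 := mul_le_mul_of_nonneg_left (show V ≤ 2 * T by linarith [sq_nonneg U]) hD
    have h4 : U ≤ 2 * T := by linarith [sq_nonneg V]
    linarith
  have a2 : V * (D * V + U) ≤ (D + 1) * T := by
    have : V * U ≤ T := by nlinarith [sq_nonneg (V - U), sq_nonneg (V + U)]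
    have h1 := mul_le_mul_of_nonneg_left (show V ^ 2 ≤ T by linarith [sq_nonneg U]) hD
    linarith
  have a3 : U * V ^ 2 ≤ 2 * T := by
    rcases le_total 1 Y with h | h
    · have h1 : U ≤ 1 := hU ▸ inv_le_one_of_one_le₀ h
      have := mul_le_of_le_one_left (sq_nonneg V) h1
      linarith [sq_nonneg V, sq_nonneg U]
    · have h1 : V ≤ 1 := hV ▸ inv_le_one_of_one_le₀ (by linarith)
      have h2 := mul_le_of_le_one_right hU0.le (pow_le_one₀ (n := 2) hV0.le h1)
      have h3 : U ≤ 2 * U ^ 2 := by nlinarith [mul_le_mul_of_nonneg_left hU2 hU0.le]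
      linarith [sq_nonneg V]
  have a3' : V ^ 2 ≤ Y * (2 * T) := by
    calc V ^ 2 = Y * (U * V ^ 2) := by rw [← mul_assoc, hYU, one_mul]
      _ ≤ _ := mul_le_mul_of_nonneg_left a3 hY.le
  have a4 : 1 ≤ 4 * T := by nlinarith [sq_nonneg U]
  have hb0 : D * V * (Y * (D * V + U)) + Y * (D * V + U) + 2 * D * V ^ 2 +
      2 * M * (Y * (D * V + U)) + M ^ 2 * Y ≤
      (D * (D + 1) + 2 * (D + 1) * (1 + 2 * M) + 4 * D + 4 * M ^ 2) * (Y * T) := by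
    have c1 := mul_le_mul_of_nonneg_left a2 (show 0 ≤ D * Y by positivity)
    have c2 := mul_le_mul_of_nonneg_left a1 (show 0 ≤ (1 + 2 * M) * Y by positivity)
    have c3 := mul_le_mul_of_nonneg_left a3' (show 0 ≤ 2 * D by positivity)
    have c4 := mul_le_mul_of_nonneg_left a4 (show 0 ≤ M ^ 2 * Y by positivity)
    linarith
  have hb1 : (M * (X * Y) * (2 * (Y * (D * V + U)) + (2 * M + 1) * Y) + 2 * M * Y) ≤
      (M * (2 * (2 * D + 2) + 4 * (2 * M + 1)) + 2 * M) * Y := by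
    have c0 : X * (Y * (D * V + U)) = D * Y + X := by
      linear_combination (D * Y) * hXV + X * hYU
    have c1 : D * Y + X ≤ 2 * D + 2 := by nlinarith
    have c2 : X * Y ≤ 4 := by nlinarith
    have c3 := mul_le_mul_of_nonneg_left c1 (show 0 ≤ 2 * M * Y by positivity)
    have c4 := mul_le_mul_of_nonneg_left c2 (show 0 ≤ M * (2 * M + 1) * Y by positivity)
    calc _ = 2 * M * Y * (X * (Y * (D * V + U))) + M * (2 * M + 1) * Y * (X * Y) + 2 * M * Y := by
          ring
      _ ≤ _ := by rw [c0]; linarith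
  have hb2 : (M + 1) * M * (X * Y) ^ 2 * Y ≤ 16 * (M * (M + 1)) * Y * q ^ 2 := by
    have c1 : (X * Y) ^ 2 ≤ 16 * q ^ 2 := by
      have := mul_le_mul hXYq hXYq (by positivity) (by positivity)
      nlinarith
    have := mul_le_mul_of_nonneg_left c1 (show 0 ≤ (M + 1) * M * Y by positivity)
    linarith
  have hb1' := mul_le_mul hb1 hpqW (by positivity) (by positivity)
  have hb2' := mul_le_mul_of_nonneg_right hb2 (show 0 ≤ ((p * q) ^ 2)⁻¹ by positivity)
  rw [mul_assoc _ (q ^ 2), hq2W] at hb2'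
  have d1 : 0 ≤ (D * (D + 1) + 2 * (D + 1) * (1 + 2 * M) + 4 * D + 4 * M ^ 2) * (Y * W) := by
    positivity
  have d2 : 0 ≤ ((M * (2 * (2 * D + 2) + 4 * (2 * M + 1)) + 2 * M) + 16 * (M * (M + 1))) *
    (Y * T) := by positivity
  linarith

theorem norm_cesB_le (δ μ : ℝ) : ∃ C : ℝ, 0 < C ∧ ∀ (z : ℂ) (p q : ℝ), ‖z‖ < 1 → 0 < p → p ≤ q →
    ‖1 - z‖ * ‖1 + z‖ ≤ 4 * q →
    ∑ k : Fin 3, ‖cesB δ μ z k‖ * ((p * q) ^ (k : ℕ))⁻¹ ≤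
      C * (‖1 + z‖ * ((‖1 - z‖ ^ 2)⁻¹ + (‖1 + z‖ ^ 2)⁻¹ + (p ^ 2)⁻¹)) := by
  set D := |δ| with hDdef
  set M := |μ| with hMdef
  have hD : 0 ≤ D := abs_nonneg _
  have hM : 0 ≤ M := abs_nonneg _
  refine ⟨(D * (D + 1) + 2 * (D + 1) * (1 + 2 * M) + 4 * D + 4 * M ^ 2 +
      (M * (2 * (2 * D + 2) + 4 * (2 * M + 1)) + 2 * M) + 16 * (M * (M + 1))), by positivity, ?_⟩
  intro z p q hz hp hpq hXYq
  have hX : 0 < ‖1 - z‖ := norm_pos_iff.2 (Complex.slitPlane_ne_zero (one_sub_mem_slitPlane hz))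
  have hY : 0 < ‖1 + z‖ := by
    have := one_sub_mem_slitPlane (z := -z) (by simpa using hz)
    rw [sub_neg_eq_add] at this
    exact norm_pos_iff.2 (Complex.slitPlane_ne_zero this)
  have hX2 : ‖1 - z‖ ≤ 2 := (norm_sub_le _ _).trans (by rw [norm_one]; linarith)
  have hY2 : ‖1 + z‖ ≤ 2 := (norm_add_le _ _).trans (by rw [norm_one]; linarith)
  have hXY : 2 ≤ ‖1 - z‖ + ‖1 + z‖ := by
    refine le_trans ?_ (norm_add_le _ _)
    rw [show (1 - z) + (1 + z) = 2 by ring]; norm_num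
  refine le_trans ?_ (cesB_majorant_le hD hM hX hY hX2 hY2 hXY hp hpq hXYq)
  have hq : 0 < q := hp.trans_le hpq
  have nD : ‖(δ : ℂ)‖ = D := by simp [hDdef]
  have nM : ‖(μ : ℂ)‖ = M := by simp [hMdef]
  have hz1 : ‖z‖ ≤ 1 := hz.le
  have hzsq : ‖1 - z ^ 2‖ = ‖1 - z‖ * ‖1 + z‖ := by rw [← norm_mul]; ring_nf
  have hA1 : ‖eulerA1 δ z‖ ≤ D * ‖1 + z‖ / ‖1 - z‖ + 1 := by
    rw [eulerA1, norm_mul]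
    refine (mul_le_of_le_one_left (norm_nonneg _) hz1).trans ((norm_add_le _ _).trans ?_)
    rw [norm_div, norm_mul, nD, norm_one]
  have hm : 0 ≤ D * ‖1 + z‖ / ‖1 - z‖ + 1 := by positivity
  have hA2 : ‖eulerA2 δ z‖ ≤ D / ‖1 - z‖ * (D * ‖1 + z‖ / ‖1 - z‖ + 1) +
      (D * ‖1 + z‖ / ‖1 - z‖ + 1) + 2 * D / ‖1 - z‖ ^ 2 := by
    rw [eulerA2]
    refine (norm_add_le _ _).trans (add_le_add ((norm_add_le _ _).trans (add_le_add ?_ hA1)) ?_)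
    · rw [norm_mul, norm_div, norm_mul, nD]
      refine mul_le_mul ?_ hA1 (norm_nonneg _) (by positivity)
      gcongr
      exact mul_le_of_le_one_right hD hz1
    · rw [norm_div, norm_mul, norm_mul, nD, norm_pow, norm_pow, Complex.norm_two]
      exact div_le_div_of_nonneg_right
        (mul_le_of_le_one_right (by positivity) (pow_le_one₀ (norm_nonneg _) hz1)) (by positivity)
  have h2μ : ‖(2 * μ + 1 : ℂ)‖ ≤ 2 * M + 1 := by
    refine (norm_add_le _ _).trans ?_
    rw [norm_mul, nM, Complex.norm_two, norm_one]
  rw [Fin.sum_univ_three, cesB_zero, cesB_one, cesB_two]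
  refine add_le_add (add_le_add ?_ ?_) ?_
  · simp only [Fin.val_zero, pow_zero, inv_one, mul_one]
    refine (norm_add_le _ _).trans (add_le_add ((norm_sub_le _ _).trans (add_le_add hA2 ?_)) ?_)
    · rw [norm_mul, norm_mul, nM, Complex.norm_two]
      gcongr
    · rw [norm_mul, norm_pow, nM]
  · simp only [Fin.val_one, pow_one]
    refine mul_le_mul_of_nonneg_right ?_ (by positivity)
    refine (norm_sub_le _ _).trans (add_le_add ?_ ?_)
    · rw [norm_mul, norm_mul, nM, hzsq]
      refine mul_le_mul_of_nonneg_left ((norm_sub_le _ _).trans (add_le_add ?_ ?_)) (by positivity)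
      · rw [norm_mul, Complex.norm_two]
        gcongr
      · rw [norm_mul]
        gcongr
    · rw [norm_mul, norm_mul, norm_mul, norm_pow, nM, Complex.norm_two]
      refine mul_le_mul_of_nonneg_right ?_ (norm_nonneg _)
      exact mul_le_of_le_one_right (by positivity) (pow_le_one₀ (norm_nonneg _) hz1)
  · refine mul_le_mul_of_nonneg_right ?_ (by positivity)
    rw [norm_mul, norm_mul, norm_mul, norm_pow, nM, hzsq]
    gcongr
    refine (norm_add_le _ _).trans ?_
    rw [nM, norm_one]

/-- The shifted product weight `∏ (x + |a_i|)^{-κ_i}`. -/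
noncomputable def shiftProd {m : ℕ} (κ a : Fin m → ℝ) (x : ℝ) : ℝ := ∏ i, (x + |a i|) ^ (-κ i)

theorem shiftProd_nonneg {m : ℕ} (κ a : Fin m → ℝ) {x : ℝ} (hx : 0 ≤ x) : 0 ≤ shiftProd κ a x :=
  prod_nonneg fun i _ => rpow_nonneg (by positivity) _

theorem shiftProd_le {m : ℕ} {κ : Fin m → ℝ} (hκ : ∀ i, 0 < κ i) (a : Fin m → ℝ) {x y : ℝ}
    (hx : 0 < x) (hxy : x ≤ 32 * y) :
    shiftProd κ a y ≤ (32 : ℝ) ^ (∑ i, κ i) * shiftProd κ a x := by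
  have hy : 0 < y := by linarith
  rw [shiftProd, shiftProd, rpow_sum_of_pos (by norm_num), ← prod_mul_distrib]
  refine prod_le_prod (fun i _ => rpow_nonneg (by positivity) _) fun i _ => ?_
  have h1 : 0 < y + |a i| := by positivity
  have h2 : 0 < x + |a i| := by positivity
  have h3 : (x + |a i|) / 32 ≤ y + |a i| := by
    have := abs_nonneg (a i)
    linarith
  calc (y + |a i|) ^ (-κ i) ≤ ((x + |a i|) / 32) ^ (-κ i) :=
        rpow_le_rpow_of_nonpos (by positivity) h3 (by linarith [hκ i])
    _ = _ := by
        rw [div_rpow h2.le (by norm_num), rpow_neg (by norm_num : (0 : ℝ) ≤ 32)]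
        field_simp

theorem jBound_eq_shiftProd {m : ℕ} (κ a : Fin m → ℝ) (e : ℝ) (k : ℕ) {x : ℝ} (hx : 0 < x) :
    jBound κ a ((∑ i, κ i) + e + k) x = (x ^ k)⁻¹ * (x ^ (-e) * shiftProd κ a x) := by
  rw [jBound, shiftProd, ← mul_assoc]
  congr 1
  rw [show (∑ i, κ i) - ((∑ i, κ i) + e + k) = -(k : ℝ) + -e by ring, rpow_add hx,
    rpow_neg hx.le, rpow_natCast]

/-- Value of the integrand majorant at a point whose nearest root of the quadratic is at distance
`p`. -/
noncomputable def contourMajorant {m : ℕ} (κ a : Fin m → ℝ) (δ e s N p X Y : ℝ) : ℝ :=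
  s ^ (-δ - e) * shiftProd κ a (s * N⁻¹) * p ^ (-2 - e) +
    s ^ (-(2 * e)) * shiftProd κ a (s ^ 2) * (X ^ (-δ - 2) + Y ^ (-δ - 2))

theorem sum_cesB_jBound_le_of_dist_le {m : ℕ} {κ : Fin m → ℝ} (hκ : ∀ i, 0 < κ i) {δ e : ℝ}
    (hδ : -1 < δ) (he : 1 ≤ e) (μ : ℝ) :
    ∃ C : ℝ, 0 < C ∧ ∀ (a : Fin m → ℝ) (z v w : ℂ) (N ρ : ℝ), 1 ≤ N → ‖z‖ = 1 - (2 * N)⁻¹ →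
      ‖v‖ = 1 → ‖w‖ = 1 → v * w = 1 → ‖z - v‖ ≤ ‖z - w‖ → 0 ≤ ρ → ρ ≤ ‖1 - v‖ → ρ ≤ ‖1 + v‖ →
      ‖1 - z‖ ^ (-δ) * ∑ k : Fin 3, ‖cesB δ μ z k‖ *
        jBound κ a ((∑ i, κ i) + e + (k : ℕ)) ‖(z - v) * (z - w)‖ ≤
      C * contourMajorant κ a δ e (ρ + N⁻¹) N ‖z - v‖ ‖1 - z‖ ‖1 + z‖ := by
  obtain ⟨C₁, hC₁, h₁⟩ := norm_cesB_le δ μ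
  obtain ⟨C₂, hC₂, h₂⟩ := contour_weight_le (e := e) (L := (32 : ℝ) ^ (∑ i, κ i)) hδ he
    (by positivity)
  refine ⟨C₁ * C₂, by positivity, ?_⟩
  intro a z v w N ρ hN hz hv hw hvw hpq hρ hρ1 hρ2
  have hN0 : 0 < N := by linarith
  have hNi : (2 * N)⁻¹ = N⁻¹ / 2 := by field_simp
  have hNi0 : 0 < N⁻¹ := by positivity
  have hz1 : ‖z‖ < 1 := by rw [hz, hNi]; linarith
  have hp2 : N⁻¹ ≤ 2 * ‖z - v‖ := by
    have := norm_sub_norm_le v z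
    rw [hv, hz, hNi, norm_sub_rev] at this
    linarith
  have hp : 0 < ‖z - v‖ := by linarith
  have hX : 0 < ‖1 - z‖ := norm_pos_iff.2 (Complex.slitPlane_ne_zero (one_sub_mem_slitPlane hz1))
  have hY : 0 < ‖1 + z‖ := by
    have := one_sub_mem_slitPlane (z := -z) (by simpa using hz1)
    rw [sub_neg_eq_add] at this
    exact norm_pos_iff.2 (Complex.slitPlane_ne_zero this)
  have hX2 : ‖1 - z‖ ≤ 2 := (norm_sub_le _ _).trans (by rw [norm_one]; linarith)
  have hY2 : ‖1 + z‖ ≤ 2 := (norm_add_le _ _).trans (by rw [norm_one]; linarith)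
  have hXY : 2 ≤ ‖1 - z‖ + ‖1 + z‖ := by
    refine le_trans ?_ (norm_add_le _ _)
    rw [show (1 - z) + (1 + z) = 2 by ring]; norm_num
  have hp3 : ‖z - v‖ ≤ 2 := (norm_sub_le _ _).trans (by linarith)
  have hXYq : ‖1 - z‖ * ‖1 + z‖ ≤ 4 * ‖z - w‖ := by
    have key : (1 - z) * (1 + z) = (z - v) * (z - w) - z * (z - w) - z * (z - v) := by
      linear_combination -hvw
    rw [← norm_mul, key]
    refine (norm_sub_le _ _).trans ((add_le_add_left (norm_sub_le _ _) _).trans ?_)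
    rw [norm_mul, norm_mul, norm_mul]
    nlinarith [norm_nonneg (z - w), norm_nonneg z]
  have hρX : ρ ≤ ‖1 - z‖ + ‖z - v‖ := hρ1.trans (norm_sub_le_norm_sub_add_norm_sub _ _ _)
  have hρY : ρ ≤ ‖1 + z‖ + ‖z - v‖ := by
    refine hρ2.trans ?_
    rw [show 1 + v = (1 + z) - (z - v) by ring]
    exact norm_sub_le _ _
  have hsq : ρ + N⁻¹ ≤ 8 * ‖z - w‖ := by
    rcases le_total 1 ‖1 - z‖ with h | h
    · nlinarith
    · have : 1 ≤ ‖1 + z‖ := by linarith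
      nlinarith
  have H₂ := h₂ (shiftProd κ a) N ‖1 - z‖ ‖1 + z‖ ‖z - v‖ ‖z - w‖ (ρ + N⁻¹)
    (fun x hx => shiftProd_nonneg κ a hx.le) (fun x y hx hxy => shiftProd_le hκ a hx hxy)
    hN0 hX hY hp (by positivity) hp2 hX2 hY2 hXY hXYq hsq (fun h => by linarith)
    (fun h => by rcases h with h | h <;> linarith)
  have H₁ := h₁ z ‖z - v‖ ‖z - w‖ hz1 hp hpq hXYq
  have hpq0 : 0 < ‖z - v‖ * ‖z - w‖ := mul_pos hp (hp.trans_le hpq)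
  have hR : 0 ≤ (‖z - v‖ * ‖z - w‖) ^ (-e) * shiftProd κ a (‖z - v‖ * ‖z - w‖) :=
    mul_nonneg (by positivity) (shiftProd_nonneg κ a hpq0.le)
  rw [norm_mul]
  calc _ = ‖1 - z‖ ^ (-δ) * ((∑ k : Fin 3, ‖cesB δ μ z k‖ *
            ((‖z - v‖ * ‖z - w‖) ^ (k : ℕ))⁻¹) *
          ((‖z - v‖ * ‖z - w‖) ^ (-e) * shiftProd κ a (‖z - v‖ * ‖z - w‖))) := by
        rw [sum_mul]
        congr 1
        refine sum_congr rfl fun k _ => ?_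
        rw [jBound_eq_shiftProd κ a e k hpq0]
        ring
    _ ≤ ‖1 - z‖ ^ (-δ) * (C₁ * (‖1 + z‖ * ((‖1 - z‖ ^ 2)⁻¹ + (‖1 + z‖ ^ 2)⁻¹ +
          (‖z - v‖ ^ 2)⁻¹)) *
          ((‖z - v‖ * ‖z - w‖) ^ (-e) * shiftProd κ a (‖z - v‖ * ‖z - w‖))) :=
        mul_le_mul_of_nonneg_left (mul_le_mul_of_nonneg_right H₁ hR) (by positivity)
    _ = C₁ * (‖1 - z‖ ^ (-δ) * (‖1 + z‖ * ((‖1 - z‖ ^ 2)⁻¹ + (‖1 + z‖ ^ 2)⁻¹ +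
          (‖z - v‖ ^ 2)⁻¹)) *
          ((‖z - v‖ * ‖z - w‖) ^ (-e) * shiftProd κ a (‖z - v‖ * ‖z - w‖))) := by ring
    _ ≤ _ := by
        rw [mul_assoc C₁ C₂]
        exact mul_le_mul_of_nonneg_left H₂ hC₁.le

theorem quad_cos_eq (φ : ℝ) (z : ℂ) :
    quad (Real.cos φ : ℝ) z = (z - circleMap 0 1 φ) * (z - circleMap 0 1 (-φ)) := by
  have h : circleMap 0 1 φ * circleMap 0 1 (-φ) = 1 := by
    simp [circleMap, ← Complex.exp_add]
  have h2 : circleMap 0 1 φ + circleMap 0 1 (-φ) = 2 * (Real.cos φ : ℝ) := by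
    rw [Complex.ofReal_cos, Complex.cos]
    simp [circleMap]
    ring
  rw [quad]
  linear_combination z * h2 - h

theorem sq_norm_one_sub_circleMap (φ : ℝ) : ‖1 - circleMap 0 1 φ‖ ^ 2 = 2 - 2 * Real.cos φ := by
  rw [← Complex.normSq_eq_norm_sq, Complex.normSq_apply]
  simp [circleMap, Complex.exp_ofReal_mul_I_re, Complex.exp_ofReal_mul_I_im]
  nlinarith [Real.sin_sq_add_cos_sq φ]

theorem sq_norm_one_add_circleMap (φ : ℝ) : ‖1 + circleMap 0 1 φ‖ ^ 2 = 2 + 2 * Real.cos φ := by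
  rw [← Complex.normSq_eq_norm_sq, Complex.normSq_apply]
  simp [circleMap, Complex.exp_ofReal_mul_I_re, Complex.exp_ofReal_mul_I_im]
  nlinarith [Real.sin_sq_add_cos_sq φ]

theorem contourMajorant_le {m : ℕ} (κ a : Fin m → ℝ) (δ e : ℝ) {s N p p' X Y : ℝ} (hs : 0 ≤ s)
    (hN : 0 ≤ N) (hp' : 0 ≤ p') :
    contourMajorant κ a δ e s N p X Y ≤
      s ^ (-δ - e) * shiftProd κ a (s * N⁻¹) * (p ^ (-2 - e) + p' ^ (-2 - e)) +
    s ^ (-(2 * e)) * shiftProd κ a (s ^ 2) * (X ^ (-δ - 2) + Y ^ (-δ - 2)) := by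
  rw [contourMajorant]
  refine add_le_add_left (mul_le_mul_of_nonneg_left ?_ ?_) _
  · linarith [rpow_nonneg hp' (-2 - e)]
  · exact mul_nonneg (by positivity) (shiftProd_nonneg _ _ (by positivity))

theorem sum_cesB_jBound_le {m : ℕ} {κ : Fin m → ℝ} (hκ : ∀ i, 0 < κ i) {δ e : ℝ}
    (hδ : -1 < δ) (he : 1 ≤ e) (μ : ℝ) :
    ∃ C : ℝ, 0 < C ∧ ∀ (a : Fin m → ℝ) (z : ℂ) (φ N ρ : ℝ), 1 ≤ N → ‖z‖ = 1 - (2 * N)⁻¹ →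
      0 ≤ ρ → ρ ^ 2 ≤ 2 - 2 * |Real.cos φ| →
      ‖1 - z‖ ^ (-δ) * ∑ k : Fin 3, ‖cesB δ μ z k‖ *
        jBound κ a ((∑ i, κ i) + e + (k : ℕ)) ‖quad (Real.cos φ : ℝ) z‖ ≤
      C * ((ρ + N⁻¹) ^ (-δ - e) * shiftProd κ a ((ρ + N⁻¹) * N⁻¹) *
          (‖z - circleMap 0 1 φ‖ ^ (-2 - e) + ‖z - circleMap 0 1 (-φ)‖ ^ (-2 - e)) +
        (ρ + N⁻¹) ^ (-(2 * e)) * shiftProd κ a ((ρ + N⁻¹) ^ 2) *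
          (‖1 - z‖ ^ (-δ - 2) + ‖1 + z‖ ^ (-δ - 2))) := by
  obtain ⟨C, hC, h⟩ := sum_cesB_jBound_le_of_dist_le hκ hδ he μ
  refine ⟨C, hC, ?_⟩
  intro a z φ N ρ hN hz hρ hρφ
  have hn (ψ : ℝ) : ‖circleMap 0 1 ψ‖ = 1 := by simp
  have hm (ψ : ℝ) : circleMap 0 1 ψ * circleMap 0 1 (-ψ) = 1 := by
    simp [circleMap, ← Complex.exp_add]
  have h1 (ψ : ℝ) (hψ : Real.cos ψ = Real.cos φ) : ρ ≤ ‖1 - circleMap 0 1 ψ‖ := by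
    refine (pow_le_pow_iff_left₀ hρ (norm_nonneg _) two_ne_zero).1 (hρφ.trans ?_)
    rw [sq_norm_one_sub_circleMap, hψ]
    linarith [le_abs_self (Real.cos φ)]
  have h2 (ψ : ℝ) (hψ : Real.cos ψ = Real.cos φ) : ρ ≤ ‖1 + circleMap 0 1 ψ‖ := by
    refine (pow_le_pow_iff_left₀ hρ (norm_nonneg _) two_ne_zero).1 (hρφ.trans ?_)
    rw [sq_norm_one_add_circleMap, hψ]
    linarith [neg_abs_le (Real.cos φ)]
  have hN0 : 0 ≤ N := by linarith
  rw [quad_cos_eq]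
  rcases le_total ‖z - circleMap 0 1 φ‖ ‖z - circleMap 0 1 (-φ)‖ with hle | hle
  · refine (h a z _ _ N ρ hN hz (hn _) (hn _) (hm φ) hle hρ (h1 φ rfl) (h2 φ rfl)).trans ?_
    exact mul_le_mul_of_nonneg_left (contourMajorant_le κ a δ e (by positivity) hN0
      (norm_nonneg _)) hC.le
  · rw [mul_comm (z - circleMap 0 1 φ), add_comm (‖z - circleMap 0 1 φ‖ ^ (-2 - e))]
    have hm' : circleMap 0 1 (-φ) * circleMap 0 1 φ = 1 := by rw [mul_comm, hm]
    refine (h a z _ _ N ρ hN hz (hn _) (hn _) hm' hle hρ (h1 _ (Real.cos_neg φ))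
      (h2 _ (Real.cos_neg φ))).trans ?_
    exact mul_le_mul_of_nonneg_left (contourMajorant_le κ a δ e (by positivity) hN0
      (norm_nonneg _)) hC.le

theorem sq_norm_circleMap_sub_one (r θ : ℝ) :
    ‖circleMap 0 r θ - 1‖ ^ 2 = (1 - r) ^ 2 + 2 * r * (1 - Real.cos θ) := by
  rw [← Complex.normSq_eq_norm_sq, Complex.normSq_apply]
  simp [circleMap, Complex.exp_ofReal_mul_I_re, Complex.exp_ofReal_mul_I_im]
  linear_combination r ^ 2 * Real.sin_sq_add_cos_sq θ

theorem norm_circleMap_sub_one_ge {N θ : ℝ} (hN : 1 ≤ N) (hθ : |θ| ≤ π) :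
    (N⁻¹ + |θ|) / 16 ≤ ‖circleMap 0 (1 - (2 * N)⁻¹) θ - 1‖ := by
  have hN0 : 0 < N := by linarith
  have hNi : (2 * N)⁻¹ = N⁻¹ / 2 := by field_simp
  have hN1 : N⁻¹ ≤ 1 := inv_le_one_of_one_le₀ hN
  have hNp : 0 < N⁻¹ := by positivity
  rw [hNi]
  have hsq := sq_norm_circleMap_sub_one (1 - N⁻¹ / 2) θ
  have hc1 := Real.cos_le_one θ
  have h1 : N⁻¹ / 2 ≤ ‖circleMap 0 (1 - N⁻¹ / 2) θ - 1‖ := by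
    refine (pow_le_pow_iff_left₀ (by positivity) (norm_nonneg _) two_ne_zero).1 ?_
    rw [hsq]
    have : 0 ≤ (1 - N⁻¹ / 2) * (1 - Real.cos θ) := mul_nonneg (by linarith) (by linarith)
    nlinarith
  have h2 : |θ| / 7 ≤ ‖circleMap 0 (1 - N⁻¹ / 2) θ - 1‖ := by
    refine (pow_le_pow_iff_left₀ (by positivity) (norm_nonneg _) two_ne_zero).1 ?_
    have hc := Real.cos_le_one_sub_mul_cos_sq hθ
    have hπ : (1 : ℝ) / 49 ≤ 2 / π ^ 2 := by
      rw [div_le_div_iff₀ (by norm_num) (by positivity)]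
      nlinarith [Real.pi_lt_four, Real.pi_pos]
    have h3 := mul_le_mul_of_nonneg_right hπ (sq_nonneg θ)
    have h4 : 0 ≤ (1 - N⁻¹) * (1 - Real.cos θ) := mul_nonneg (by linarith) (by linarith)
    rw [hsq, div_pow, sq_abs]
    nlinarith [sq_nonneg (N⁻¹ / 2)]
  linarith

theorem integral_add_abs_rpow_le {b c : ℝ} (hb : 1 < b) (hc : 0 < c) :
    ∫ θ in (-π)..π, (c + |θ|) ^ (-b) ≤ 2 / (b - 1) * c ^ (1 - b) := by
  have hcont : Continuous fun θ : ℝ => (c + |θ|) ^ (-b) :=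
    (continuous_const.add continuous_abs).rpow_const fun θ =>
      Or.inl (add_pos_of_pos_of_nonneg hc (abs_nonneg θ)).ne'
  have h1 : ∫ θ in (0 : ℝ)..π, (c + |θ|) ^ (-b) ≤ 1 / (b - 1) * c ^ (1 - b) := by
    have e1 : ∫ θ in (0 : ℝ)..π, (c + |θ|) ^ (-b) = ∫ θ in (0 : ℝ)..π, (c + θ) ^ (-b) := by
      refine intervalIntegral.integral_congr fun θ hθ => ?_
      rw [Set.uIcc_of_le pi_pos.le] at hθ
      simp only [abs_of_nonneg hθ.1]
    rw [e1, intervalIntegral.integral_comp_add_left (fun x => x ^ (-b)), add_zero,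
      integral_rpow (Or.inr ⟨by linarith, ?_⟩)]
    · have hp : 0 ≤ (c + π) ^ (-b + 1) := rpow_nonneg (by linarith [pi_pos]) _
      rw [show -b + 1 = -(b - 1) by ring, div_neg, show 1 - b = -(b - 1) by ring,
        ← neg_div, one_div_mul_eq_div]
      refine div_le_div_of_nonneg_right ?_ (by linarith)
      rw [show -b + 1 = -(b - 1) by ring] at hp
      linarith
    · rw [Set.uIcc_of_le (by linarith [pi_pos])]
      exact fun h => absurd h.1 (by linarith)
  have h2 : ∫ θ in (-π)..0, (c + |θ|) ^ (-b) = ∫ θ in (0 : ℝ)..π, (c + |θ|) ^ (-b) := by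
    have := intervalIntegral.integral_comp_neg (a := 0) (b := π) fun θ : ℝ => (c + |θ|) ^ (-b)
    simpa using this.symm
  rw [← intervalIntegral.integral_add_adjacent_intervals (hcont.intervalIntegrable (-π) 0)
    (hcont.intervalIntegrable 0 π), h2]
  calc _ ≤ 1 / (b - 1) * c ^ (1 - b) + 1 / (b - 1) * c ^ (1 - b) := add_le_add h1 h1
    _ = _ := by ring

theorem integral_norm_circleMap_sub_rpow_le {b : ℝ} (hb : 1 < b) :
    ∃ C : ℝ, 0 < C ∧ ∀ N φ : ℝ, 1 ≤ N →
      ∫ θ in (0 : ℝ)..2 * π, ‖circleMap 0 (1 - (2 * N)⁻¹) θ - circleMap 0 1 φ‖ ^ (-b) ≤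
        C * N ^ (b - 1) := by
  refine ⟨16 ^ b * (2 / (b - 1)), mul_pos (by positivity) (div_pos two_pos (by linarith)), ?_⟩
  intro N φ hN
  have hN0 : 0 < N := by linarith
  set r := 1 - (2 * N)⁻¹ with hr
  have hper : Function.Periodic
      (fun θ => ‖circleMap 0 r θ - circleMap 0 1 φ‖ ^ (-b)) (2 * π) := fun θ => by
    simp only [periodic_circleMap 0 r θ]
  have h := hper.intervalIntegral_add_eq 0 (-π + φ)
  rw [zero_add] at h
  rw [h, show -π + φ + 2 * π = π + φ by ring,
    ← intervalIntegral.integral_comp_add_right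
      (fun θ => ‖circleMap 0 r θ - circleMap 0 1 φ‖ ^ (-b)) φ]
  have hrot (θ : ℝ) : ‖circleMap 0 r (θ + φ) - circleMap 0 1 φ‖ = ‖circleMap 0 r θ - 1‖ := by
    rw [show circleMap 0 r (θ + φ) - circleMap 0 1 φ = (circleMap 0 r θ - 1) * circleMap 0 1 φ by
      simp [circleMap, add_mul, Complex.exp_add]; ring, norm_mul]
    simp
  simp only [hrot]
  have hpos (θ : ℝ) : 0 < N⁻¹ + |θ| := by positivity
  have hcont : Continuous fun θ : ℝ => (N⁻¹ + |θ|) ^ (-b) :=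
    (continuous_const.add continuous_abs).rpow_const fun θ => Or.inl (hpos θ).ne'
  have hle (θ : ℝ) (hθ : θ ∈ Set.Icc (-π) π) :
      ‖circleMap 0 r θ - 1‖ ^ (-b) ≤ 16 ^ b * (N⁻¹ + |θ|) ^ (-b) := by
    have := hpos θ
    refine (rpow_le_rpow_of_nonpos (by positivity)
      (norm_circleMap_sub_one_ge hN (abs_le.2 hθ)) (by linarith)).trans (le_of_eq ?_)
    rw [div_rpow this.le (by norm_num), rpow_neg (by norm_num : (0 : ℝ) ≤ 16)]
    field_simp
  have hcont2 : IntervalIntegrable (fun θ => ‖circleMap 0 r θ - 1‖ ^ (-b)) volume (-π) π := by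
    refine ContinuousOn.intervalIntegrable (ContinuousOn.rpow_const ?_ fun θ hθ => Or.inl ?_)
    · exact ((continuous_circleMap 0 r).sub continuous_const).norm.continuousOn
    · rw [Set.uIcc_of_le (by linarith [pi_pos])] at hθ
      have := hpos θ
      exact (lt_of_lt_of_le (by positivity) (norm_circleMap_sub_one_ge hN (abs_le.2 hθ))).ne'
  calc _ ≤ ∫ θ in (-π)..π, 16 ^ b * (N⁻¹ + |θ|) ^ (-b) :=
        intervalIntegral.integral_mono_on (by linarith [pi_pos]) hcont2
          ((continuous_const.mul hcont).intervalIntegrable _ _) hle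
    _ ≤ 16 ^ b * (2 / (b - 1) * N⁻¹ ^ (1 - b)) := by
        rw [intervalIntegral.integral_const_mul]
        exact mul_le_mul_of_nonneg_left (integral_add_abs_rpow_le hb (by positivity))
          (by positivity)
    _ = _ := by
        rw [inv_rpow hN0.le, ← rpow_neg hN0.le, neg_sub, mul_assoc]

theorem cesA_ge {δ : ℝ} (hδ : -1 < δ) :
    ∃ c : ℝ, 0 < c ∧ ∀ n : ℕ, 1 ≤ n → c * (n : ℝ) ^ δ ≤ cesA δ n := by
  have ht := Real.GammaSeq_tendsto_Gamma (δ + 1)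
  obtain ⟨B, hB⟩ := ht.bddAbove_range
  have hδ1 : 0 < δ + 1 := by linarith
  have hseq (n : ℕ) (hn : 1 ≤ n) :
      Real.GammaSeq (δ + 1) n * ((δ + 1 + n) * cesA δ n) = (n : ℝ) ^ (δ + 1) := by
    have hp := poch_pos hδ1 n
    have hf : (0 : ℝ) < (n.factorial : ℝ) := by positivity
    have e : ∏ j ∈ range (n + 1), (δ + 1 + (j : ℝ)) = poch (δ + 1) n * (δ + 1 + n) := by
      rw [prod_range_succ, poch]
    rw [Real.GammaSeq, e, cesA_eq hδ]
    have : 0 < δ + 1 + n := by positivity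
    field_simp
  have hB1 (n : ℕ) : Real.GammaSeq (δ + 1) n ≤ B := hB ⟨n, rfl⟩
  have hBpos : 0 < B := by
    have h1 := hseq 1 le_rfl
    have hA := cesA_pos hδ 1
    have : 0 < (δ + 1 + (1 : ℕ)) * cesA δ 1 := by positivity
    refine lt_of_lt_of_le ?_ (hB1 1)
    refine pos_of_mul_pos_left (b := (δ + 1 + (1 : ℕ)) * cesA δ 1) ?_ this.le
    rw [h1]
    positivity
  refine ⟨(B * (δ + 2))⁻¹, inv_pos.2 (mul_pos hBpos (by linarith)), ?_⟩
  intro n hn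
  have hn1 : (1 : ℝ) ≤ n := by exact_mod_cast hn
  have hn0 : (0 : ℝ) < n := by linarith
  have hA := cesA_pos hδ n
  have h2 : (n : ℝ) ^ (δ + 1) ≤ B * ((δ + 2) * n * cesA δ n) := by
    rw [← hseq n hn]
    refine mul_le_mul (hB1 n) (mul_le_mul_of_nonneg_right ?_ hA.le) (by positivity) hBpos.le
    nlinarith
  have h3 : 0 < B * (δ + 2) := mul_pos hBpos (by linarith)
  rw [inv_mul_le_iff₀ h3]
  rw [rpow_add hn0, rpow_one] at h2
  refine le_of_mul_le_mul_right ?_ hn0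
  linarith

theorem half_le_one_sub_inv_pow {n : ℕ} (hn : 1 ≤ n) :
    (1 : ℝ) / 2 ≤ (1 - (2 * (n : ℝ))⁻¹) ^ n := by
  have hn1 : (1 : ℝ) ≤ n := by exact_mod_cast hn
  have hi : (2 * (n : ℝ))⁻¹ ≤ 1 := inv_le_one_of_one_le₀ (by linarith)
  have := one_add_mul_le_pow (a := -(2 * (n : ℝ))⁻¹) (by linarith) n
  rw [← sub_eq_add_neg] at this
  refine le_trans (le_of_eq ?_) this
  field_simp
  norm_num

theorem ae_circleMap_im_ne_zero {r : ℝ} (hr : 0 < r) : ∀ᵐ θ : ℝ, (circleMap 0 r θ).im ≠ 0 := by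
  have hc : (Set.range fun n : ℤ => (n : ℝ) * π).Countable := Set.countable_range _
  filter_upwards [hc.ae_notMem volume] with θ hθ h
  apply hθ
  have h2 : Real.sin θ = 0 := by
    rw [circleMap, zero_add, Complex.im_ofReal_mul, Complex.exp_ofReal_mul_I_im] at h
    exact (mul_eq_zero.1 h).resolve_left hr.ne'
  exact Real.sin_eq_zero_iff.1 h2

theorem intervalIntegrable_norm_circleMap_sub_rpow {r : ℝ} (hr : 0 < r) (hr1 : r < 1) (φ b : ℝ) :
    IntervalIntegrable (fun θ => ‖circleMap 0 r θ - circleMap 0 1 φ‖ ^ b) volume 0 (2 * π) := by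
  refine Continuous.intervalIntegrable ?_ _ _
  refine ((continuous_circleMap 0 r).sub continuous_const).norm.rpow_const fun θ => Or.inl ?_
  refine norm_ne_zero_iff.2 (sub_ne_zero.2 fun h => ?_)
  have := congrArg (fun w : ℂ => ‖w‖) h
  simp [abs_of_pos hr] at this
  linarith

/-- Pointwise bound for the contour integrand in terms of distances to the singularities. -/
theorem norm_contour_integrand_le {d : ℕ} (hd : 1 ≤ d) {κ : Fin (d + 1) → ℝ} (hκ : ∀ i, 0 < κ i)
    {δ : ℝ} (hδ : -1 < δ) :
    ∃ C : ℝ, 0 < C ∧ ∀ (a : Fin (d + 1) → ℝ) (z : ℂ) (N ρ : ℝ), 1 ≤ N → ‖z‖ = 1 - (2 * N)⁻¹ →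
      z.im ≠ 0 → 0 ≤ ρ → ∑ i, |a i| ≤ 1 - ρ ^ 2 / 2 →
      ‖∑ k : Fin 3, (1 - z) ^ (-δ : ℂ) * cesB δ (lamK d κ + 1) z k *
          cubePhi κ a (lamK d κ + 1 + (k : ℕ)) z‖ ≤
      C * ∑ ε : Fin (d + 1) → Bool,
        ((ρ + N⁻¹) ^ (-δ - ((d : ℝ) + 1) / 2) * shiftProd κ a ((ρ + N⁻¹) * N⁻¹) *
          (‖z - circleMap 0 1 (arccos (∑ i, a i * boolSign (ε i)))‖ ^ (-2 - ((d : ℝ) + 1) / 2) +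
            ‖z - circleMap 0 1 (-arccos (∑ i, a i * boolSign (ε i)))‖ ^
              (-2 - ((d : ℝ) + 1) / 2)) +
        (ρ + N⁻¹) ^ (-(2 * (((d : ℝ) + 1) / 2))) * shiftProd κ a ((ρ + N⁻¹) ^ 2) *
          (‖1 - z‖ ^ (-δ - 2) + ‖1 + z‖ ^ (-δ - 2))) := by
  have hd1 : (1 : ℝ) ≤ d := by exact_mod_cast hd
  set e : ℝ := ((d : ℝ) + 1) / 2 with he
  have he1 : 1 ≤ e := by rw [he]; linarith
  have hlam : lamK d κ + 1 = (∑ i, κ i) + e := by rw [lamK, he]; ring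
  obtain ⟨C₁, hC₁, h₁⟩ := sum_cesB_jBound_le hκ hδ he1 (lamK d κ + 1)
  have hν (k : Fin 3) : ∑ i, κ i + 1 ≤ (∑ i, κ i) + e + (k : ℕ) := by
    have : (0 : ℝ) ≤ ((k : ℕ) : ℝ) := by positivity
    linarith
  choose C₂ hC₂ h₂ using fun k : Fin 3 => norm_cubePhi_le hκ (hν k)
  set S := ∑ k, C₂ k with hS
  have hS0 : 0 < S := sum_pos (fun k _ => hC₂ k) univ_nonempty
  refine ⟨S * C₁, by positivity, ?_⟩
  intro a z N ρ hN hz hzi hρ ha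
  have hN0 : 0 < N := by linarith
  have hNi : (2 * N)⁻¹ ≤ 1 / 2 := by
    rw [one_div]; exact inv_anti₀ (by norm_num) (by linarith)
  have hNi0 : 0 < (2 * N)⁻¹ := by positivity
  have ha1 : ∑ i, |a i| ≤ 1 := ha.trans (by nlinarith)
  have hz1 : ‖z‖ < 1 := by rw [hz]; linarith
  have hz2 : 1 / 2 ≤ ‖z‖ := by rw [hz]; linarith
  have hu (ε : Fin (d + 1) → Bool) : |∑ i, a i * boolSign (ε i)| ≤ 1 - ρ ^ 2 / 2 := by
    refine ((abs_sum_le_sum_abs _ _).trans (le_of_eq ?_)).trans ha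
    simp [abs_mul, abs_boolSign]
  have hcos (ε : Fin (d + 1) → Bool) :
      Real.cos (arccos (∑ i, a i * boolSign (ε i))) = ∑ i, a i * boolSign (ε i) := by
    have h := abs_le.1 (hu ε)
    exact Real.cos_arccos (by nlinarith) (by nlinarith)
  have hcp : ‖(1 - z) ^ (-δ : ℂ)‖ = ‖1 - z‖ ^ (-δ) := by
    rw [← Complex.ofReal_neg, Complex.norm_cpow_real]
  calc _ ≤ ∑ k : Fin 3, ‖1 - z‖ ^ (-δ) * ‖cesB δ (lamK d κ + 1) z k‖ *
        (S * ∑ ε : Fin (d + 1) → Bool, jBound κ a ((∑ i, κ i) + e + (k : ℕ))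
          ‖quad ((∑ i, a i * boolSign (ε i) : ℝ) : ℂ) z‖) := by
        refine norm_sum_le_of_le _ fun k _ => ?_
        rw [norm_mul, norm_mul, hcp, hlam]
        refine mul_le_mul_of_nonneg_left ((h₂ k a z ha1 hz2 hz1 hzi).trans ?_) (by positivity)
        refine mul_le_mul_of_nonneg_right ?_
          (sum_nonneg fun ε _ => jBound_nonneg κ a _ (norm_nonneg _))
        exact single_le_sum (fun k _ => (hC₂ k).le) (mem_univ k)
    _ = S * ∑ ε : Fin (d + 1) → Bool, ‖1 - z‖ ^ (-δ) * ∑ k : Fin 3,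
          ‖cesB δ (lamK d κ + 1) z k‖ * jBound κ a ((∑ i, κ i) + e + (k : ℕ))
            ‖quad ((∑ i, a i * boolSign (ε i) : ℝ) : ℂ) z‖ := by
        simp only [mul_sum]
        rw [sum_comm]
        refine sum_congr rfl fun ε _ => sum_congr rfl fun k _ => ?_
        ring
    _ ≤ _ := by
        rw [mul_assoc S, mul_sum _ _ C₁]
        refine mul_le_mul_of_nonneg_left (sum_le_sum fun ε _ => ?_) hS0.le
        have := h₁ a z (arccos (∑ i, a i * boolSign (ε i))) N ρ hN hz hρ (by
          rw [hcos]; linarith [hu ε])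
        rwa [hcos] at this

theorem sq_mul_cesA_mul_abs_hK_le {d : ℕ} (hd : 1 ≤ d) {κ : Fin (d + 1) → ℝ} (hκ : ∀ i, 0 < κ i)
    {δ : ℝ} (hδ : -1 < δ) :
    ∃ C : ℝ, 0 < C ∧ ∀ (n : ℕ) (x y : EuclideanSpace ℝ (Fin (d + 1))) (ρ : ℝ), 1 ≤ n → 0 ≤ ρ →
      ∑ i, |x i * y i| ≤ 1 - ρ ^ 2 / 2 →
      (n : ℝ) ^ 2 * (cesA δ n * |hK d κ δ n x y|) ≤
        C * ((ρ + (n : ℝ)⁻¹) ^ (-δ - ((d : ℝ) + 1) / 2) *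
            shiftProd κ (fun i => x i * y i) ((ρ + (n : ℝ)⁻¹) * (n : ℝ)⁻¹) *
            (n : ℝ) ^ (1 + ((d : ℝ) + 1) / 2) +
          (ρ + (n : ℝ)⁻¹) ^ (-((d : ℝ) + 1)) *
            shiftProd κ (fun i => x i * y i) ((ρ + (n : ℝ)⁻¹) ^ 2) * (n : ℝ) ^ (δ + 1)) := by
  have hd1 : (1 : ℝ) ≤ d := by exact_mod_cast hd
  set e : ℝ := ((d : ℝ) + 1) / 2 with he
  have he1 : 1 ≤ e := by rw [he]; linarith
  obtain ⟨C₀, hC₀, h₀⟩ := norm_contour_integrand_le hd hκ hδ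
  obtain ⟨C₁, hC₁, h₁⟩ := integral_norm_circleMap_sub_rpow_le (b := 2 + e) (by linarith)
  obtain ⟨C₂, hC₂, h₂⟩ := integral_norm_circleMap_sub_rpow_le (b := δ + 2) (by linarith)
  have hW := integral_wprod_pos hκ
  set W := ∫ t in cube (d + 1), wprod κ t with hWdef
  set K : ℝ := ((Fintype.card (Fin (d + 1) → Bool) : ℕ) : ℝ) with hKdef
  have hK0 : 0 < K := by rw [hKdef]; exact_mod_cast Fintype.card_pos
  refine ⟨W⁻¹ * ((2 * π)⁻¹ * (2 * (C₀ * (K * (2 * C₁ + 2 * C₂))))), by positivity, ?_⟩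
  intro n x y ρ hn hρ ha
  set a : Fin (d + 1) → ℝ := fun i => x i * y i with hadef
  have hn1 : (1 : ℝ) ≤ n := by exact_mod_cast hn
  have hn0 : (0 : ℝ) < n := by linarith
  set r : ℝ := 1 - (2 * (n : ℝ))⁻¹ with hr
  have hNi : (2 * (n : ℝ))⁻¹ ≤ 1 / 2 := by
    rw [one_div]; exact inv_anti₀ (by norm_num) (by linarith)
  have hNi0 : 0 < (2 * (n : ℝ))⁻¹ := by positivity
  have hr0 : 0 < r := by rw [hr]; linarith
  have hr1 : r < 1 := by rw [hr]; linarith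
  set s : ℝ := ρ + (n : ℝ)⁻¹ with hs
  have hs0 : 0 < s := by positivity
  set B₁ := s ^ (-δ - e) * shiftProd κ a (s * (n : ℝ)⁻¹) with hB₁
  set B₂ := s ^ (-(2 * e)) * shiftProd κ a (s ^ 2) with hB₂
  have hB₁0 : 0 ≤ B₁ := mul_nonneg (by positivity) (shiftProd_nonneg _ _ (by positivity))
  have hB₂0 : 0 ≤ B₂ := mul_nonneg (by positivity) (shiftProd_nonneg _ _ (by positivity))
  set D : ℝ → ℝ → ℝ → ℝ := fun φ b θ => ‖circleMap 0 r θ - circleMap 0 1 φ‖ ^ b with hD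
  have hDi (φ b : ℝ) : IntervalIntegrable (D φ b) volume 0 (2 * π) :=
    intervalIntegrable_norm_circleMap_sub_rpow hr0 hr1 φ b
  set Φ : (Fin (d + 1) → Bool) → ℝ := fun ε => arccos (∑ i, a i * boolSign (ε i)) with hΦ
  set G : (Fin (d + 1) → Bool) → ℝ → ℝ := fun ε θ =>
    B₁ * (D (Φ ε) (-(2 + e)) θ + D (-Φ ε) (-(2 + e)) θ) +
      B₂ * (D 0 (-(δ + 2)) θ + D π (-(δ + 2)) θ) with hG
  have hGi (ε) : IntervalIntegrable (G ε) volume 0 (2 * π) :=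
    (((hDi _ _).add (hDi _ _)).const_mul _).add (((hDi _ _).add (hDi _ _)).const_mul _)
  have hGle (ε) : ∫ θ in (0 : ℝ)..2 * π, G ε θ ≤ (2 * C₁ + 2 * C₂) *
      (B₁ * (n : ℝ) ^ (1 + e) + B₂ * (n : ℝ) ^ (δ + 1)) := by
    rw [hG]
    simp only
    rw [intervalIntegral.integral_add (((hDi _ _).add (hDi _ _)).const_mul _)
      (((hDi _ _).add (hDi _ _)).const_mul _), intervalIntegral.integral_const_mul,
      intervalIntegral.integral_const_mul, intervalIntegral.integral_add (hDi _ _) (hDi _ _),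
      intervalIntegral.integral_add (hDi _ _) (hDi _ _)]
    have i₁ (φ : ℝ) : ∫ θ in (0 : ℝ)..2 * π, D φ (-(2 + e)) θ ≤ C₁ * (n : ℝ) ^ (1 + e) := by
      have := h₁ n φ hn1
      rwa [show 2 + e - 1 = 1 + e by ring] at this
    have i₂ (φ : ℝ) : ∫ θ in (0 : ℝ)..2 * π, D φ (-(δ + 2)) θ ≤ C₂ * (n : ℝ) ^ (δ + 1) := by
      have := h₂ n φ hn1
      rwa [show δ + 2 - 1 = δ + 1 by ring] at this
    have j₁ := mul_le_mul_of_nonneg_left (add_le_add (i₁ (Φ ε)) (i₁ (-Φ ε))) hB₁0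
    have j₂ := mul_le_mul_of_nonneg_left (add_le_add (i₂ 0) (i₂ π)) hB₂0
    have k₁ : 0 ≤ C₂ * (B₁ * (n : ℝ) ^ (1 + e)) := by positivity
    have k₂ : 0 ≤ C₁ * (B₂ * (n : ℝ) ^ (δ + 1)) := by positivity
    linarith
  have hpow : ∀ θ, ‖((circleMap 0 r θ) ^ n)⁻¹‖ ≤ 2 := by
    intro θ
    rw [norm_inv, norm_pow, norm_circleMap_zero, abs_of_pos hr0]
    have := half_le_one_sub_inv_pow hn
    rw [inv_le_comm₀ (by positivity) (by norm_num)]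
    rw [hr]
    linarith
  have hpt : ∀ᵐ θ : ℝ, θ ∈ Set.Ioc 0 (2 * π) →
      ‖((circleMap 0 r θ) ^ n)⁻¹ * ∑ k : Fin 3, (1 - circleMap 0 r θ) ^ (-δ : ℂ) *
        cesB δ (lamK d κ + 1) (circleMap 0 r θ) k *
        cubePhi κ a (lamK d κ + 1 + (k : ℕ)) (circleMap 0 r θ)‖ ≤
      2 * (C₀ * ∑ ε, G ε θ) := by
    filter_upwards [ae_circleMap_im_ne_zero hr0] with θ hθ _
    rw [norm_mul]
    have hz : ‖circleMap 0 r θ‖ = 1 - (2 * (n : ℝ))⁻¹ := by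
      rw [norm_circleMap_zero, abs_of_pos hr0]
    refine mul_le_mul (hpow θ) ((h₀ a (circleMap 0 r θ) n ρ hn1 hz hθ hρ ha).trans
      (le_of_eq ?_)) (norm_nonneg _) zero_le_two
    have c0 : ‖1 - circleMap 0 r θ‖ = ‖circleMap 0 r θ - circleMap 0 1 0‖ := by
      rw [norm_sub_rev]; simp [circleMap]
    have cπ : ‖1 + circleMap 0 r θ‖ = ‖circleMap 0 r θ - circleMap 0 1 π‖ := by
      rw [add_comm]; simp [circleMap]
    rw [c0, cπ, show -2 - e = -(2 + e) by ring, show -δ - 2 = -(δ + 2) by ring]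
  have hint : IntervalIntegrable (fun θ => 2 * (C₀ * ∑ ε, G ε θ)) volume 0 (2 * π) := by
    refine (IntervalIntegrable.const_mul ?_ _).const_mul _
    have := IntervalIntegrable.sum univ fun ε _ => hGi ε
    simpa only [Finset.sum_fn] using this
  have hmain := congrArg norm (hK_eq_contour hd hκ hδ n (x := x) (y := y)
    (ha.trans (by nlinarith)) hr0 hr1)
  rw [norm_mul, norm_mul, norm_pow, Complex.norm_natCast, Complex.norm_real, Real.norm_eq_abs,
    abs_mul, abs_mul, abs_of_pos hW, abs_of_pos (cesA_pos hδ n)] at hmain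
  have hle := intervalIntegral.norm_integral_le_of_norm_le (by positivity) hpt hint
  have hsum : ∫ θ in (0 : ℝ)..2 * π, 2 * (C₀ * ∑ ε, G ε θ) ≤
      2 * (C₀ * (K * ((2 * C₁ + 2 * C₂) *
        (B₁ * (n : ℝ) ^ (1 + e) + B₂ * (n : ℝ) ^ (δ + 1))))) := by
    rw [intervalIntegral.integral_const_mul, intervalIntegral.integral_const_mul,
      intervalIntegral.integral_finsetSum fun ε _ => hGi ε]
    refine mul_le_mul_of_nonneg_left (mul_le_mul_of_nonneg_left ?_ hC₀.le) zero_le_two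
    refine (sum_le_sum fun ε _ => hGle ε).trans (le_of_eq ?_)
    rw [sum_const, nsmul_eq_mul, hKdef, card_univ]
  have hpi : ‖((2 * π : ℂ))⁻¹‖ = (2 * π)⁻¹ := by
    rw [norm_inv, norm_mul, Complex.norm_two, Complex.norm_real, Real.norm_eq_abs,
      abs_of_pos pi_pos]
  rw [hpi] at hmain
  have h2e : -((d : ℝ) + 1) = -(2 * e) := by rw [he]; ring
  rw [h2e]
  have hfin := mul_le_mul_of_nonneg_left (hle.trans hsum)
    (show 0 ≤ W⁻¹ * (2 * π)⁻¹ by positivity)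
  calc _ = W⁻¹ * ((n : ℝ) ^ 2 * (cesA δ n * |hK d κ δ n x y| * W)) := by field_simp
    _ = W⁻¹ * (2 * π)⁻¹ * _ := by rw [hmain, mul_assoc]
    _ ≤ _ := hfin
    _ = _ := by ring

theorem sum_abs_mul_eq_of_mem_sphere {m : ℕ} {x y : EuclideanSpace ℝ (Fin m)}
    (hx : x ∈ Metric.sphere (0 : EuclideanSpace ℝ (Fin m)) 1)
    (hy : y ∈ Metric.sphere (0 : EuclideanSpace ℝ (Fin m)) 1) :
    ∑ i, |x i * y i| = 1 - ‖ebar x - ebar y‖ ^ 2 / 2 := by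
  have hx2 : ∑ i, x i ^ 2 = 1 := by
    have := EuclideanSpace.norm_sq_eq x
    rw [mem_sphere_zero_iff_norm.1 hx] at this
    simpa using this.symm
  have hy2 : ∑ i, y i ^ 2 = 1 := by
    have := EuclideanSpace.norm_sq_eq y
    rw [mem_sphere_zero_iff_norm.1 hy] at this
    simpa using this.symm
  have h : ‖ebar x - ebar y‖ ^ 2 = ∑ i, (x i ^ 2 + y i ^ 2 - 2 * |x i * y i|) := by
    rw [EuclideanSpace.norm_sq_eq]
    refine sum_congr rfl fun i _ => ?_
    have e : (ebar x - ebar y) i = |x i| - |y i| := rfl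
    rw [e, Real.norm_eq_abs, sq_abs, abs_mul, sub_sq, sq_abs, sq_abs]
    ring
  rw [h, sum_sub_distrib, sum_add_distrib, hx2, hy2, ← mul_sum]
  ring

/-- Theorem 2.1, Cesàro kernel estimate on the sphere:
for `δ > -1` there is `c > 0` (depending only on `d, κ, δ`) such that for all `n ≥ 1`
and `x, y ∈ S^d`,
`|K_n^δ(h_κ²;x,y)| ≤ c [ ∏ (|x_j y_j| + n⁻¹‖x̄-ȳ‖ + n⁻²)^{-κ_j} / (n^{δ-(d-1)/2} (‖x̄-ȳ‖+n⁻¹)^{δ+(d+1)/2})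
  + ∏ (|x_j y_j| + ‖x̄-ȳ‖² + n⁻²)^{-κ_j} / (n (‖x̄-ȳ‖+n⁻¹)^{d+1}) ]`. -/
theorem cesaro_kernel_estimate_sphere (d : ℕ) (hd : 1 ≤ d) (κ : Fin (d + 1) → ℝ)
    (hκ : ∀ i, 0 < κ i) (δ : ℝ) (hδ : -1 < δ) :
    ∃ c : ℝ, 0 < c ∧ ∀ n : ℕ, 1 ≤ n → ∀ x y : EuclideanSpace ℝ (Fin (d + 1)),
      x ∈ Metric.sphere (0 : EuclideanSpace ℝ (Fin (d + 1))) 1 →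
      y ∈ Metric.sphere (0 : EuclideanSpace ℝ (Fin (d + 1))) 1 →
      |hK d κ δ n x y| ≤
        c * ((∏ j, (|x j * y j| + (n : ℝ)⁻¹ * ‖ebar x - ebar y‖ + ((n : ℝ) ^ 2)⁻¹) ^ (-κ j)) /
              ((n : ℝ) ^ (δ - ((d : ℝ) - 1) / 2) *
                (‖ebar x - ebar y‖ + (n : ℝ)⁻¹) ^ (δ + ((d : ℝ) + 1) / 2)) +
            (∏ j, (|x j * y j| + ‖ebar x - ebar y‖ ^ 2 + ((n : ℝ) ^ 2)⁻¹) ^ (-κ j)) /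
              ((n : ℝ) * (‖ebar x - ebar y‖ + (n : ℝ)⁻¹) ^ ((d : ℝ) + 1))) := by
  obtain ⟨C, hC, h⟩ := sq_mul_cesA_mul_abs_hK_le hd hκ hδ
  obtain ⟨c, hc, hA⟩ := cesA_ge hδ
  refine ⟨C / c, by positivity, ?_⟩
  intro n hn x y hx hy
  set ρ := ‖ebar x - ebar y‖ with hρdef
  have hρ : 0 ≤ ρ := norm_nonneg _
  have hn1 : (1 : ℝ) ≤ n := by exact_mod_cast hn
  have hn0 : (0 : ℝ) < n := by linarith
  have H := h n x y ρ hn hρ (sum_abs_mul_eq_of_mem_sphere hx hy).le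
  set s := ρ + (n : ℝ)⁻¹ with hs
  have hs0 : 0 < s := by positivity
  have e1 : shiftProd κ (fun i => x i * y i) (s * (n : ℝ)⁻¹) =
      ∏ j, (|x j * y j| + (n : ℝ)⁻¹ * ρ + ((n : ℝ) ^ 2)⁻¹) ^ (-κ j) := by
    refine prod_congr rfl fun j _ => ?_
    congr 1
    rw [hs]
    ring
  have e2 : shiftProd κ (fun i => x i * y i) (s ^ 2) ≤
      ∏ j, (|x j * y j| + ρ ^ 2 + ((n : ℝ) ^ 2)⁻¹) ^ (-κ j) := by
    refine prod_le_prod (fun j _ => by positivity) fun j _ => ?_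
    refine rpow_le_rpow_of_nonpos (by positivity) ?_ (by linarith [hκ j])
    have h2 : ((n : ℝ) ^ 2)⁻¹ = (n : ℝ)⁻¹ ^ 2 := (inv_pow _ _).symm
    have h3 : 0 ≤ ρ * (n : ℝ)⁻¹ := by positivity
    rw [h2, hs]
    linarith
  rw [e1] at H
  set P₁ := ∏ j, (|x j * y j| + (n : ℝ)⁻¹ * ρ + ((n : ℝ) ^ 2)⁻¹) ^ (-κ j)
  set P₂ := ∏ j, (|x j * y j| + ρ ^ 2 + ((n : ℝ) ^ 2)⁻¹) ^ (-κ j)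
  have h1 : c * (n : ℝ) ^ (δ + 2) * |hK d κ δ n x y| ≤
      C * (s ^ (-δ - ((d : ℝ) + 1) / 2) * P₁ * (n : ℝ) ^ (1 + ((d : ℝ) + 1) / 2) +
        s ^ (-((d : ℝ) + 1)) * P₂ * (n : ℝ) ^ (δ + 1)) := by
    refine le_trans ?_ (H.trans ?_)
    · rw [rpow_add hn0, rpow_two]
      have := mul_le_mul_of_nonneg_left (hA n hn)
        (show 0 ≤ (n : ℝ) ^ 2 * |hK d κ δ n x y| by positivity)
      linarith
    · gcongr
  have h2 : (n : ℝ) ^ (1 + ((d : ℝ) + 1) / 2) =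
      (n : ℝ) ^ (δ + 2) * ((n : ℝ) ^ (δ - ((d : ℝ) - 1) / 2))⁻¹ := by
    rw [← rpow_neg hn0.le, ← rpow_add hn0]
    congr 1
    ring
  have h3 : (n : ℝ) ^ (δ + 1) = (n : ℝ) ^ (δ + 2) * (n : ℝ)⁻¹ := by
    rw [← rpow_neg_one, ← rpow_add hn0]
    congr 1
    ring
  have h4 : s ^ (-δ - ((d : ℝ) + 1) / 2) = (s ^ (δ + ((d : ℝ) + 1) / 2))⁻¹ := by
    rw [← rpow_neg hs0.le]
    congr 1
    ring
  rw [h2, h3, h4, rpow_neg hs0.le] at h1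
  have hnp : 0 < (n : ℝ) ^ (δ + 2) := by positivity
  rw [div_mul_eq_mul_div, le_div_iff₀ hc]
  refine le_of_mul_le_mul_right (le_trans (le_of_eq ?_) (h1.trans (le_of_eq ?_))) hnp
  · ring
  · simp only [div_eq_mul_inv, mul_inv]
    ring
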